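/- Let p be a prime, F = ℚ(√p), and H the totally definite quaternion F-algebra that is unramified at every finite place of F. Then there exists a maximal O_F-order 𝒪 in H whose unit group 𝒪^× contains a finite non-abelian subgroup if and only if p ≢ 1 (mod 24). -/

import Mathlib

open NumberField Quaternion

noncomputable section

namespace QuatPaper

variable (F : Type) [Field F] [NumberField F]

def scalarSet (H : Type) [Ring H] [Algebra F H] : Set H :=
  Set.range fun r : 𝓞 F => algebraMap F H (algebraMap (𝓞 F) F r)

def IsOrder {H : Type} [Ring H] [Algebra F H] (O : Subring H) : Prop :=
  scalarSet F H ⊆ ↑O ∧ O.toAddSubgroup.FG ∧ Submodule.span F (O : Set H) = ⊤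

def IsMaximalOrder {H : Type} [Ring H] [Algebra F H] (O : Subring H) : Prop :=
  IsOrder F O ∧ ∀ O' : Subring H, IsOrder F O' → O ≤ O' → O' = O

def IsScalarUnit {H : Type} [Ring H] [Algebra F H] {O : Subring H} (u : (↥O)ˣ) : Prop :=
  ∃ r : (𝓞 F)ˣ, ((u : ↥O) : H) = algebraMap F H (algebraMap (𝓞 F) F ↑r)

def RedUnitIso {H : Type} [Ring H] [Algebra F H] (O : Subring H) (G : Type*) [Group G] : Prop :=
  ∃ φ : (↥O)ˣ →* G, Function.Surjective φ ∧ ∀ u, φ u = 1 ↔ IsScalarUnit F u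

def IsConjugate {H : Type} [Ring H] (x : Hˣ) (O O' : Subring H) : Prop :=
  ∀ y : H, y ∈ O ↔ (x : H) * y * ((x⁻¹ : Hˣ) : H) ∈ O'

def ConjRel {H : Type} [Ring H] (O O' : Subring H) : Prop :=
  ∃ x : Hˣ, IsConjugate x O O'

def typeNum (H : Type) [Ring H] [Algebra F H] (G : Type*) [Group G] : ℕ :=
  Nat.card (Quot fun O O' : {O : Subring H // IsMaximalOrder F O ∧ RedUnitIso F O G} =>
    ConjRel O.1 O'.1)

def IsQuatAlg (H : Type) [Ring H] [Algebra F H] : Prop :=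
  ∃ a b : F, a ≠ 0 ∧ b ≠ 0 ∧ Nonempty (H ≃ₐ[F] ℍ[F, a, b])

def TotallyDefinite (H : Type) [Ring H] [Algebra F H] : Prop :=
  ∀ σ : F →+* ℝ,
    letI : Algebra F ℝ := σ.toAlgebra
    ∀ x : TensorProduct F ℝ H, x ≠ 0 → IsUnit x

section WittGroup

open Module

variable {K : Type} [Field K] {ι κ : Type} [Fintype ι] [Fintype κ]

/-- The diagonal form with coefficients `a` has a totally isotropic subspace of at least half
the dimension. -/
def Metab (a : ι → Kˣ) : Prop :=
  ∃ M : Submodule K (ι → K), (∀ x ∈ M, ∀ y ∈ M, ∑ i, (a i : K) * x i * y i = 0) ∧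
    Fintype.card ι ≤ 2 * finrank K M

theorem Metab.reindex {a : ι → Kˣ} (h : Metab a) (e : κ ≃ ι) : Metab (a ∘ e) := by
  obtain ⟨M, hM, hd⟩ := h
  refine ⟨M.map (LinearEquiv.funCongrLeft K K e).toLinearMap, ?_, ?_⟩
  · rintro _ ⟨x, hx, rfl⟩ _ ⟨y, hy, rfl⟩
    rw [← hM x hx y hy, ← Equiv.sum_comp e]
    rfl
  · rw [Fintype.card_congr e]
    refine hd.trans_eq ?_
    congr 1
    exact (LinearEquiv.finrank_eq ((LinearEquiv.funCongrLeft K K e).submoduleMap M))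

/-- A pair of isometrically embedded families of the same size gives a Lagrangian. -/
theorem Metab.of_isometry {a : ι → Kˣ} {b : κ → Kˣ} (f : (ι → K) →ₗ[K] (κ → K))
    (hf : ∀ x y, ∑ j, (b j : K) * f x j * f y j = ∑ i, (a i : K) * x i * y i)
    (hc : Fintype.card κ ≤ Fintype.card ι) : Metab (Sum.elim a (fun j => -b j)) := by
  let g : (ι → K) →ₗ[K] (ι ⊕ κ → K) :=
    (LinearEquiv.sumArrowLequivProdArrow ι κ K K).symm.toLinearMap ∘ₗ
      (LinearMap.id.prod f)
  have hg : ∀ x, g x = Sum.elim x (f x) := fun x => rfl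
  have hinj : Function.Injective g := fun x y hxy => by
    rw [hg, hg] at hxy
    ext i
    exact congrFun hxy (Sum.inl i)
  refine ⟨LinearMap.range g, ?_, ?_⟩
  · rintro _ ⟨x, rfl⟩ _ ⟨y, rfl⟩
    simp only [hg, Fintype.sum_sum_type, Sum.elim_inl, Sum.elim_inr, Units.val_neg, neg_mul,
      Finset.sum_neg_distrib, hf]
    simp
  · rw [LinearMap.finrank_range_of_inj hinj]
    simp
    omega

theorem Metab.sum {a : ι → Kˣ} {b : κ → Kˣ} (ha : Metab a) (hb : Metab b) :
    Metab (Sum.elim a b) := by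
  obtain ⟨M, hM, hMd⟩ := ha
  obtain ⟨N, hN, hNd⟩ := hb
  let g : (M × N) →ₗ[K] (ι ⊕ κ → K) :=
    (LinearEquiv.sumArrowLequivProdArrow ι κ K K).symm.toLinearMap ∘ₗ
      (M.subtype.prodMap N.subtype)
  have hg : ∀ x, g x = Sum.elim (x.1 : ι → K) (x.2 : κ → K) := fun x => rfl
  have hinj : Function.Injective g := fun x y hxy => by
    rw [hg, hg] at hxy
    ext i
    exacts [congrFun hxy (Sum.inl i), congrFun hxy (Sum.inr i)]
  refine ⟨LinearMap.range g, ?_, ?_⟩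
  · rintro _ ⟨x, rfl⟩ _ ⟨y, rfl⟩
    simp only [hg, Fintype.sum_sum_type, Sum.elim_inl, Sum.elim_inr]
    rw [hM _ x.1.2 _ y.1.2, hN _ x.2.2 _ y.2.2, add_zero]
  · rw [LinearMap.finrank_range_of_inj hinj, Module.finrank_prod]
    simp
    omega

theorem finrank_le_of_orthogonal (b : κ → Kˣ) (N R : Submodule K (κ → K))
    (h : ∀ x ∈ N, ∀ y ∈ R, ∑ i, (b i : K) * x i * y i = 0) :
    finrank K R + finrank K N ≤ Fintype.card κ := by
  classical
  let B : LinearMap.BilinForm K (κ → K) := Matrix.toBilin' (Matrix.diagonal fun i => (b i : K))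
  have hB : ∀ x y, B x y = ∑ i, (b i : K) * x i * y i := fun x y => by
    simp only [B, Matrix.toBilin'_apply', Matrix.mulVec_diagonal, dotProduct]
    exact Finset.sum_congr rfl fun i _ => by ring
  have hnd : B.Nondegenerate := by
    rw [LinearMap.BilinForm.nondegenerate_toBilin'_iff_det_ne_zero, Matrix.det_diagonal]
    exact Finset.prod_ne_zero_iff.mpr fun i _ => (b i).ne_zero
  have h1 : R ≤ B.orthogonal N := fun y hy x hx => by
    change B x y = 0
    rw [hB, h x hx y hy]
  have h2 := Submodule.finrank_mono h1
  rw [LinearMap.BilinForm.finrank_orthogonal hnd] at h2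
  have h3 := Submodule.finrank_le N
  rw [Module.finrank_fintype_fun_eq_card] at *
  omega

theorem Metab.cancel {a : ι → Kˣ} {b : κ → Kˣ} (hab : Metab (Sum.elim a b)) (hb : Metab b) :
    Metab a := by
  obtain ⟨M, hM, hMd⟩ := hab
  obtain ⟨N, hN, hNd⟩ := hb
  let p1 : (ι ⊕ κ → K) →ₗ[K] (ι → K) := LinearMap.funLeft K K Sum.inl
  let p2 : (ι ⊕ κ → K) →ₗ[K] (κ → K) := LinearMap.funLeft K K Sum.inr
  have hM' : ∀ x ∈ M, ∀ y ∈ M, ∑ i, (a i : K) * p1 x i * p1 y i +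
      ∑ i, (b i : K) * p2 x i * p2 y i = 0 := fun x hx y hy => by
    rw [← hM x hx y hy, Fintype.sum_sum_type]
    rfl
  let N' : Submodule K (κ → K) := N ⊓ (M ⊓ LinearMap.ker p1).map p2
  let T : (M × N) →ₗ[K] (κ → K) := (p2 ∘ₗ M.subtype).coprod (-N.subtype)
  have hT : ∀ x : M × N, T x = p2 x.1 - x.2 := fun x => by simp [T, sub_eq_add_neg]
  have hrange := finrank_le_of_orthogonal b N' (LinearMap.range T) (by
    rintro x ⟨hx, ⟨z, ⟨hz, hz0⟩, rfl⟩⟩ _ ⟨⟨m, n⟩, rfl⟩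
    have h1 := hM' z hz m m.2
    have h2 := hN _ hx n n.2
    have h0 : p1 z = 0 := hz0
    rw [h0] at h1
    simp only [hT, Pi.sub_apply, mul_sub, Finset.sum_sub_distrib]
    rw [h2]
    simpa using h1)
  let S : LinearMap.ker T →ₗ[K] (ι → K) := p1 ∘ₗ M.subtype ∘ₗ LinearMap.fst K M N ∘ₗ
    (LinearMap.ker T).subtype
  have hS : ∀ x, S x = p1 x.1.1 := fun x => rfl
  have hker : finrank K (LinearMap.ker S) ≤ finrank K N' := by
    let R : LinearMap.ker S →ₗ[K] (κ → K) := p2 ∘ₗ M.subtype ∘ₗ LinearMap.fst K M N ∘ₗ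
      (LinearMap.ker T).subtype ∘ₗ (LinearMap.ker S).subtype
    have hTx : ∀ x : LinearMap.ker S, p2 x.1.1.1 = x.1.1.2 := fun x => by
      have := x.1.2
      rw [LinearMap.mem_ker, hT, sub_eq_zero] at this
      exact this
    have hR : Function.Injective R := by
      intro x y hxy
      have h1 : p2 x.1.1.1 = p2 y.1.1.1 := hxy
      have h2 : p1 x.1.1.1 = p1 y.1.1.1 :=
        (show p1 x.1.1.1 = 0 from x.2).trans (show p1 y.1.1.1 = 0 from y.2).symm
      have h3 := hTx x
      have h4 := hTx y
      refine Subtype.ext (Subtype.ext (Prod.ext (Subtype.ext (funext fun i => ?_))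
        (Subtype.ext ?_)))
      · rcases i with i | i
        exacts [congrFun h2 i, congrFun h1 i]
      · rw [← h3, ← h4, h1]
    rw [← LinearMap.finrank_range_of_inj hR]
    apply Submodule.finrank_mono
    rintro _ ⟨x, rfl⟩
    refine ⟨?_, ⟨x.1.1.1, ⟨x.1.1.1.2, x.2⟩, rfl⟩⟩
    change p2 x.1.1.1 ∈ N
    rw [hTx x]
    exact x.1.1.2.2
  refine ⟨LinearMap.range S, ?_, ?_⟩
  · rintro _ ⟨x, rfl⟩ _ ⟨y, rfl⟩
    have h1 := hM' _ x.1.1.2 _ y.1.1.2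
    have hx := x.2
    have hy := y.2
    rw [LinearMap.mem_ker, hT, sub_eq_zero] at hx hy
    rw [hx, hy, hN _ x.1.2.2 _ y.1.2.2, add_zero] at h1
    exact h1
  · have e1 := LinearMap.finrank_range_add_finrank_ker (V := LinearMap.ker T) S
    have e2 := LinearMap.finrank_range_add_finrank_ker T
    rw [Module.finrank_prod] at e2
    rw [Fintype.card_sum] at hMd
    omega

/-- Sum of the one-dimensional classes of a family, in the free group on `Kˣ`. -/
def famSum (a : ι → Kˣ) : Kˣ →₀ ℤ := ∑ i, Finsupp.single (a i) 1

variable (K) in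
def metabSubgroup : AddSubgroup (Kˣ →₀ ℤ) :=
  AddSubgroup.closure {g | ∃ (n : ℕ) (a : Fin n → Kˣ), Metab a ∧ g = famSum a}

theorem famSum_sum (a : ι → Kˣ) (b : κ → Kˣ) :
    famSum (Sum.elim a b) = famSum a + famSum b := by
  simp [famSum, Fintype.sum_sum_type]

theorem famSum_comp (a : ι → Kˣ) (e : κ ≃ ι) : famSum (a ∘ e) = famSum a :=
  Equiv.sum_comp e fun i => Finsupp.single (a i) (1 : ℤ)

theorem famSum_apply (a : ι → Kˣ) (u : Kˣ) :
    famSum a u = Nat.card {i // a i = u} := by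
  classical
  simp [famSum, Finsupp.finsetSum_apply, Finsupp.single_apply, Finset.sum_boole,
    Fintype.card_subtype]

theorem exists_equiv_of_famSum_eq {a : ι → Kˣ} {b : κ → Kˣ} (h : famSum a = famSum b) :
    ∃ e : ι ≃ κ, a = b ∘ e := by
  have hu : ∀ u, Nonempty ({i // a i = u} ≃ {i // b i = u}) := fun u => by
    have := DFunLike.congr_fun h u
    rw [famSum_apply, famSum_apply] at this
    exact Finite.card_eq.mp (by exact_mod_cast this)
  refine ⟨Equiv.ofFiberEquiv fun u => (hu u).some, funext fun i => ?_⟩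
  exact (Equiv.ofFiberEquiv_map _ i).symm

theorem Metab.of_famSum_eq {a : ι → Kˣ} {b : κ → Kˣ} (hb : Metab b) (h : famSum a = famSum b) :
    Metab a := by
  obtain ⟨e, rfl⟩ := exists_equiv_of_famSum_eq h
  exact hb.reindex e

theorem famSum_mem_of_metab {a : ι → Kˣ} (h : Metab a) : famSum a ∈ metabSubgroup K :=
  AddSubgroup.subset_closure ⟨_, a ∘ (Fintype.equivFin ι).symm, h.reindex _,
    (famSum_comp a _).symm⟩

theorem exists_metab_of_mem {g : Kˣ →₀ ℤ} (hg : g ∈ metabSubgroup K) :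
    ∃ (m n : ℕ) (a : Fin m → Kˣ) (b : Fin n → Kˣ), Metab a ∧ Metab b ∧
      g + famSum b = famSum a := by
  have hnil : Metab (Fin.elim0 : Fin 0 → Kˣ) := ⟨⊤, by simp, by simp⟩
  have hnil' : famSum (Fin.elim0 : Fin 0 → Kˣ) = 0 := by simp [famSum]
  induction hg using AddSubgroup.closure_induction with
  | mem x hx =>
    obtain ⟨n, a, ha, rfl⟩ := hx
    exact ⟨n, 0, a, _, ha, hnil, by rw [hnil', add_zero]⟩
  | zero => exact ⟨0, 0, _, _, hnil, hnil, by simp⟩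
  | add x y _ _ hx hy =>
    obtain ⟨m, n, a, b, ha, hb, h⟩ := hx
    obtain ⟨m', n', a', b', ha', hb', h'⟩ := hy
    refine ⟨m + m', n + n', Sum.elim a a' ∘ finSumFinEquiv.symm,
      Sum.elim b b' ∘ finSumFinEquiv.symm, (ha.sum ha').reindex _, (hb.sum hb').reindex _, ?_⟩
    rw [famSum_comp, famSum_comp, famSum_sum, famSum_sum, ← h, ← h']
    abel
  | neg x _ hx =>
    obtain ⟨m, n, a, b, ha, hb, h⟩ := hx
    exact ⟨n, m, b, a, hb, ha, by rw [← h]; abel⟩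

theorem famSum_mem_iff {a : ι → Kˣ} : famSum a ∈ metabSubgroup K ↔ Metab a := by
  refine ⟨fun h => ?_, famSum_mem_of_metab⟩
  obtain ⟨m, n, b, c, hb, hc, h⟩ := exists_metab_of_mem h
  rw [← famSum_sum] at h
  exact (hb.of_famSum_eq h).cancel hc

variable (K) in
/-- The Witt group of diagonal forms over `K`. -/
def Witt : Type := (Kˣ →₀ ℤ) ⧸ metabSubgroup K

instance : AddCommGroup (Witt K) := inferInstanceAs (AddCommGroup ((Kˣ →₀ ℤ) ⧸ metabSubgroup K))

/-- The class of the one-dimensional form `⟨a⟩`. -/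
def cls (a : Kˣ) : Witt K := QuotientAddGroup.mk' (metabSubgroup K) (Finsupp.single a 1)

theorem sum_cls (a : ι → Kˣ) :
    ∑ i, cls (a i) = QuotientAddGroup.mk' (metabSubgroup K) (famSum a) := by
  rw [famSum, map_sum]
  rfl

theorem sum_cls_eq_zero_iff {a : ι → Kˣ} : ∑ i, cls (a i) = 0 ↔ Metab a := by
  rw [sum_cls, ← famSum_mem_iff]
  exact QuotientAddGroup.eq_zero_iff _

end WittGroup

section WittLift

open Module

variable {K : Type} [Field K] {ι κ : Type} [Fintype ι] [Fintype κ] {A : Type} [AddCommGroup A]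

theorem cls_neg (a : Kˣ) : cls (-a) = -cls a := by
  have h := Metab.of_isometry (a := fun _ : Unit => a) (b := fun _ : Unit => a)
    LinearMap.id (fun x y => rfl) le_rfl
  rw [← sum_cls_eq_zero_iff] at h
  simp only [Fintype.sum_sum_type, Sum.elim_inl, Sum.elim_inr, Finset.univ_unique,
    Finset.sum_singleton] at h
  exact (neg_eq_of_add_eq_zero_right h).symm

theorem sum_cls_eq_of_isometry {a : ι → Kˣ} {b : κ → Kˣ} (f : (ι → K) →ₗ[K] (κ → K))
    (hf : ∀ x y, ∑ j, (b j : K) * f x j * f y j = ∑ i, (a i : K) * x i * y i)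
    (hc : Fintype.card κ ≤ Fintype.card ι) : ∑ i, cls (a i) = ∑ j, cls (b j) := by
  have h := Metab.of_isometry f hf hc
  rw [← sum_cls_eq_zero_iff] at h
  simp only [Fintype.sum_sum_type, Sum.elim_inl, Sum.elim_inr, cls_neg,
    Finset.sum_neg_distrib] at h
  exact add_neg_eq_zero.mp h

/-- Maps on `Kˣ` satisfying the defining relations of the Witt group. -/
structure IsWittFun (f : Kˣ → A) : Prop where
  sq : ∀ a b, f (a * b ^ 2) = f a
  neg : ∀ a, f a + f (-a) = 0
  add : ∀ a b c : Kˣ, (c : K) = a + b → f a + f b = f c + f (a * b * c)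

theorem isWittFun_cls : IsWittFun (cls : Kˣ → Witt K) where
  sq a b := by
    have := sum_cls_eq_of_isometry (a := fun _ : Unit => a * b ^ 2) (b := fun _ : Unit => a)
      ((b : K) • LinearMap.id) (fun x y => by simp; ring) le_rfl
    simpa using this
  neg a := by rw [cls_neg, add_neg_cancel]
  add a b c h := by
    let f : (Fin 2 → K) →ₗ[K] (Fin 2 → K) :=
      Matrix.toLin' !![1, (b : K); 1, -(a : K)]
    have := sum_cls_eq_of_isometry (a := ![c, a * b * c]) (b := ![a, b]) f (fun x y => by
      simp [f, Matrix.toLin'_apply, Matrix.mulVec, dotProduct, Fin.sum_univ_two, h]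
      ring) le_rfl
    simpa [Fin.sum_univ_two] using this.symm

namespace IsWittFun

variable {f : Kˣ → A}

theorem prod (hf : IsWittFun f) {B : Type} [AddCommGroup B] {g : Kˣ → B} (hg : IsWittFun g) :
    IsWittFun (fun a => (f a, g a)) where
  sq a b := by rw [hf.sq, hg.sq]
  neg a := Prod.ext (hf.neg a) (hg.neg a)
  add a b c h := Prod.ext (hf.add a b c h) (hg.add a b c h)

theorem map_neg (hf : IsWittFun f) (a : Kˣ) : f (-a) = -f a :=
  (neg_eq_of_add_eq_zero_right (hf.neg a)).symm

theorem exists_of_represents (hf : IsWittFun f) (L : List (Kˣ × K)) (c : Kˣ)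
    (hc : (L.map fun p => (p.1 : K) * p.2 ^ 2).sum = (c : K)) :
    ∃ L' : List Kˣ, L'.length + 1 = L.length ∧
      (L.map fun p => f p.1).sum = f c + (L'.map f).sum := by
  induction L generalizing c with
  | nil => exact absurd hc.symm c.ne_zero
  | cons p L ih =>
    obtain ⟨a, x⟩ := p
    simp only [List.map_cons, List.sum_cons, List.length_cons] at hc ⊢
    by_cases hx : x = 0
    · obtain ⟨L', h1, h2⟩ := ih c (by simpa [hx] using hc)
      refine ⟨a :: L', by simpa using h1, ?_⟩
      rw [h2, List.map_cons, List.sum_cons]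
      abel
    · have hfa : f (a * Units.mk0 x hx ^ 2) = f a := hf.sq _ _
      by_cases hd : (L.map fun p => (p.1 : K) * p.2 ^ 2).sum = 0
      · refine ⟨L.map Prod.fst, by simp, ?_⟩
        have : c = a * Units.mk0 x hx ^ 2 := by
          ext
          rw [← hc, hd]
          simp
        rw [this, hfa, List.map_map]
        rfl
      · obtain ⟨L', h1, h2⟩ := ih (Units.mk0 _ hd) rfl
        refine ⟨(a * Units.mk0 x hx ^ 2 * Units.mk0 _ hd * c) :: L', by simpa using h1, ?_⟩
        have := hf.add (a * Units.mk0 x hx ^ 2) (Units.mk0 _ hd) c (by rw [← hc]; simp)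
        rw [hfa] at this
        rw [h2, List.map_cons, List.sum_cons, ← add_assoc, ← add_assoc, this]

theorem exists_of_isotropic (hf : IsWittFun f) (L : List (Kˣ × K))
    (hL : ∃ p ∈ L, p.2 ≠ 0) (hc : (L.map fun p => (p.1 : K) * p.2 ^ 2).sum = 0) :
    ∃ L' : List Kˣ, L'.length + 2 = L.length ∧
      (L.map fun p => f p.1).sum = (L'.map f).sum := by
  induction L with
  | nil => simp at hL
  | cons p L ih =>
    obtain ⟨a, x⟩ := p
    simp only [List.map_cons, List.sum_cons, List.length_cons] at hc ⊢
    by_cases hx : x = 0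
    · obtain ⟨L', h1, h2⟩ := ih (by
        obtain ⟨p, hp, hp0⟩ := hL
        rcases List.mem_cons.mp hp with rfl | hp
        · exact absurd hx hp0
        · exact ⟨p, hp, hp0⟩) (by simpa [hx] using hc)
      exact ⟨a :: L', by simpa using h1, by rw [h2, List.map_cons, List.sum_cons]⟩
    · obtain ⟨L', h1, h2⟩ := hf.exists_of_represents L (-(a * Units.mk0 x hx ^ 2)) (by
        rw [eq_neg_of_add_eq_zero_right hc]
        simp)
      refine ⟨L', by omega, ?_⟩
      rw [h2, hf.map_neg, hf.sq]
      abel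

theorem sum_eq_zero_of_metab_list (hf : IsWittFun f) (n : ℕ) (L : List Kˣ) (hn : L.length = n)
    (hL : Metab fun i : Fin L.length => L[i]) : (L.map f).sum = 0 := by
  induction n using Nat.strong_induction_on generalizing L with
  | _ n ih =>
  rcases Nat.eq_zero_or_pos n with rfl | hpos
  · rw [List.length_eq_zero_iff.mp hn]
    simp
  obtain ⟨M, hM, hd⟩ := hL
  have hM0 : M ≠ ⊥ := by
    rintro rfl
    simp at hd
    simp [hd] at hn
    omega
  obtain ⟨x, hx, hx0⟩ := Submodule.exists_mem_ne_zero_of_ne_bot hM0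
  obtain ⟨i, hi⟩ := Function.ne_iff.mp hx0
  have key := (hf.prod isWittFun_cls).exists_of_isotropic
    (List.ofFn fun i : Fin L.length => (L[i], x i))
    ⟨_, (List.mem_ofFn' _ _).mpr ⟨i, rfl⟩, hi⟩ (by
      rw [List.map_ofFn, List.sum_ofFn, ← hM x hx x hx]
      exact Finset.sum_congr rfl fun i _ => by simp only [Function.comp]; ring)
  obtain ⟨L', hlen, hsum⟩ := key
  have e1 : (List.ofFn fun i : Fin L.length => (L[i], x i)).map
      (fun p => ((f p.1, cls p.1) : A × Witt K)) = L.map fun a => (f a, cls a) := by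
    conv_rhs => rw [← List.ofFn_getElem (xs := L), List.map_ofFn]
    rw [List.map_ofFn]
    rfl
  rw [e1] at hsum
  have h1 : (L.map f).sum = (L'.map f).sum := by
    have := congrArg (AddMonoidHom.fst A (Witt K)) hsum
    simpa [map_list_sum, Function.comp_def] using this
  have h2 : (L.map cls).sum = (L'.map cls).sum := by
    have := congrArg (AddMonoidHom.snd A (Witt K)) hsum
    simpa [map_list_sum, Function.comp_def] using this
  have hofn : ∀ l : List Kˣ, (l.map cls).sum = ∑ i : Fin l.length, cls l[i] := fun l => by
    conv_lhs => rw [← List.ofFn_getElem (xs := l), List.map_ofFn, List.sum_ofFn]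
    rfl
  rw [hofn, hofn] at h2
  rw [h1]
  rw [List.length_ofFn] at hlen
  refine ih L'.length (by omega) L' rfl ?_
  rw [← sum_cls_eq_zero_iff, ← h2, sum_cls_eq_zero_iff]
  exact ⟨M, hM, hd⟩

theorem sum_eq_zero (hf : IsWittFun f) {n : ℕ} {a : Fin n → Kˣ} (ha : Metab a) :
    ∑ i, f (a i) = 0 := by
  have h : ∑ i, f (a i) = ((List.ofFn a).map f).sum := by
    rw [List.map_ofFn, List.sum_ofFn]
    rfl
  rw [h]
  refine hf.sum_eq_zero_of_metab_list _ _ rfl ?_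
  have := ha.reindex (finCongr (List.length_ofFn (f := a)))
  convert this using 2
  simp
  rfl

/-- A Witt function induces a homomorphism on the Witt group. -/
def lift (hf : IsWittFun f) : Witt K →+ A :=
  QuotientAddGroup.lift (metabSubgroup K) (Finsupp.liftAddHom fun a => zmultiplesHom A (f a)) <| by
    refine (AddSubgroup.closure_le _).mpr ?_
    rintro _ ⟨n, a, ha, rfl⟩
    simpa [famSum, AddMonoidHom.mem_ker] using hf.sum_eq_zero ha

@[simp]
theorem lift_cls (hf : IsWittFun f) (a : Kˣ) : hf.lift (cls a) = f a := by
  change QuotientAddGroup.lift (metabSubgroup K) _ _ (QuotientAddGroup.mk' _ _) = _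
  rw [QuotientAddGroup.mk'_apply]
  erw [QuotientAddGroup.lift_mk]
  simp

theorem comp_map (hf : IsWittFun f) {k : Type} [Field k] (τ : k →+* K) :
    IsWittFun fun a : kˣ => f (Units.map (τ : k →* K) a) where
  sq a b := by rw [map_mul, map_pow, hf.sq]
  neg a := by
    rw [← hf.neg (Units.map (τ : k →* K) a)]
    congr 2
    ext
    simp
  add a b c h := by
    rw [map_mul, map_mul]
    exact hf.add _ _ _ (by simp [h])

theorem comp_mul (hf : IsWittFun f) (r : Kˣ) : IsWittFun fun a => f (r * a) where
  sq a b := by rw [← mul_assoc, hf.sq]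
  neg a := by rw [mul_neg, hf.neg]
  add a b c h := by
    rw [hf.add (r * a) (r * b) (r * c) (by simp [h, mul_add])]
    rw [show r * a * (r * b) * (r * c) = r * (a * b * c) * r ^ 2 by
      ext
      push_cast
      ring, hf.sq]

end IsWittFun

theorem witt_hom_ext {f g : Witt K →+ A} (h : ∀ a, f (cls a) = g (cls a)) : f = g := by
  refine QuotientAddGroup.addMonoidHom_ext _ (Finsupp.addHom_ext' fun a => ?_)
  ext
  exact h a

theorem witt_induction {p : Witt K → Prop} (hcls : ∀ a, p (cls a))
    (hadd : ∀ x y, p x → p y → p (x + y)) (hneg : ∀ x, p x → p (-x)) (hzero : p 0) (x : Witt K) :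
    p x := by
  let S : AddSubgroup (Witt K) :=
    { carrier := {x | p x}, add_mem' := fun h1 h2 => hadd _ _ h1 h2, zero_mem' := hzero,
      neg_mem' := fun h => hneg _ h }
  have h : (QuotientAddGroup.mk' S).comp (AddMonoidHom.id _) = 0 :=
    witt_hom_ext fun a => (QuotientAddGroup.eq_zero_iff _).mpr (hcls a)
  exact (QuotientAddGroup.eq_zero_iff (N := S) x).mp (DFunLike.congr_fun h x)

end WittLift

section Residue

variable {K k : Type} [Field K] [Field k]

/-- A discrete valuation with an angular component map. -/
structure ResData (K k : Type) [Field K] [Field k] where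
  v : Kˣ → ℤ
  ac : Kˣ → kˣ
  v_mul : ∀ a b, v (a * b) = v a + v b
  ac_mul : ∀ a b, ac (a * b) = ac a * ac b
  v_neg : ∀ a, v (-a) = v a
  ac_neg : ∀ a, ac (-a) = -ac a
  of_lt : ∀ a b c : Kˣ, (c : K) = a + b → v a < v b → v c = v a ∧ ac c = ac a
  of_eq : ∀ a b c : Kˣ, (c : K) = a + b → v a = v b → (ac a + ac b : k) ≠ 0 →
    v c = v a ∧ (ac c : k) = ac a + ac b

namespace ResData

variable (D : ResData K k)

open Classical in
def res (a : Kˣ) : Witt k := if Odd (D.v a) then cls (D.ac a) else 0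

theorem res_mul_sq (a b : Kˣ) : D.res (a * b ^ 2) = D.res a := by
  have hv : D.v (a * b ^ 2) = D.v a + 2 * D.v b := by rw [pow_two, D.v_mul, D.v_mul]; ring
  have ha : D.ac (a * b ^ 2) = D.ac a * D.ac b ^ 2 := by
    rw [pow_two, D.ac_mul, D.ac_mul, pow_two]
  have : Odd (D.v (a * b ^ 2)) ↔ Odd (D.v a) := by rw [hv]; simp [parity_simps]
  rw [res, res, ha, isWittFun_cls.sq]
  simp only [this]

theorem res_neg (a : Kˣ) : D.res (-a) = -D.res a := by
  rw [res, res, D.v_neg, D.ac_neg, cls_neg]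
  split <;> simp

theorem res_congr {a b : Kˣ} (hv : D.v a = D.v b) (hac : D.ac a = D.ac b) : D.res a = D.res b := by
  rw [res, res, hv, hac]

theorem isWittFun_res : IsWittFun D.res where
  sq := D.res_mul_sq
  neg a := by rw [res_neg, add_neg_cancel]
  add := by
    have main : ∀ a b c : Kˣ, (c : K) = a + b → D.v a < D.v b →
        D.res a + D.res b = D.res c + D.res (a * b * c) := fun a b c h hlt => by
      obtain ⟨h1, h2⟩ := D.of_lt a b c h hlt
      rw [D.res_congr h1 h2, D.res_congr (a := a * b * c) (b := b * a ^ 2), D.res_mul_sq]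
      · rw [pow_two, D.v_mul, D.v_mul, D.v_mul, D.v_mul, h1]; ring
      · rw [pow_two, D.ac_mul, D.ac_mul, D.ac_mul, D.ac_mul, h2]
        ext
        push_cast
        ring
    intro a b c h
    rcases lt_trichotomy (D.v a) (D.v b) with hlt | heq | hlt
    · exact main a b c h hlt
    · by_cases h0 : (D.ac a + D.ac b : k) = 0
      · have hab : D.ac b = -D.ac a := by
          ext
          rw [Units.val_neg]
          exact eq_neg_of_add_eq_zero_right h0
        have e1 : D.res b = -D.res a := by
          rw [← res_neg]
          exact D.res_congr (by rw [D.v_neg, heq]) (by rw [D.ac_neg, hab])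
        have e2 : D.res (a * b * c) = D.res (-c * a ^ 2) := by
          apply D.res_congr
          · rw [pow_two, D.v_mul, D.v_mul, D.v_mul, D.v_mul, D.v_neg, heq]; ring
          · rw [pow_two, D.ac_mul, D.ac_mul, D.ac_mul, D.ac_mul, D.ac_neg, hab]
            ext
            push_cast
            ring
        rw [e1, e2, D.res_mul_sq, D.res_neg]
        abel
      · obtain ⟨h1, h2⟩ := D.of_eq a b c h heq h0
        have hv : D.v (a * b * c) = D.v a + 2 * D.v b := by
          rw [D.v_mul, D.v_mul, h1, heq]; ring
        have ho : Odd (D.v (a * b * c)) ↔ Odd (D.v a) := by rw [hv]; simp [parity_simps]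
        rw [res, res, res, res, D.ac_mul, D.ac_mul]
        simp only [ho, h1, ← heq]
        split
        · exact isWittFun_cls.add _ _ _ h2
        · rfl
    · rw [add_comm, main b a c (by rw [h, add_comm]) hlt, mul_comm b a]

def resHom : Witt K →+ Witt k := D.isWittFun_res.lift

@[simp] theorem resHom_cls (a : Kˣ) : D.resHom (cls a) = D.res a := D.isWittFun_res.lift_cls a

def comap {L : Type} [Field L] (τ : L →+* K) : ResData L k where
  v a := D.v (Units.map (τ : L →* K) a)
  ac a := D.ac (Units.map (τ : L →* K) a)
  v_mul a b := by rw [map_mul, D.v_mul]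
  ac_mul a b := by rw [map_mul, D.ac_mul]
  v_neg a := by
    rw [← D.v_neg]
    congr 1
    ext
    simp
  ac_neg a := by
    rw [← D.ac_neg]
    congr 1
    ext
    simp
  of_lt a b c h := D.of_lt _ _ _ (by simp [h])
  of_eq a b c h := D.of_eq _ _ _ (by simp [h])

end ResData

section Padic

variable (ℓ : ℕ) [Fact ℓ.Prime]

theorem padicInt_toZMod_ne_zero_iff (z : ℤ_[ℓ]) : PadicInt.toZMod z ≠ 0 ↔ ‖z‖ = 1 := by
  rw [Ne, ← RingHom.mem_ker, PadicInt.ker_toZMod, PadicInt.maximalIdeal_eq_span_p,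
    Ideal.mem_span_singleton, ← PadicInt.norm_lt_one_iff_dvd, not_lt]
  exact ⟨fun h => le_antisymm (PadicInt.norm_le_one z) h, fun h => h.ge⟩

variable {ℓ}

theorem padic_exists_rep (a : ℚ_[ℓ]ˣ) :
    ∃ z : ℤ_[ℓ], PadicInt.toZMod z ≠ 0 ∧ (a : ℚ_[ℓ]) = (ℓ : ℚ_[ℓ]) ^ (a : ℚ_[ℓ]).valuation * z := by
  have hℓ : (ℓ : ℚ_[ℓ]) ≠ 0 := by exact_mod_cast (Fact.out : ℓ.Prime).ne_zero
  have hn : ‖(ℓ : ℚ_[ℓ]) ^ (-(a : ℚ_[ℓ]).valuation) * a‖ = 1 := by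
    rw [norm_mul, Padic.norm_p_zpow, Padic.norm_eq_zpow_neg_valuation a.ne_zero, neg_neg,
      ← zpow_add₀ (by exact_mod_cast (Fact.out : ℓ.Prime).ne_zero)]
    simp
  refine ⟨⟨_, hn.le⟩, ?_, ?_⟩
  · exact (padicInt_toZMod_ne_zero_iff ℓ _).mpr hn
  · rw [← mul_assoc, ← zpow_add₀ hℓ]
    simp

theorem padic_valuation_eq {a : ℚ_[ℓ]ˣ} {n : ℤ} {z : ℤ_[ℓ]} (hz : PadicInt.toZMod z ≠ 0)
    (h : (a : ℚ_[ℓ]) = (ℓ : ℚ_[ℓ]) ^ n * z) : (a : ℚ_[ℓ]).valuation = n := by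
  have hz1 : ‖(z : ℚ_[ℓ])‖ = 1 := (padicInt_toZMod_ne_zero_iff ℓ z).mp hz
  have h1 : ‖(a : ℚ_[ℓ])‖ = (ℓ : ℝ) ^ (-n) := by
    rw [h, norm_mul, hz1, Padic.norm_p_zpow, mul_one]
  rw [Padic.norm_eq_zpow_neg_valuation a.ne_zero] at h1
  have := zpow_right_injective₀ (by exact_mod_cast (Fact.out : ℓ.Prime).pos)
    (by exact_mod_cast (Fact.out : ℓ.Prime).one_lt.ne') h1
  omega

def padicAc (a : ℚ_[ℓ]ˣ) : (ZMod ℓ)ˣ :=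
  Units.mk0 (PadicInt.toZMod (padic_exists_rep a).choose) (padic_exists_rep a).choose_spec.1

theorem padicAc_eq {a : ℚ_[ℓ]ˣ} {n : ℤ} {z : ℤ_[ℓ]} (hz : PadicInt.toZMod z ≠ 0)
    (h : (a : ℚ_[ℓ]) = (ℓ : ℚ_[ℓ]) ^ n * z) : (padicAc a : ZMod ℓ) = PadicInt.toZMod z := by
  have hℓ : (ℓ : ℚ_[ℓ]) ≠ 0 := by exact_mod_cast (Fact.out : ℓ.Prime).ne_zero
  rw [padicAc, Units.val_mk0]
  generalize_proofs p1
  have h2 := p1.choose_spec.2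
  generalize p1.choose = w at h2 ⊢
  rw [padic_valuation_eq hz h, h] at h2
  rw [PadicInt.ext (mul_left_cancel₀ (zpow_ne_zero n hℓ) h2)]

theorem padicAc_rep (a : ℚ_[ℓ]ˣ) : ∃ z : ℤ_[ℓ], PadicInt.toZMod z = padicAc a ∧
    (a : ℚ_[ℓ]) = (ℓ : ℚ_[ℓ]) ^ (a : ℚ_[ℓ]).valuation * z :=
  ⟨_, rfl, (padic_exists_rep a).choose_spec.2⟩

theorem padicAc_unique {a : ℚ_[ℓ]ˣ} {n : ℤ} {z : ℤ_[ℓ]} {u : (ZMod ℓ)ˣ}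
    (hz : PadicInt.toZMod z = u)
    (h : (a : ℚ_[ℓ]) = (ℓ : ℚ_[ℓ]) ^ n * z) : (a : ℚ_[ℓ]).valuation = n ∧ padicAc a = u := by
  have h0 : PadicInt.toZMod z ≠ 0 := hz ▸ u.ne_zero
  exact ⟨padic_valuation_eq h0 h, Units.ext ((padicAc_eq h0 h).trans hz)⟩

variable (ℓ) in
def padicResData : ResData ℚ_[ℓ] (ZMod ℓ) where
  v a := (a : ℚ_[ℓ]).valuation
  ac := padicAc
  v_mul a b := by
    rw [Units.val_mul, Padic.valuation_mul a.ne_zero b.ne_zero]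
  ac_mul a b := by
    obtain ⟨x, hx, hx'⟩ := padicAc_rep a
    obtain ⟨y, hy, hy'⟩ := padicAc_rep b
    have hℓ : (ℓ : ℚ_[ℓ]) ≠ 0 := by exact_mod_cast (Fact.out : ℓ.Prime).ne_zero
    refine (padicAc_unique (n := (a : ℚ_[ℓ]).valuation + (b : ℚ_[ℓ]).valuation) (z := x * y)
      (by simp [hx, hy]) ?_).2
    rw [zpow_add₀ hℓ, Units.val_mul]
    conv_lhs => rw [hx', hy']
    push_cast
    ring
  v_neg a := by
    obtain ⟨x, hx, hx'⟩ := padicAc_rep a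
    refine (padicAc_unique (n := (a : ℚ_[ℓ]).valuation) (z := -x) (u := -padicAc a)
      (by simp [hx]) ?_).1
    conv_lhs => rw [Units.val_neg, hx']
    push_cast
    ring
  ac_neg a := by
    obtain ⟨x, hx, hx'⟩ := padicAc_rep a
    refine (padicAc_unique (n := (a : ℚ_[ℓ]).valuation) (z := -x) (by simp [hx]) ?_).2
    conv_lhs => rw [Units.val_neg, hx']
    push_cast
    ring
  of_lt a b c h hlt := by
    obtain ⟨x, hx, hx'⟩ := padicAc_rep a
    obtain ⟨y, hy, hy'⟩ := padicAc_rep b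
    have hℓ : (ℓ : ℚ_[ℓ]) ≠ 0 := by exact_mod_cast (Fact.out : ℓ.Prime).ne_zero
    obtain ⟨m, hm⟩ : ∃ m : ℕ, (b : ℚ_[ℓ]).valuation = (a : ℚ_[ℓ]).valuation + (m + 1) :=
      ⟨((b : ℚ_[ℓ]).valuation - (a : ℚ_[ℓ]).valuation - 1).toNat, by
        have : (a : ℚ_[ℓ]).valuation < (b : ℚ_[ℓ]).valuation := hlt
        omega⟩
    refine padicAc_unique (z := x + (ℓ : ℤ_[ℓ]) ^ (m + 1) * y) (by simp [hx]) ?_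
    rw [h]
    conv_lhs => rw [hx', hy', hm]
    rw [zpow_add₀ hℓ]
    push_cast
    have : (ℓ : ℚ_[ℓ]) ^ ((m : ℤ) + 1) = (ℓ : ℚ_[ℓ]) ^ (m + 1) := by
      exact_mod_cast zpow_natCast (ℓ : ℚ_[ℓ]) (m + 1)
    rw [this]
    ring
  of_eq a b c h heq h0 := by
    obtain ⟨x, hx, hx'⟩ := padicAc_rep a
    obtain ⟨y, hy, hy'⟩ := padicAc_rep b
    have := padicAc_unique (a := c) (n := (a : ℚ_[ℓ]).valuation) (z := x + y)
      (u := Units.mk0 _ h0) (by simp [hx, hy]) (by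
        rw [h]
        conv_lhs => rw [hx', hy', ← heq]
        push_cast
        ring)
    exact ⟨this.1, by rw [this.2, Units.val_mk0]⟩

end Padic

end Residue

section Frm

variable {K : Type} [Field K]

/-- The class of the form `⟨a⟩`, extended by zero. -/
def frm (a : K) : Witt K := by
  classical exact if h : a = 0 then 0 else cls (Units.mk0 a h)

@[simp] theorem frm_zero : frm (0 : K) = 0 := by simp [frm]

theorem frm_of_ne {a : K} (h : a ≠ 0) : frm a = cls (Units.mk0 a h) := by simp [frm, h]

@[simp] theorem frm_units (a : Kˣ) : frm (a : K) = cls a := by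
  rw [frm_of_ne a.ne_zero, Units.mk0_val]

theorem frm_neg (a : K) : frm (-a) = -frm a := by
  by_cases h : a = 0
  · simp [h]
  · rw [frm_of_ne h, frm_of_ne (neg_ne_zero.mpr h), ← cls_neg]
    congr 1
    ext
    simp

theorem frm_mul_sq (a : K) {b : K} (hb : b ≠ 0) : frm (a * b ^ 2) = frm a := by
  by_cases h : a = 0
  · simp [h]
  · lift a to Kˣ using isUnit_iff_ne_zero.mpr h
    lift b to Kˣ using isUnit_iff_ne_zero.mpr hb
    rw [← Units.val_pow_eq_pow_val, ← Units.val_mul, frm_units, frm_units, isWittFun_cls.sq a b]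

theorem frm_add {a b : K} (hc : a + b ≠ 0) :
    frm a + frm b = frm (a + b) + frm (a * b * (a + b)) := by
  by_cases ha : a = 0
  · simp [ha]
  by_cases hb : b = 0
  · simp [hb]
  obtain ⟨c, hc⟩ : ∃ c : Kˣ, (c : K) = a + b := isUnit_iff_ne_zero.mpr hc
  lift a to Kˣ using isUnit_iff_ne_zero.mpr ha
  lift b to Kˣ using isUnit_iff_ne_zero.mpr hb
  rw [← hc, ← Units.val_mul, ← Units.val_mul]
  simp only [frm_units]
  exact isWittFun_cls.add a b c hc

/-- Scaling of forms. -/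
def scale (r : Kˣ) : Witt K →+ Witt K := (isWittFun_cls.comp_mul r).lift

theorem scale_cls (r a : Kˣ) : scale r (cls a) = cls (r * a) := IsWittFun.lift_cls _ a

theorem scale_frm {r : K} (hr : r ≠ 0) (a : K) : scale (Units.mk0 r hr) (frm a) = frm (r * a) := by
  by_cases h : a = 0
  · simp [h]
  lift a to Kˣ using isUnit_iff_ne_zero.mpr h
  rw [frm_units, scale_cls, ← frm_units]
  simp

/-- Base change of forms. -/
def baseChange {L : Type} [Field L] (τ : K →+* L) : Witt K →+ Witt L :=
  (isWittFun_cls.comp_map τ).lift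

theorem baseChange_frm {L : Type} [Field L] (τ : K →+* L) (a : K) :
    baseChange τ (frm a) = frm (τ a) := by
  by_cases h : a = 0
  · simp [h]
  lift a to Kˣ using isUnit_iff_ne_zero.mpr h
  rw [frm_units, baseChange, IsWittFun.lift_cls, ← frm_units]
  simp

end Frm

section MilnorTate

/-- The residue homomorphism at a prime. -/
def dl (ℓ : ℕ) [Fact ℓ.Prime] : Witt ℚ →+ Witt (ZMod ℓ) :=
  ((padicResData ℓ).comap (algebraMap ℚ ℚ_[ℓ])).resHom

theorem padic_res_pow_mul {ℓ : ℕ} [Fact ℓ.Prime] {a : ℚ_[ℓ]} (e : ℤ) (z : ℤ_[ℓ])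
    (hz : PadicInt.toZMod z ≠ 0) (h : a = (ℓ : ℚ_[ℓ]) ^ e * z) :
    (padicResData ℓ).resHom (frm a) = if Odd e then frm (PadicInt.toZMod z) else 0 := by
  have hℓ : (ℓ : ℚ_[ℓ]) ≠ 0 := by exact_mod_cast (Fact.out : ℓ.Prime).ne_zero
  have ha : a ≠ 0 := by
    rw [h]
    refine mul_ne_zero (zpow_ne_zero _ hℓ) ?_
    rintro h0
    apply hz
    rw [show z = 0 from PadicInt.ext h0, map_zero]
  rw [frm_of_ne ha, ResData.resHom_cls, ResData.res]
  obtain ⟨h1, h2⟩ := padicAc_unique (a := Units.mk0 a ha) (u := Units.mk0 _ hz) rfl h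
  have h1' : (padicResData ℓ).v (Units.mk0 a ha) = e := h1
  have h2' : (padicResData ℓ).ac (Units.mk0 a ha) = Units.mk0 _ hz := h2
  rw [h1', h2', frm_of_ne hz]

theorem dl_eq {ℓ : ℕ} [Fact ℓ.Prime] (x : Witt ℚ) :
    dl ℓ x = (padicResData ℓ).resHom (baseChange (algebraMap ℚ ℚ_[ℓ]) x) := by
  have : dl ℓ = ((padicResData ℓ).resHom).comp (baseChange (algebraMap ℚ ℚ_[ℓ])) := by
    refine witt_hom_ext fun a => ?_
    rw [AddMonoidHom.comp_apply, baseChange, IsWittFun.lift_cls, ResData.resHom_cls, dl,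
      ResData.resHom_cls]
    rfl
  rw [this]
  rfl

theorem dl_pow_mul {ℓ : ℕ} [Fact ℓ.Prime] (e : ℕ) (m : ℤ) (hm : (m : ZMod ℓ) ≠ 0) :
    dl ℓ (frm ((ℓ : ℚ) ^ e * m)) = if Odd e then frm (m : ZMod ℓ) else 0 := by
  rw [dl_eq, baseChange_frm, padic_res_pow_mul (e : ℤ) (m : ℤ_[ℓ]) (by simpa using hm) (by simp)]
  simp

open Classical in
theorem isWittFun_sign : IsWittFun (fun a : ℚˣ => if 0 < (a : ℚ) then (1 : ℤ) else -1) where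
  sq a b := by
    have : 0 < (b : ℚ) ^ 2 := by
      have := b.ne_zero
      positivity
    simp [this]
  neg a := by
    rcases lt_or_gt_of_ne a.ne_zero with h | h
    · simp [h, not_lt.mpr h.le]
    · simp [h, not_lt.mpr h.le]
  add a b c h := by
    have h1 := a.ne_zero
    have h2 := b.ne_zero
    have h3 := c.ne_zero
    rcases lt_or_gt_of_ne h1 with ha | ha <;> rcases lt_or_gt_of_ne h2 with hb | hb
    · have hc : (c : ℚ) < 0 := by linarith
      have : (a * b * c : ℚ) < 0 := by nlinarith [mul_pos_of_neg_of_neg ha hb]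
      simp [not_lt.mpr ha.le, not_lt.mpr hb.le, not_lt.mpr hc.le, not_lt.mpr this.le]
    all_goals
      rcases lt_or_gt_of_ne h3 with hc | hc
    · have : 0 < (a * b * c : ℚ) := by nlinarith [mul_neg_of_neg_of_pos ha hb]
      simp [not_lt.mpr ha.le, hb, not_lt.mpr hc.le, this]
    · have : (a * b * c : ℚ) < 0 := by nlinarith [mul_neg_of_neg_of_pos ha hb]
      simp [not_lt.mpr ha.le, hb, hc, not_lt.mpr this.le]
    · have : 0 < (a * b * c : ℚ) := by nlinarith [mul_neg_of_pos_of_neg ha hb]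
      simp [ha, not_lt.mpr hb.le, not_lt.mpr hc.le, this]
    · have : (a * b * c : ℚ) < 0 := by nlinarith [mul_neg_of_pos_of_neg ha hb]
      simp [ha, not_lt.mpr hb.le, hc, not_lt.mpr this.le]
    · linarith
    · have : 0 < (a * b * c : ℚ) := by positivity
      simp [ha, hb, hc, this]

/-- The signature. -/
def sgn : Witt ℚ →+ ℤ := isWittFun_sign.lift

theorem sgn_pos {a : ℚ} (h : 0 < a) : sgn (frm a) = 1 := by
  rw [frm_of_ne h.ne', sgn, IsWittFun.lift_cls]
  simp [h]

theorem sgn_neg {a : ℚ} (h : a < 0) : sgn (frm a) = -1 := by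
  rw [← neg_neg a, frm_neg, map_neg, sgn_pos (neg_pos.mpr h)]

theorem isWittFun_par : IsWittFun (fun a : ℚˣ => (padicValRat 2 (a : ℚ) : ZMod 2)) where
  sq a b := by
    rw [Units.val_mul, Units.val_pow_eq_pow_val, padicValRat.mul a.ne_zero (pow_ne_zero 2 b.ne_zero),
      padicValRat.pow]
    push_cast
    rw [show ((2 : ZMod 2)) = 0 from rfl]
    ring
  neg a := by
    rw [Units.val_neg, padicValRat.neg]
    exact CharTwo.add_self_eq_zero _
  add a b c h := by
    rw [Units.val_mul, Units.val_mul, padicValRat.mul (mul_ne_zero a.ne_zero b.ne_zero) c.ne_zero,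
      padicValRat.mul a.ne_zero b.ne_zero]
    push_cast
    generalize (padicValRat 2 (a : ℚ) : ZMod 2) = x
    generalize (padicValRat 2 (b : ℚ) : ZMod 2) = y
    generalize (padicValRat 2 (c : ℚ) : ZMod 2) = z
    revert x y z
    decide

/-- The parity of the 2-adic valuation of the discriminant. -/
def par : Witt ℚ →+ ZMod 2 := isWittFun_par.lift

theorem par_frm (a : ℚ) : par (frm a) = (padicValRat 2 a : ZMod 2) := by
  by_cases h : a = 0
  · simp [h]
  · rw [frm_of_ne h, par, IsWittFun.lift_cls, Units.val_mk0]

/-- All prime divisors are smaller than `k`. -/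
def Smooth (k : ℕ) (n : ℤ) : Prop := n ≠ 0 ∧ ∀ q : ℕ, q.Prime → (q : ℤ) ∣ n → q < k

theorem Smooth.mul {k : ℕ} {m n : ℤ} (hm : Smooth k m) (hn : Smooth k n) : Smooth k (m * n) :=
  ⟨mul_ne_zero hm.1 hn.1, fun q hq h => by
    rcases (Nat.prime_iff_prime_int.mp hq).dvd_or_dvd h with h | h
    exacts [hm.2 q hq h, hn.2 q hq h]⟩

theorem Smooth.of_mul_right {k : ℕ} {m n : ℤ} (h : Smooth k (m * n)) : Smooth k n :=
  ⟨right_ne_zero_of_mul h.1, fun q hq hd => h.2 q hq (hd.mul_left m)⟩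

theorem smooth_of_abs_lt {k : ℕ} {n : ℤ} (h0 : n ≠ 0) (h : |n| < k) : Smooth k n :=
  ⟨h0, fun q _ hd => by
    have := Int.le_of_dvd (abs_pos.mpr h0) ((dvd_abs _ _).mpr hd)
    omega⟩

theorem Smooth.not_dvd {k : ℕ} (hk : k.Prime) {n : ℤ} (h : Smooth k n) : ¬ (k : ℤ) ∣ n :=
  fun hd => lt_irrefl _ (h.2 k hk hd)

theorem Smooth.ne_zero_zmod {ℓ : ℕ} [Fact ℓ.Prime] {n : ℤ} (h : Smooth ℓ n) : (n : ZMod ℓ) ≠ 0 := by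
  rw [Ne, ZMod.intCast_zmod_eq_zero_iff_dvd]
  exact h.not_dvd Fact.out

def smoothSubgroup (k : ℕ) : AddSubgroup (Witt ℚ) :=
  AddSubgroup.closure {x | ∃ n : ℤ, Smooth k n ∧ x = frm (n : ℚ)}

theorem frm_mem_smooth {k : ℕ} {n : ℤ} (h : Smooth k n) : frm (n : ℚ) ∈ smoothSubgroup k :=
  AddSubgroup.subset_closure ⟨n, h, rfl⟩

theorem smoothSubgroup_mono {k m : ℕ} (h : k ≤ m) : smoothSubgroup k ≤ smoothSubgroup m := by
  refine AddSubgroup.closure_mono ?_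
  rintro _ ⟨n, hn, rfl⟩
  exact ⟨n, ⟨hn.1, fun q hq hd => (hn.2 q hq hd).trans_le h⟩, rfl⟩

theorem exists_mem_smoothSubgroup (x : Witt ℚ) : ∃ k, x ∈ smoothSubgroup k := by
  induction x using witt_induction with
  | hcls a =>
    have h1 : (a : ℚ).num ≠ 0 := Rat.num_ne_zero.mpr a.ne_zero
    have h2 : ((a : ℚ).den : ℤ) ≠ 0 := by exact_mod_cast (a : ℚ).den_ne_zero
    have h3 : (a : ℚ).num * (a : ℚ).den ≠ 0 := mul_ne_zero h1 h2
    refine ⟨((a : ℚ).num * (a : ℚ).den).natAbs + 1, ?_⟩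
    have : cls a = frm (((a : ℚ).num * (a : ℚ).den : ℤ) : ℚ) := by
      rw [← frm_units, ← frm_mul_sq (a : ℚ) (b := ((a : ℚ).den : ℚ)) (by exact_mod_cast h2)]
      congr 1
      push_cast
      nth_rewrite 1 [← Rat.num_div_den (a : ℚ)]
      have : ((a : ℚ).den : ℚ) ≠ 0 := by exact_mod_cast h2
      field_simp
    rw [this]
    exact frm_mem_smooth (smooth_of_abs_lt h3 (by rw [Int.abs_eq_natAbs]; omega))
  | hadd x y hx hy =>
    obtain ⟨k, hk⟩ := hx
    obtain ⟨m, hm⟩ := hy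
    exact ⟨max k m, add_mem (smoothSubgroup_mono (le_max_left _ _) hk)
      (smoothSubgroup_mono (le_max_right _ _) hm)⟩
  | hneg x hx => exact hx.imp fun k hk => neg_mem hk
  | hzero => exact ⟨0, zero_mem _⟩

theorem scale_mem_smooth {k : ℕ} {n : ℤ} (hn : Smooth k n) (h0 : (n : ℚ) ≠ 0) {x : Witt ℚ}
    (hx : x ∈ smoothSubgroup k) : scale (Units.mk0 (n : ℚ) h0) x ∈ smoothSubgroup k := by
  have : smoothSubgroup k ≤ (smoothSubgroup k).comap (scale (Units.mk0 (n : ℚ) h0)) := by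
    refine (AddSubgroup.closure_le _).mpr ?_
    rintro _ ⟨m, hm, rfl⟩
    change scale (Units.mk0 (n : ℚ) h0) (frm (m : ℚ)) ∈ smoothSubgroup k
    rw [scale_frm]
    exact_mod_cast frm_mem_smooth (hn.mul hm)
  exact this hx

theorem frm_sub_mem_of_sub_eq {ℓ : ℕ} {m n k : ℤ} (hm : Smooth ℓ m) (hn : Smooth ℓ n)
    (hk : Smooth ℓ k) (h : m - n = k * ℓ) :
    frm ((ℓ * m : ℤ) : ℚ) - frm ((ℓ * n : ℤ) : ℚ) ∈ smoothSubgroup ℓ := by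
  have hm0 : (m : ℚ) ≠ 0 := by exact_mod_cast hm.1
  have hk0 : (k : ℚ) ≠ 0 := by exact_mod_cast hk.1
  have hsum : ((k * m * n : ℤ) : ℚ) + (ℓ * m) * k ^ 2 = k * m ^ 2 := by
    have : (m : ℚ) - n = k * ℓ := by exact_mod_cast h
    push_cast
    linear_combination -(k : ℚ) * m * this
  have key := frm_add (a := ((k * m * n : ℤ) : ℚ)) (b := (ℓ * m) * (k : ℚ) ^ 2)
    (by rw [hsum]; positivity)
  rw [hsum, frm_mul_sq _ hk0, frm_mul_sq _ hm0,
    show ((k * m * n : ℤ) : ℚ) * (ℓ * m * k ^ 2) * (k * m ^ 2) = ((ℓ * n : ℤ) : ℚ) * (k ^ 2 * m ^ 2) ^ 2 by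
      push_cast
      ring, frm_mul_sq _ (by positivity)] at key
  have e : frm ((ℓ * m : ℤ) : ℚ) - frm ((ℓ * n : ℤ) : ℚ) =
      frm (k : ℚ) - frm ((k * m * n : ℤ) : ℚ) := by
    push_cast at key ⊢
    rw [sub_eq_sub_iff_add_eq_add, add_comm, key]
  rw [e]
  exact sub_mem (frm_mem_smooth hk) (frm_mem_smooth ((hk.mul hm).mul hn))

section Step

variable (ℓ : ℕ)

def redClass (n : ℤ) : Witt ℚ ⧸ smoothSubgroup ℓ :=
  QuotientAddGroup.mk' (smoothSubgroup ℓ) (frm ((ℓ * n : ℤ) : ℚ))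

theorem redClass_neg (n : ℤ) : redClass ℓ (-n) = -redClass ℓ n := by
  rw [redClass, redClass, ← map_neg, ← frm_neg]
  push_cast
  rw [mul_neg]

variable {ℓ}

theorem redClass_mul {m n q : ℤ} (hq : Smooth ℓ q) (h : redClass ℓ m = redClass ℓ n) :
    redClass ℓ (q * m) = redClass ℓ (q * n) := by
  have hq0 : (q : ℚ) ≠ 0 := by exact_mod_cast hq.1
  rw [redClass, redClass, ← sub_eq_zero, ← map_sub] at h ⊢
  have := scale_mem_smooth hq hq0 ((QuotientAddGroup.eq_zero_iff _).mp h)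
  rw [map_sub, scale_frm, scale_frm] at this
  refine (QuotientAddGroup.eq_zero_iff _).mpr ?_
  convert this using 3 <;> (push_cast; ring)


theorem redClass_eq_of_sub {m n k : ℤ} (hm : Smooth ℓ m) (hn : Smooth ℓ n)
    (hk : k ≠ 0 → Smooth ℓ k) (h : m - n = k * ℓ) : redClass ℓ m = redClass ℓ n := by
  by_cases hk0 : k = 0
  · rw [hk0, zero_mul, sub_eq_zero] at h
    rw [h]
  · rw [redClass, redClass, ← sub_eq_zero, ← map_sub]
    exact (QuotientAddGroup.eq_zero_iff _).mpr
      (frm_sub_mem_of_sub_eq hm hn (hk hk0) h)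

variable [Fact ℓ.Prime]

theorem redClass_emod (n : ℤ) (hn : Smooth ℓ n) : redClass ℓ n = redClass ℓ (n % ℓ) := by
  have hℓ : 0 < (ℓ : ℤ) := by exact_mod_cast (Fact.out : ℓ.Prime).pos
  have hmod : ∀ m, Smooth ℓ m → Smooth ℓ (m % ℓ) := fun m hm => by
    have h1 := Int.emod_nonneg m hℓ.ne'
    have h2 := Int.emod_lt_of_pos m hℓ
    exact smooth_of_abs_lt (fun h => hm.not_dvd Fact.out (Int.dvd_of_emod_eq_zero h))
      (by rwa [abs_of_nonneg h1])
  induction hN : n.natAbs using Nat.strong_induction_on generalizing n with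
  | _ N ih =>
  by_cases hlt : n.natAbs < ℓ
  · rcases lt_or_gt_of_ne hn.1 with h | h
    · refine redClass_eq_of_sub (k := -1) hn (hmod n hn) (fun _ => ⟨by simp, fun q hq hd => ?_⟩) ?_
      · exact absurd (Int.isUnit_iff.mpr (Or.inr rfl))
          (fun hu => (Nat.prime_iff_prime_int.mp hq).not_isUnit (isUnit_of_dvd_unit hd hu))
      · have : (n + ℓ) % ℓ = n % ℓ := Int.add_emod_right n ℓ
        rw [← this, Int.emod_eq_of_lt (by omega) (by omega)]
        ring
    · rw [Int.emod_eq_of_lt h.le (by omega)]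
  · obtain ⟨q, hq, hqd⟩ := Nat.exists_prime_and_dvd (n := n.natAbs) (by
      have := (Fact.out : ℓ.Prime).two_le
      omega)
    obtain ⟨m, rfl⟩ := Int.natCast_dvd.mpr hqd
    have hql : q < ℓ := hn.2 q hq (dvd_mul_right _ m)
    have hqs : Smooth ℓ q := smooth_of_abs_lt (by exact_mod_cast hq.ne_zero) (by simpa using hql)
    have hms : Smooth ℓ m := hn.of_mul_right
    have h1 := ih m.natAbs (by
      rw [← hN, Int.natAbs_mul]
      have := Int.natAbs_pos.mpr hms.1
      have := hq.two_le
      simp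
      nlinarith) m hms rfl
    rw [redClass_mul hqs h1]
    have hr0 := Int.emod_nonneg m hℓ.ne'
    have hrl := Int.emod_lt_of_pos m hℓ
    have hq0 : 0 < (q : ℤ) := by exact_mod_cast hq.pos
    refine redClass_eq_of_sub (k := q * (m % ℓ) / ℓ) (hqs.mul (hmod m hms)) (hmod _ hn)
      (fun hk => smooth_of_abs_lt hk ?_) ?_
    · rw [abs_of_nonneg (Int.ediv_nonneg (by positivity) hℓ.le)]
      refine Int.ediv_lt_of_lt_mul hℓ ?_
      have : (q : ℤ) < ℓ := by exact_mod_cast hql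
      nlinarith
    · have := Int.emod_add_mul_ediv (q * (m % ℓ)) ℓ
      rw [show q * (m % ℓ) % ℓ = q * m % (ℓ : ℤ) by simp [Int.mul_emod]] at this
      linarith

def liftClass (u : (ZMod ℓ)ˣ) : Witt ℚ ⧸ smoothSubgroup ℓ := redClass ℓ ((u : ZMod ℓ).val : ℤ)

theorem redClass_eq_liftClass (n : ℤ) (hn : Smooth ℓ n) (u : (ZMod ℓ)ˣ) (hu : (n : ZMod ℓ) = u) :
    redClass ℓ n = liftClass u := by
  rw [redClass_emod n hn, liftClass, ← hu, ZMod.val_intCast]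

theorem smooth_val (u : (ZMod ℓ)ˣ) : Smooth ℓ ((u : ZMod ℓ).val : ℤ) := by
  refine smooth_of_abs_lt ?_ ?_
  · exact_mod_cast fun h => u.ne_zero ((ZMod.val_eq_zero _).mp h)
  · rw [Nat.abs_cast]
    exact_mod_cast ZMod.val_lt (u : ZMod ℓ)

theorem isWittFun_liftClass : IsWittFun (liftClass (ℓ := ℓ)) where
  sq a b := by
    rw [← redClass_eq_liftClass (((a : ZMod ℓ).val : ℤ) * ((b : ZMod ℓ).val : ℤ) ^ 2)
      ((smooth_val a).mul (by rw [pow_two]; exact (smooth_val b).mul (smooth_val b))) (a * b ^ 2)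
      (by simp), liftClass, redClass, redClass]
    congr 1
    have h : (((b : ZMod ℓ).val : ℤ) : ℚ) ≠ 0 := by exact_mod_cast (smooth_val b).1
    rw [← frm_mul_sq ((ℓ * ((a : ZMod ℓ).val : ℤ) : ℤ) : ℚ) h]
    congr 1
    push_cast
    ring
  neg a := by
    have hs := smooth_val a
    rw [← redClass_eq_liftClass (-((a : ZMod ℓ).val : ℤ))
      ⟨neg_ne_zero.mpr hs.1, fun q hq hd => hs.2 q hq ((dvd_neg).mp hd)⟩ (-a) (by simp),
      redClass_neg, liftClass, add_neg_cancel]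
  add a b c h := by
    have hℓ : (ℓ : ℤ) ≠ 0 := by exact_mod_cast (Fact.out : ℓ.Prime).ne_zero
    have ha := smooth_val a
    have hal : (a : ZMod ℓ).val < ℓ := ZMod.val_lt _
    have hbl : (b : ZMod ℓ).val < ℓ := ZMod.val_lt _
    have hb0 := (smooth_val b).1
    have ha0 := ha.1
    set x : ℤ := ((a : ZMod ℓ).val : ℤ) with hx
    set y : ℤ := ((b : ZMod ℓ).val : ℤ) - ℓ with hy
    have hxz : (x : ZMod ℓ) = a := by simp [hx]
    have hyz : (y : ZMod ℓ) = b := by simp [hy]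
    have hxyz : ((x + y : ℤ) : ZMod ℓ) = c := by rw [Int.cast_add, hxz, hyz, h]
    have hys : Smooth ℓ y := smooth_of_abs_lt (by omega) (by rw [abs_lt]; omega)
    have hxy0 : x + y ≠ 0 := fun h0 => c.ne_zero (by rw [← hxyz, h0, Int.cast_zero])
    have hxys : Smooth ℓ (x + y) := smooth_of_abs_lt hxy0 (by rw [abs_lt]; omega)
    rw [← redClass_eq_liftClass x ha a hxz, ← redClass_eq_liftClass y hys b hyz,
      ← redClass_eq_liftClass (x + y) hxys c hxyz,
      ← redClass_eq_liftClass (x * y * (x + y)) ((ha.mul hys).mul hxys) (a * b * c)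
        (by rw [Int.cast_mul, Int.cast_mul, hxyz, hxz, hyz]; simp)]
    simp only [redClass, ← map_add]
    congr 1
    have hℓ' : (ℓ : ℚ) ≠ 0 := by exact_mod_cast hℓ
    have hs : ((ℓ * x : ℤ) : ℚ) + ((ℓ * y : ℤ) : ℚ) = ((ℓ * (x + y) : ℤ) : ℚ) := by push_cast; ring
    have h2 : ((x + y : ℤ) : ℚ) ≠ 0 := by exact_mod_cast hxy0
    have key := frm_add (a := ((ℓ * x : ℤ) : ℚ)) (b := ((ℓ * y : ℤ) : ℚ)) (by
      rw [hs, Int.cast_mul]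
      exact mul_ne_zero (by exact_mod_cast hℓ) h2)
    rw [key, hs, ← frm_mul_sq ((ℓ * (x * y * (x + y)) : ℤ) : ℚ) hℓ']
    congr 2
    push_cast
    ring

theorem mem_smoothSubgroup_of_dl_eq_zero {x : Witt ℚ} (hx : x ∈ smoothSubgroup (ℓ + 1))
    (h : dl ℓ x = 0) : x ∈ smoothSubgroup ℓ := by
  have hp : ℓ.Prime := Fact.out
  have key : smoothSubgroup (ℓ + 1) ≤ AddMonoidHom.eqLocus
      (QuotientAddGroup.mk' (smoothSubgroup ℓ)) ((isWittFun_liftClass (ℓ := ℓ)).lift.comp (dl ℓ)) := by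
    refine (AddSubgroup.closure_le _).mpr ?_
    rintro _ ⟨n, hn, rfl⟩
    obtain ⟨e, m, hm, rfl⟩ : ∃ (e : ℕ) (m : ℤ), ¬ (ℓ : ℤ) ∣ m ∧ n = (ℓ : ℤ) ^ e * m := by
      have hf : FiniteMultiplicity (ℓ : ℤ) n :=
        Int.finiteMultiplicity_iff.mpr ⟨by simpa using hp.ne_one, hn.1⟩
      obtain ⟨m, h1, h2⟩ := hf.exists_eq_pow_mul_and_not_dvd
      exact ⟨_, m, h2, h1⟩
    have hms : Smooth ℓ m := ⟨right_ne_zero_of_mul hn.1, fun q hq hd => by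
      have := hn.2 q hq (hd.mul_left _)
      have hne : q ≠ ℓ := fun h0 => hm (h0 ▸ hd)
      omega⟩
    have hℓ0 : (ℓ : ℚ) ≠ 0 := by exact_mod_cast hp.ne_zero
    change QuotientAddGroup.mk' (smoothSubgroup ℓ) _ = isWittFun_liftClass.lift (dl ℓ _)
    rw [Int.cast_mul, Int.cast_pow, Int.cast_natCast, dl_pow_mul e m hms.ne_zero_zmod]
    rcases Nat.even_or_odd e with he | he
    · rw [if_neg (by simpa using he), map_zero]
      refine (QuotientAddGroup.eq_zero_iff _).mpr ?_
      obtain ⟨d, rfl⟩ := he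
      rw [mul_comm, ← two_mul, mul_comm 2 d, pow_mul, frm_mul_sq _ (pow_ne_zero _ hℓ0)]
      exact frm_mem_smooth hms
    · rw [if_pos he, frm_of_ne hms.ne_zero_zmod, IsWittFun.lift_cls,
        ← redClass_eq_liftClass m hms _ rfl, redClass]
      obtain ⟨d, rfl⟩ := he
      congr 1
      rw [pow_succ, mul_comm 2 d, pow_mul, ← frm_mul_sq ((ℓ * m : ℤ) : ℚ) (pow_ne_zero d hℓ0)]
      congr 1
      push_cast
      ring
  have := key hx
  change QuotientAddGroup.mk' (smoothSubgroup ℓ) _ = isWittFun_liftClass.lift (dl ℓ _) at this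
  rw [h, map_zero] at this
  exact (QuotientAddGroup.eq_zero_iff _).mp this

end Step

theorem mem_smoothSubgroup_two {x : Witt ℚ} (h : ∀ (ℓ : ℕ) [Fact ℓ.Prime], dl ℓ x = 0) (k : ℕ)
    (hx : x ∈ smoothSubgroup k) : x ∈ smoothSubgroup 2 := by
  induction k with
  | zero => exact smoothSubgroup_mono (by norm_num) hx
  | succ k ih =>
    by_cases hk : k.Prime
    · have : Fact k.Prime := ⟨hk⟩
      exact ih (mem_smoothSubgroup_of_dl_eq_zero hx (h k))
    · refine ih ((AddSubgroup.closure_mono ?_ : smoothSubgroup (k + 1) ≤ smoothSubgroup k) hx)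
      rintro _ ⟨n, hn, rfl⟩
      refine ⟨n, ⟨hn.1, fun q hq hd => ?_⟩, rfl⟩
      have := hn.2 q hq hd
      have hne : q ≠ k := fun h0 => hk (h0 ▸ hq)
      omega

theorem eq_zero_of_dl_of_sgn {x : Witt ℚ} (h : ∀ (ℓ : ℕ) [Fact ℓ.Prime], dl ℓ x = 0)
    (hs : sgn x = 0) : x = 0 := by
  obtain ⟨k, hk⟩ := exists_mem_smoothSubgroup x
  have h2 := mem_smoothSubgroup_two h k hk
  have key : smoothSubgroup 2 ≤ AddMonoidHom.eqLocus (AddMonoidHom.id _)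
      ((zmultiplesHom _ (frm (1 : ℚ))).comp sgn) := by
    refine (AddSubgroup.closure_le _).mpr ?_
    rintro _ ⟨n, hn, rfl⟩
    change frm (n : ℚ) = sgn (frm (n : ℚ)) • frm (1 : ℚ)
    have hu : IsUnit n := by
      by_contra hu
      rw [Int.isUnit_iff_natAbs_eq] at hu
      obtain ⟨q, hq, hqd⟩ := Nat.exists_prime_and_dvd hu
      have := hn.2 q hq (Int.natCast_dvd.mpr hqd)
      have := hq.two_le
      omega
    rcases Int.isUnit_iff.mp hu with rfl | rfl
    · rw [sgn_pos (by norm_num)]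
      simp
    · rw [sgn_neg (by norm_num)]
      simp [frm_neg]
  have := key h2
  change x = sgn x • frm (1 : ℚ) at this
  rw [this, hs, zero_smul]

theorem dl_two_eq (x : Witt ℚ) (h : par x = 0) : dl 2 x = 0 := by
  have h3 : frm (1 : ZMod 2) + frm 1 = 0 := by
    have : frm (-1 : ZMod 2) = frm 1 := by congr 1
    rwa [frm_neg, neg_eq_iff_add_eq_zero] at this
  have h2 : zmultiplesHom (Witt (ZMod 2)) (frm 1) ((2 : ℕ) : ℤ) = 0 := by
    simpa [two_smul] using h3
  have key : dl 2 = (ZMod.lift 2 ⟨zmultiplesHom (Witt (ZMod 2)) (frm 1), h2⟩).comp par := by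
    refine witt_hom_ext fun a => ?_
    rw [← frm_units, AddMonoidHom.comp_apply, par_frm, ZMod.lift_coe, dl]
    rw [frm_units, ResData.resHom_cls, ResData.res]
    have hv : ((padicResData 2).comap (algebraMap ℚ ℚ_[2])).v a = padicValRat 2 (a : ℚ) := by
      change ((algebraMap ℚ ℚ_[2] (a : ℚ)) : ℚ_[2]).valuation = _
      simp
    have h1 : ∀ u : (ZMod 2)ˣ, cls u = frm 1 := fun u => by
      rw [← frm_units]
      congr 1
      revert u
      decide
    rw [hv, h1]
    rcases Int.even_or_odd (padicValRat 2 (a : ℚ)) with he | he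
    · rw [if_neg (by simpa using he)]
      obtain ⟨d, hd⟩ := he
      rw [hd]
      simp [add_smul, ← smul_add, h3]
    · rw [if_pos he]
      obtain ⟨d, hd⟩ := he
      rw [hd]
      simp [add_smul, two_mul, ← smul_add, h3]
  rw [key, AddMonoidHom.comp_apply, h, map_zero]

end MilnorTate

section Close

variable {ℓ : ℕ} [Fact ℓ.Prime]

theorem toZMod_eq_one {z : ℤ_[ℓ]} (h : ‖z - 1‖ < 1) : PadicInt.toZMod z = 1 := by
  by_contra hne
  have : PadicInt.toZMod (z - 1) ≠ 0 := by simpa [sub_eq_zero] using hne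
  rw [padicInt_toZMod_ne_zero_iff] at this
  exact h.ne this

/-- Residues of `ℓ`-adically close elements agree. -/
theorem padic_res_congr {a b : ℚ_[ℓ]} (h : ‖b - a‖ < ‖a‖) :
    (padicResData ℓ).resHom (frm a) = (padicResData ℓ).resHom (frm b) := by
  have ha : a ≠ 0 := by
    rintro rfl
    simp only [norm_zero] at h
    exact (norm_nonneg _).not_gt h
  have hw : ‖b / a - 1‖ < 1 := by
    rw [div_sub_one ha, norm_div]
    exact (div_lt_one (norm_pos_iff.mpr ha)).mpr h
  have hw1 : ‖b / a‖ ≤ 1 := by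
    have := Padic.nonarchimedean (b / a - 1) 1
    rw [sub_add_cancel, norm_one] at this
    exact this.trans (max_le hw.le le_rfl)
  let w : ℤ_[ℓ] := ⟨b / a, hw1⟩
  have hwz : PadicInt.toZMod w = 1 := toZMod_eq_one (by exact_mod_cast hw)
  obtain ⟨z, hz, haz⟩ := padicAc_rep (Units.mk0 a ha)
  rw [Units.val_mk0] at haz
  have hz0 : PadicInt.toZMod z ≠ 0 := hz ▸ Units.ne_zero _
  have hb : b = (ℓ : ℚ_[ℓ]) ^ a.valuation * (z * w : ℤ_[ℓ]) := by
    rw [PadicInt.coe_mul, ← mul_assoc, ← haz]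
    exact (mul_div_cancel₀ b ha).symm
  rw [padic_res_pow_mul _ z hz0 haz, padic_res_pow_mul _ (z * w) (by simpa [hwz] using hz0) hb]
  simp [hwz]

theorem dl_congr {a b : ℚ} (h : ‖(b - a : ℚ_[ℓ])‖ < ‖(a : ℚ_[ℓ])‖) :
    dl ℓ (frm a) = dl ℓ (frm b) := by
  rw [dl_eq, dl_eq, baseChange_frm, baseChange_frm]
  exact padic_res_congr (by simpa using h)

end Close

section Quad

/-- Coordinates on the quadratic field `ℚ(√p)`. -/
structure QuadField (F : Type) [Field F] [CharZero F] (p : ℕ) where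
  s : F
  re : F → ℚ
  im : F → ℚ
  prime : p.Prime
  sq : s ^ 2 = p
  rep : ∀ x, x = (re x : F) + im x * s
  uniq : ∀ a b : ℚ, (a : F) + b * s = 0 → a = 0 ∧ b = 0

theorem prime_ne_sq {p : ℕ} (hp : p.Prime) (q : ℚ) : q ^ 2 ≠ p := fun h => by
  have h1 := hp.irrational_sqrt
  refine h1 ⟨|q|, ?_⟩
  rw [Rat.cast_abs, ← Real.sqrt_sq_eq_abs, ← Rat.cast_pow, h, Rat.cast_natCast]

def QuadField.mk' {F : Type} [Field F] [NumberField F] {p : ℕ} (hp : p.Prime)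
    {s : F} (hs : s ^ 2 = (p : F)) (hgen : Algebra.adjoin ℚ {s} = ⊤) : QuadField F p :=
  have h : ∀ x : F, ∃ ab : ℚ × ℚ, x = (ab.1 : F) + ab.2 * s := fun x => by
    have hx : x ∈ Algebra.adjoin ℚ {s} := hgen ▸ Algebra.mem_top
    induction hx using Algebra.adjoin_induction with
    | mem x hx => exact ⟨(0, 1), by simpa using hx⟩
    | algebraMap r => exact ⟨(r, 0), by simp⟩
    | add x y _ _ hx hy =>
      obtain ⟨a, rfl⟩ := hx
      obtain ⟨b, rfl⟩ := hy
      exact ⟨(a.1 + b.1, a.2 + b.2), by push_cast; ring⟩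
    | mul x y _ _ hx hy =>
      obtain ⟨a, rfl⟩ := hx
      obtain ⟨b, rfl⟩ := hy
      exact ⟨(a.1 * b.1 + p * a.2 * b.2, a.1 * b.2 + a.2 * b.1), by
        push_cast
        linear_combination (a.2 * b.2 : F) * hs⟩
  { s := s
    re := fun x => (h x).choose.1
    im := fun x => (h x).choose.2
    prime := hp
    sq := hs
    rep := fun x => (h x).choose_spec
    uniq := fun a b hab => by
      have hb : b = 0 := by
        by_contra hb
        apply prime_ne_sq hp (a / b)
        have hb' : (b : F) ≠ 0 := by exact_mod_cast hb
        have : ((a / b : ℚ) : F) ^ 2 = (p : ℚ) := by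
          push_cast
          rw [← hs, div_pow, div_eq_iff (pow_ne_zero 2 hb')]
          linear_combination (a - b * s : F) * hab
        exact_mod_cast this
      subst hb
      simpa using hab }

namespace QuadField

variable {F : Type} [Field F] [CharZero F] {p : ℕ} (Q : QuadField F p)

theorem eq_of_rep {x : F} {a b : ℚ} (h : x = a + b * Q.s) : Q.re x = a ∧ Q.im x = b := by
  have h1 := Q.rep x
  have := Q.uniq (Q.re x - a) (Q.im x - b) (by push_cast; linear_combination h - h1)
  exact ⟨sub_eq_zero.mp this.1, sub_eq_zero.mp this.2⟩

theorem ext {x y : F} (h1 : Q.re x = Q.re y) (h2 : Q.im x = Q.im y) : x = y := by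
  rw [Q.rep x, Q.rep y, h1, h2]

@[simp] theorem re_add (x y : F) : Q.re (x + y) = Q.re x + Q.re y :=
  (Q.eq_of_rep (b := Q.im x + Q.im y) (by push_cast; linear_combination Q.rep x + Q.rep y)).1
@[simp] theorem im_add (x y : F) : Q.im (x + y) = Q.im x + Q.im y :=
  (Q.eq_of_rep (a := Q.re x + Q.re y) (by push_cast; linear_combination Q.rep x + Q.rep y)).2

theorem mul_aux (x y : F) : x * y = ((Q.re x * Q.re y + p * (Q.im x * Q.im y) : ℚ) : F) +
    ((Q.re x * Q.im y + Q.im x * Q.re y : ℚ) : F) * Q.s := by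
  conv_lhs => rw [Q.rep x, Q.rep y]
  push_cast
  linear_combination (Q.im x * Q.im y : F) * Q.sq

@[simp] theorem re_mul (x y : F) : Q.re (x * y) = Q.re x * Q.re y + p * (Q.im x * Q.im y) :=
  (Q.eq_of_rep (Q.mul_aux x y)).1
@[simp] theorem im_mul (x y : F) : Q.im (x * y) = Q.re x * Q.im y + Q.im x * Q.re y :=
  (Q.eq_of_rep (Q.mul_aux x y)).2
@[simp] theorem re_rat (a : ℚ) : Q.re (a : F) = a := (Q.eq_of_rep (b := 0) (by simp)).1
@[simp] theorem im_rat (a : ℚ) : Q.im (a : F) = 0 := (Q.eq_of_rep (a := a) (by simp)).2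
@[simp] theorem re_zero : Q.re (0 : F) = 0 := by simpa using Q.re_rat 0
@[simp] theorem im_zero : Q.im (0 : F) = 0 := by simpa using Q.im_rat 0
@[simp] theorem re_one : Q.re (1 : F) = 1 := by simpa using Q.re_rat 1
@[simp] theorem im_one : Q.im (1 : F) = 0 := by simpa using Q.im_rat 1
@[simp] theorem re_s : Q.re Q.s = 0 := (Q.eq_of_rep (b := 1) (by simp)).1
@[simp] theorem im_s : Q.im Q.s = 1 := (Q.eq_of_rep (a := 0) (by simp)).2
@[simp] theorem re_neg (x : F) : Q.re (-x) = -Q.re x := by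
  have := Q.re_add x (-x); rw [add_neg_cancel, Q.re_zero] at this; linarith
@[simp] theorem im_neg (x : F) : Q.im (-x) = -Q.im x := by
  have := Q.im_add x (-x); rw [add_neg_cancel, Q.im_zero] at this; linarith
@[simp] theorem re_sub (x y : F) : Q.re (x - y) = Q.re x - Q.re y := by
  rw [sub_eq_add_neg, re_add, re_neg, sub_eq_add_neg]
@[simp] theorem im_sub (x y : F) : Q.im (x - y) = Q.im x - Q.im y := by
  rw [sub_eq_add_neg, im_add, im_neg, sub_eq_add_neg]

theorem s_ne_zero : Q.s ≠ 0 := fun h => by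
  have := Q.sq
  rw [h] at this
  exact Q.prime.ne_zero (by exact_mod_cast (by simpa using this.symm : (p : F) = 0))

/-- The field norm. -/
def nrm (x : F) : ℚ := Q.re x ^ 2 - p * Q.im x ^ 2

theorem nrm_mul (x y : F) : Q.nrm (x * y) = Q.nrm x * Q.nrm y := by
  simp only [nrm, re_mul, im_mul]
  ring

theorem nrm_eq_zero {x : F} : Q.nrm x = 0 ↔ x = 0 := by
  constructor
  · intro h
    by_contra hx
    have h1 : Q.nrm (x * x⁻¹) = 1 := by simp [mul_inv_cancel₀ hx, nrm]
    rw [nrm_mul, h, zero_mul] at h1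
    exact zero_ne_one h1
  · rintro rfl
    simp [nrm]

/-- The embedding of `ℚ(√p)` in a field attached to a square root of `p`. -/
def emb {L : Type} [Field L] [CharZero L] (t : L) (ht : t ^ 2 = p) : F →+* L where
  toFun x := Q.re x + Q.im x * t
  map_one' := by simp
  map_zero' := by simp
  map_add' x y := by simp; ring
  map_mul' x y := by
    simp
    linear_combination -(Q.im x * Q.im y : L) * ht

theorem emb_apply {L : Type} [Field L] [CharZero L] (t : L) (ht : t ^ 2 = p) (x : F) :
    Q.emb t ht x = Q.re x + Q.im x * t := rfl

def conj : F →+* F := Q.emb (-Q.s) (by rw [neg_sq, Q.sq])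

theorem mul_conj (x : F) : x * Q.conj x = Q.nrm x := by
  conv_lhs => rw [Q.rep x]
  simp only [conj, emb_apply, re_add, re_rat, re_mul, im_add, im_mul, im_rat, re_s, im_s, nrm]
  push_cast
  linear_combination -(Q.im x : F) ^ 2 * Q.sq

def realEmb : F →+* ℝ := Q.emb (√(p : ℝ)) (Real.sq_sqrt (Nat.cast_nonneg p))
def realEmb' : F →+* ℝ := Q.emb (-√(p : ℝ)) (by rw [neg_sq, Real.sq_sqrt (Nat.cast_nonneg p)])

theorem realEmb_mul (x : F) : Q.realEmb x * Q.realEmb' x = Q.nrm x := by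
  simp only [realEmb, realEmb', emb_apply, nrm]
  push_cast
  linear_combination -(Q.im x : ℝ) ^ 2 * Real.sq_sqrt (Nat.cast_nonneg (α := ℝ) p)

theorem nrm_pos {x : F} (h : ∀ σ : F →+* ℝ, 0 < σ x) : 0 < Q.nrm x := by
  have := mul_pos (h Q.realEmb) (h Q.realEmb')
  rw [realEmb_mul] at this
  exact_mod_cast this

theorem ratCast_smul (q : ℚ) (x : F) : q • x = (q : F) * x := by
  rw [Algebra.smul_def, eq_ratCast]

/-- Coordinates as a linear equivalence. -/
def equiv : F ≃ₗ[ℚ] (Fin 2 → ℚ) where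
  toFun x := ![Q.re x, Q.im x]
  map_add' x y := by ext i; fin_cases i <;> simp
  map_smul' q x := by ext i; fin_cases i <;> simp [ratCast_smul]
  invFun v := (v 0 : F) + v 1 * Q.s
  left_inv x := (Q.rep x).symm
  right_inv v := by ext i; fin_cases i <;> simp

end QuadField

end Quad

namespace QuadField

open Module

variable {F : Type} [Field F] [CharZero F] {p : ℕ} (Q : QuadField F p)

theorem finrank_eq (Q : QuadField F p) : finrank ℚ F = 2 := by
  rw [Q.equiv.finrank_eq]
  simp

theorem finite (Q : QuadField F p) : FiniteDimensional ℚ F := Module.Finite.equiv Q.equiv.symm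

theorem equiv_zero (x : F) : Q.equiv x 0 = Q.re x := rfl
theorem equiv_one (x : F) : Q.equiv x 1 = Q.im x := rfl

/-- The transfer of the form `⟨E⟩` along the functional `im`. -/
def tr (E : F) : Witt ℚ := frm (Q.im E) + frm (-(Q.im E * Q.nrm E))

theorem exists_tr_diag (E : Fˣ) : ∃ (b : Fin 2 → ℚˣ) (g : F ≃ₗ[ℚ] (Fin 2 → ℚ)),
    (∀ x y, Q.im (E * x * y) = ∑ j, (b j : ℚ) * g x j * g y j) ∧ ∑ j, cls (b j) = Q.tr E := by
  have key : ∀ (b : Fin 2 → ℚˣ) (g : (Fin 2 → ℚ) →ₗ[ℚ] (Fin 2 → ℚ)) (hg : Function.Injective g),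
      (∀ x y, Q.im (E * x * y) = ∑ j, (b j : ℚ) * g (Q.equiv x) j * g (Q.equiv y) j) →
      ∑ j, cls (b j) = Q.tr E →
      ∃ (b : Fin 2 → ℚˣ) (g : F ≃ₗ[ℚ] (Fin 2 → ℚ)),
    (∀ x y, Q.im (E * x * y) = ∑ j, (b j : ℚ) * g x j * g y j) ∧ ∑ j, cls (b j) = Q.tr E :=
    fun b g hg h1 h2 => ⟨b, Q.equiv.trans (LinearEquiv.ofInjectiveEndo g hg), h1, h2⟩
  have hE := Q.nrm_eq_zero.not.mpr E.ne_zero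
  by_cases h : Q.im (E : F) = 0
  · have h0 : Q.re (E : F) ≠ 0 := fun h0 => E.ne_zero (Q.ext (by simpa using h0) (by simpa using h))
    refine key ![1, -1] (Matrix.toLin' !![Q.re (E : F) / 2, 1; Q.re (E : F) / 2, -1]) ?_ ?_ ?_
    · rw [← LinearMap.ker_eq_bot, Matrix.ker_toLin'_eq_bot_iff]
      intro v hv
      simp [dotProduct, Fin.sum_univ_two] at hv
      ext i
      fin_cases i
      · have : Q.re (E : F) * v 0 = 0 := by linarith [hv.1, hv.2]
        simpa [h0] using this
      · simp
        linarith [hv.1, hv.2]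
    · intro x y
      simp [Matrix.toLin'_apply, Matrix.mulVec, dotProduct, Fin.sum_univ_two, equiv_zero, equiv_one, h]
      ring
    · simp [Fin.sum_univ_two, cls_neg, tr, h]
  · refine key ![Units.mk0 _ h, Units.mk0 (-(Q.im (E : F) * Q.nrm E))
      (neg_ne_zero.mpr (mul_ne_zero h hE))]
      (Matrix.toLin' !![1, Q.re (E : F) / Q.im E; 0, 1 / Q.im (E : F)]) ?_ ?_ ?_
    · rw [← LinearMap.ker_eq_bot, Matrix.ker_toLin'_eq_bot_iff]
      intro v hv
      simp [dotProduct, Fin.sum_univ_two, h] at hv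
      ext i
      fin_cases i
      · simpa [hv.2] using hv.1
      · simpa using hv.2
    · intro x y
      simp [Matrix.toLin'_apply, Matrix.mulVec, dotProduct, Fin.sum_univ_two, equiv_zero, equiv_one, nrm]
      field_simp
      ring
    · rw [Fin.sum_univ_two, tr, frm_of_ne h, frm_of_ne (neg_ne_zero.mpr (mul_ne_zero h hE))]
      rfl

variable {ι : Type} [Fintype ι]

theorem exists_tr_diag_family (a : ι → Fˣ) :
    ∃ (b : ι × Fin 2 → ℚˣ) (g : (ι → F) ≃ₗ[ℚ] (ι × Fin 2 → ℚ)),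
    (∀ x y, Q.im (∑ i, (a i : F) * x i * y i) = ∑ j, (b j : ℚ) * g x j * g y j) ∧
      ∑ j, cls (b j) = ∑ i, Q.tr (a i) := by
  choose b g h1 h2 using fun i => Q.exists_tr_diag (a i)
  refine ⟨fun j => b j.1 j.2, (LinearEquiv.piCongrRight g).trans
    (LinearEquiv.curry ℚ ℚ ι (Fin 2)).symm, fun x y => ?_, ?_⟩
  · have : ∀ (s : Finset ι) (f : ι → F), Q.im (∑ i ∈ s, f i) = ∑ i ∈ s, Q.im (f i) := fun s f =>
      map_sum (⟨⟨Q.im, Q.im_zero⟩, Q.im_add⟩ : F →+ ℚ) f s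
    rw [this, Fintype.sum_prod_type]
    exact Finset.sum_congr rfl fun i _ => h1 i _ _
  · rw [Fintype.sum_prod_type]
    exact Finset.sum_congr rfl fun i _ => h2 i

theorem sum_tr_eq_zero {a : ι → Fˣ} (h : Metab a) : ∑ i, Q.tr (a i) = 0 := by
  have := Q.finite
  obtain ⟨b, g, h1, h2⟩ := Q.exists_tr_diag_family a
  obtain ⟨M, hM, hd⟩ := h
  rw [← h2, sum_cls_eq_zero_iff]
  refine ⟨(M.restrictScalars ℚ).map g.toLinearMap, ?_, ?_⟩
  · rintro _ ⟨x, hx, rfl⟩ _ ⟨y, hy, rfl⟩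
    have := h1 x y
    rw [hM x hx y hy, Q.im_zero] at this
    exact this.symm
  · have e1 : finrank ℚ ((M.restrictScalars ℚ).map g.toLinearMap) = finrank ℚ M :=
      (LinearEquiv.finrank_eq (g.submoduleMap (M.restrictScalars ℚ))).symm
    rw [e1, ← finrank_mul_finrank ℚ F M, Q.finrank_eq, Fintype.card_prod, Fintype.card_fin]
    omega

/-- A vanishing transfer yields a rational subspace of half the dimension on which the form
takes rational values. -/
theorem exists_submodule_of_sum_tr {a : ι → Fˣ} (h : ∑ i, Q.tr (a i) = 0) :
    ∃ M : Submodule ℚ (ι → F), (∀ x ∈ M, ∀ y ∈ M, Q.im (∑ i, (a i : F) * x i * y i) = 0) ∧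
      Fintype.card ι ≤ finrank ℚ M := by
  obtain ⟨b, g, h1, h2⟩ := Q.exists_tr_diag_family a
  rw [← h2, sum_cls_eq_zero_iff] at h
  obtain ⟨M, hM, hd⟩ := h
  refine ⟨M.map g.symm.toLinearMap, ?_, ?_⟩
  · rintro _ ⟨x, hx, rfl⟩ _ ⟨y, hy, rfl⟩
    rw [h1]
    simpa using hM x hx y hy
  · have e1 : finrank ℚ (M.map g.symm.toLinearMap) = finrank ℚ M :=
      (LinearEquiv.finrank_eq (g.symm.submoduleMap M)).symm
    rw [e1]
    simp at hd
    omega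

theorem isWittFun_tr : IsWittFun (fun a : Fˣ => Q.tr a) := by
  have hneg : ∀ x : F, Q.tr x + Q.tr (-x) = 0 := fun x => by
    have h : Q.nrm (-x) = Q.nrm x := by simp [nrm]
    simp only [tr, h, im_neg, frm_neg, neg_mul]
    abel
  refine ⟨fun a b => ?_, fun a => hneg a, fun a b c h => ?_⟩
  · have : Metab ![a * b ^ 2, -a] := by
      rw [← sum_cls_eq_zero_iff]
      simp [Fin.sum_univ_two, isWittFun_cls.sq, cls_neg]
    have := Q.sum_tr_eq_zero this
    simp [Fin.sum_univ_two] at this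
    have h2 := hneg a
    push_cast
    exact add_right_cancel (this.trans h2.symm)
  · have : Metab ![a, b, -c, -(a * b * c)] := by
      rw [← sum_cls_eq_zero_iff]
      simp [Fin.sum_univ_four, cls_neg, isWittFun_cls.add a b c h]
    have := Q.sum_tr_eq_zero this
    simp [Fin.sum_univ_four] at this
    have h2 := hneg c
    have h3 := hneg (a * b * c)
    push_cast
    rw [← add_neg_eq_zero, ← this, eq_neg_of_add_eq_zero_right h2, eq_neg_of_add_eq_zero_right h3]
    abel

def trHom : Witt F →+ Witt ℚ := Q.isWittFun_tr.lift

theorem trHom_frm (x : F) : Q.trHom (frm x) = Q.tr x := by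
  by_cases h : x = 0
  · simp [h, tr]
  · rw [frm_of_ne h, trHom, IsWittFun.lift_cls, Units.val_mk0]

end QuadField

section Local

/-- The square of the pure quaternion with coordinates `x, y, z`. -/
def sqv {K : Type} [CommRing K] (a b x y z : K) : K := a * x ^ 2 + b * y ^ 2 - a * b * z ^ 2

theorem exists_sqv_eq_one {K : Type} [Field K] [CharZero K] {a b : K}
    (φ : ℍ[K, a, b] ≃ₐ[K] Matrix (Fin 2) (Fin 2) K) : ∃ x y z, sqv a b x y z = 1 := by
  set w := φ.symm !![1, 0; 0, -1] with hw
  have hw2 : w * w = 1 := by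
    rw [hw, ← map_mul, ← map_one φ.symm]
    congr 1
    ext i j
    fin_cases i <;> fin_cases j <;> simp
  have hns : ∀ r : K, w ≠ algebraMap K _ r := fun r h => by
    rw [hw, AlgEquiv.symm_apply_eq, AlgEquiv.commutes] at h
    have h0 := congrFun (congrFun h 0) 0
    have h1 := congrFun (congrFun h 1) 1
    simp [Matrix.algebraMap_matrix_apply] at h0 h1
    rw [← h0] at h1
    have : (2 : K) = 0 := by linear_combination -h1
    exact two_ne_zero this
  have hre := congrArg QuaternionAlgebra.re hw2
  have h1 := congrArg QuaternionAlgebra.imI hw2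
  have h2 := congrArg QuaternionAlgebra.imJ hw2
  have h3 := congrArg QuaternionAlgebra.imK hw2
  simp [QuaternionAlgebra.re_mul, QuaternionAlgebra.imI_mul, QuaternionAlgebra.imJ_mul,
    QuaternionAlgebra.imK_mul] at hre h1 h2 h3
  by_cases hr : w.re = 0
  · refine ⟨w.imI, w.imJ, w.imK, ?_⟩
    rw [hr] at hre
    rw [sqv]
    linear_combination hre
  · exfalso
    have e1 : w.imI = 0 := by
      have : w.re * w.imI = 0 := by linear_combination h1 / 2
      simpa [hr] using this
    have e2 : w.imJ = 0 := by
      have : w.re * w.imJ = 0 := by linear_combination h2 / 2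
      simpa [hr] using this
    have e3 : w.imK = 0 := by
      have : w.re * w.imK = 0 := by linear_combination h3 / 2
      simpa [hr] using this
    apply hns w.re
    ext <;> simp [QuaternionAlgebra.algebraMap_eq, e1, e2, e3]

theorem exists_dense_approx {F L : Type} [Field F] [Field L] [TopologicalSpace L]
    [IsTopologicalRing L] (i : F →+* L) (hi : DenseRange i) {S : Set L} (hS : IsOpen S)
    (h0 : 0 ∈ S) {a b : F} {x y z : L} (h : sqv (i a) (i b) x y z = 1) (c : F) :
    ∃ x y z : F, i ((sqv a b x y z - 1) * c⁻¹) ∈ S := by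
  let f : L × L × L → L := fun t => (sqv (i a) (i b) t.1 t.2.1 t.2.2 - 1) * (i c)⁻¹
  have hf : Continuous f := by
    unfold f sqv
    fun_prop
  obtain ⟨⟨x', y', z'⟩, ht⟩ := (hi.prodMap (hi.prodMap hi)).exists_mem_open (hS.preimage hf)
    ⟨(x, y, z), by simpa [f, h] using h0⟩
  refine ⟨x', y', z', ?_⟩
  convert ht using 1
  simp [f, sqv]

open IsDedekindDomain

variable {F : Type} [Field F] [NumberField F] {A B : F}

theorem exists_local_approx (v : HeightOneSpectrum (𝓞 F))
    (h : Nonempty (ℍ[v.adicCompletion F, algebraMap F (v.adicCompletion F) A,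
            algebraMap F (v.adicCompletion F) B] ≃ₐ[v.adicCompletion F]
          Matrix (Fin 2) (Fin 2) (v.adicCompletion F))) {c : F} (hc : c ≠ 0) :
    ∃ x y z : F, v.valuation F (sqv A B x y z - 1) ≤ v.valuation F c := by
  let L := v.adicCompletion F
  have : CharZero L := algebraRat.charZero _
  obtain ⟨x, y, z, hxyz⟩ := exists_sqv_eq_one h.some
  obtain ⟨x', y', z', h1⟩ := exists_dense_approx (algebraMap F L)
    (HeightOneSpectrum.denseRange_algebraMap (K := F) v) (Valued.isOpen_integer L)
    (zero_mem _) hxyz c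
  refine ⟨x', y', z', ?_⟩
  replace h1 : Valued.v (algebraMap F L ((sqv A B x' y' z' - 1) * c⁻¹)) ≤ 1 := h1
  have h2 : Valued.v (algebraMap F L ((sqv A B x' y' z' - 1) * c⁻¹)) =
    v.valuation F ((sqv A B x' y' z' - 1) * c⁻¹) := HeightOneSpectrum.valuedAdicCompletion_eq_valuation' v _
  rw [h2, map_mul, map_inv₀] at h1
  have hc' : v.valuation F c ≠ 0 := (Valuation.ne_zero_iff _).mpr hc
  rwa [← div_eq_mul_inv, div_le_one₀ (zero_lt_iff.mpr hc')] at h1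

end Local

section Global

open IsDedekindDomain

variable {F : Type} [Field F] [NumberField F]

theorem exists_common_denom (S : Finset F) :
    ∃ d : 𝓞 F, d ≠ 0 ∧ ∀ x ∈ S, ∃ r : 𝓞 F, (d : F) * x = r := by
  obtain ⟨d, hd⟩ := IsLocalization.exist_integer_multiples_of_finset (nonZeroDivisors (𝓞 F)) S
  refine ⟨d, nonZeroDivisors.coe_ne_zero d, fun x hx => ?_⟩
  obtain ⟨r, hr⟩ := hd x hx
  refine ⟨r, ?_⟩
  rw [← Algebra.smul_def]
  exact hr.symm

theorem exists_exp_le {v : HeightOneSpectrum (𝓞 F)} {x : F} (hx : x ≠ 0) :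
    ∃ n : ℕ, WithZero.exp (-(n : ℤ)) ≤ v.valuation F x := by
  have h := (Valuation.ne_zero_iff (v.valuation F)).mpr hx
  obtain ⟨k, hk⟩ := WithZero.ne_zero_iff_exists.mp h
  refine ⟨(Multiplicative.toAdd k).natAbs, ?_⟩
  rw [← hk]
  change WithZero.exp _ ≤ WithZero.exp (Multiplicative.toAdd k)
  rw [WithZero.exp_le_exp]
  omega

/-- Weak approximation at finite places. -/
theorem exists_weak_approx (S : Finset (HeightOneSpectrum (𝓞 F)))
    (X m : HeightOneSpectrum (𝓞 F) → F) (hm : ∀ v, m v ≠ 0) :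
    ∃ x : F, ∀ v ∈ S, v.valuation F (x - X v) ≤ v.valuation F (m v) := by
  classical
  obtain ⟨d, hd0, hd⟩ := exists_common_denom (S.image X)
  have hd' : (d : F) ≠ 0 := by exact_mod_cast hd0
  choose r hr using fun v : S => hd (X v) (Finset.mem_image_of_mem X v.2)
  choose N hN using fun v : HeightOneSpectrum (𝓞 F) =>
    exists_exp_le (v := v) (mul_ne_zero hd' (hm v))
  obtain ⟨y, hy⟩ := IsDedekindDomain.exists_forall_sub_mem_ideal (s := S)
    (fun v => v.asIdeal) N (fun v _ => v.prime) (fun v _ w _ h h2 => h (HeightOneSpectrum.ext h2)) r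
  refine ⟨y / d, fun v hv => ?_⟩
  have h1 : v.valuation F (algebraMap (𝓞 F) F y - algebraMap (𝓞 F) F (r ⟨v, hv⟩)) ≤
      WithZero.exp (-(N v : ℤ)) := by
    rw [← map_sub (algebraMap (𝓞 F) F), v.valuation_of_algebraMap]
    exact (v.intValuation_le_pow_iff_mem _ _).mpr (hy v hv)
  have h2 := h1.trans (hN v)
  have hr' : algebraMap (𝓞 F) F (r ⟨v, hv⟩) = d * X v := (hr ⟨v, hv⟩).symm
  rw [hr'] at h2
  have h3 : (algebraMap (𝓞 F) F y) - d * X v = d * (y / d - X v) := by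
    field_simp
  change v.valuation F ((algebraMap (𝓞 F) F y) - d * X v) ≤ _ at h2
  rw [h3, map_mul, map_mul] at h2
  exact le_of_mul_le_mul_left h2 (zero_lt_iff.mpr ((Valuation.ne_zero_iff _).mpr hd'))

theorem valuation_sqv_le (v : HeightOneSpectrum (𝓞 F)) {A B c : F} (hc : c ≠ 0) (X Y Z : F)
    (h : v.valuation F (sqv A B X Y Z - 1) ≤ v.valuation F c) :
    ∃ m : F, m ≠ 0 ∧ ∀ x y z, v.valuation F (x - X) ≤ v.valuation F m →
      v.valuation F (y - Y) ≤ v.valuation F m → v.valuation F (z - Z) ≤ v.valuation F m →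
      v.valuation F (sqv A B x y z - 1) ≤ v.valuation F c := by
  classical
  obtain ⟨d, hd0, hd⟩ := exists_common_denom
    {A / c, A * (2 * X) / c, B / c, B * (2 * Y) / c, A * B / c, A * B * (2 * Z) / c}
  have hcv : 0 < v.valuation F c := zero_lt_iff.mpr ((Valuation.ne_zero_iff _).mpr hc)
  have key : ∀ a x X : F, (∃ r : 𝓞 F, (d : F) * (a / c) = r) →
      (∃ r : 𝓞 F, (d : F) * (a * (2 * X) / c) = r) →
      v.valuation F (x - X) ≤ v.valuation F (d : F) →
      v.valuation F (a * x ^ 2 - a * X ^ 2) ≤ v.valuation F c := by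
    rintro a x X ⟨r, hr⟩ ⟨r', hr'⟩ hx
    have hb : ∀ (e : F) (s : 𝓞 F), (d : F) * (e / c) = s →
        v.valuation F d * v.valuation F e ≤ v.valuation F c := fun e s hs => by
      have h1 := v.valuation_le_one (K := F) s
      change v.valuation F (s : F) ≤ 1 at h1
      rw [← hs, map_mul, map_div₀, ← mul_div_assoc, div_le_one₀ hcv] at h1
      exact h1
    have h1 := hb _ _ hr
    have h2 := hb _ _ hr'
    have hd1 : v.valuation F (d : F) ≤ 1 := v.valuation_le_one (K := F) d
    have e : a * x ^ 2 - a * X ^ 2 = (x - X) * a * (x - X) + (x - X) * (a * (2 * X)) := by ring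
    rw [e]
    refine (Valuation.map_add _ _ _).trans (max_le ?_ ?_)
    · rw [map_mul, map_mul]
      refine (mul_le_of_le_one_right' (hx.trans hd1)).trans (le_trans ?_ h1)
      gcongr
    · rw [map_mul]
      refine le_trans ?_ h2
      gcongr
  refine ⟨d, by exact_mod_cast hd0, fun x y z hx hy hz => ?_⟩
  have e : sqv A B x y z - 1 = (A * x ^ 2 - A * X ^ 2) + (B * y ^ 2 - B * Y ^ 2) -
      (A * B * z ^ 2 - A * B * Z ^ 2) + (sqv A B X Y Z - 1) := by
    simp only [sqv]
    ring
  rw [e]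
  refine (Valuation.map_add _ _ _).trans (max_le ?_ h)
  refine (Valuation.map_sub _ _ _).trans (max_le ?_ ?_)
  · refine (Valuation.map_add _ _ _).trans (max_le ?_ ?_)
    · exact key _ _ _ (hd _ (by simp)) (hd _ (by simp)) hx
    · exact key _ _ _ (hd _ (by simp)) (hd _ (by simp)) hy
  · exact key _ _ _ (hd _ (by simp)) (hd _ (by simp)) hz

/-- An element integral at all places above `ℓ` has a denominator prime to `ℓ`. -/
theorem exists_denom_prime_to {ℓ : ℕ} (hℓ : ℓ.Prime) {t : F}
    (h : ∀ v : HeightOneSpectrum (𝓞 F), (ℓ : 𝓞 F) ∈ v.asIdeal → v.valuation F t ≤ 1) :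
    ∃ (n : ℕ) (y : 𝓞 F), ¬ ℓ ∣ n ∧ (n : F) * t = y := by
  let D : Ideal (𝓞 F) :=
    { carrier := {d | ∃ y : 𝓞 F, (d : F) * t = y}
      zero_mem' := ⟨0, by simp⟩
      add_mem' := by
        rintro a b ⟨y, hy⟩ ⟨z, hz⟩
        exact ⟨y + z, by push_cast; rw [add_mul, hy, hz]⟩
      smul_mem' := by
        rintro a b ⟨y, hy⟩
        exact ⟨a * y, by simp only [smul_eq_mul]; push_cast; rw [mul_assoc, hy]⟩ }
  have hℓ0 : (ℓ : 𝓞 F) ≠ 0 := by exact_mod_cast hℓ.ne_zero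
  have hD : D ⊔ Ideal.span {(ℓ : 𝓞 F)} = ⊤ := by
    by_contra hne
    obtain ⟨M, hM, hle⟩ := Ideal.exists_le_maximal _ hne
    have hℓM : (ℓ : 𝓞 F) ∈ M := hle (Ideal.mem_sup_right (Ideal.mem_span_singleton_self _))
    let v : HeightOneSpectrum (𝓞 F) := ⟨M, hM.isPrime, fun h0 => hℓ0 (by simpa [h0] using hℓM)⟩
    obtain ⟨n, d, hnd⟩ := HeightOneSpectrum.exists_primeCompl_mul_eq_of_integer v t (h v hℓM)
    exact d.2 (hle (Ideal.mem_sup_left (show (d : 𝓞 F) ∈ D from ⟨n, by rw [mul_comm]; exact hnd⟩)))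
  obtain ⟨m, hm0, hm⟩ : ∃ m : ℕ, m ≠ 0 ∧ (m : 𝓞 F) ∈ D := by
    obtain ⟨m, hm0, hm⟩ := ((IsFractionRing.isAlgebraic_iff ℤ ℚ F).mpr
      (Algebra.IsAlgebraic.isAlgebraic (R := ℚ) t)).exists_integral_multiple
    refine ⟨m.natAbs, by simpa using hm0, ?_⟩
    have : (m : 𝓞 F) ∈ D := ⟨⟨m • t, hm⟩, by simp⟩
    rcases Int.natAbs_eq m with h | h
    · rwa [h, Int.cast_natCast] at this
    · rw [h] at this
      have h2 := D.neg_mem this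
      rwa [Int.cast_neg, neg_neg, Int.cast_natCast] at h2
  obtain ⟨a, n, hn, rfl⟩ := Nat.exists_eq_pow_mul_and_not_dvd hm0 ℓ hℓ.ne_one
  have hDa : D ⊔ Ideal.span {(ℓ : 𝓞 F)} ^ a = ⊤ := Ideal.sup_pow_eq_top hD
  rw [Ideal.span_singleton_pow, Ideal.eq_top_iff_one, Submodule.mem_sup] at hDa
  obtain ⟨d, hd, e, he, hde⟩ := hDa
  obtain ⟨f, rfl⟩ := Ideal.mem_span_singleton'.mp he
  have hnD : (n : 𝓞 F) ∈ D := by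
    have : (n : 𝓞 F) = n * d + f * ((ℓ ^ a * n : ℕ) : 𝓞 F) := by
      push_cast
      linear_combination -(n : 𝓞 F) * hde
    rw [this]
    exact D.add_mem (D.mul_mem_left _ hd) (D.mul_mem_left _ hm)
  obtain ⟨y, hy⟩ := hnD
  exact ⟨n, y, hn, by simpa using hy⟩

theorem exists_approx {A B : F} (hunram : ∀ v : HeightOneSpectrum (𝓞 F),
      Nonempty
        (ℍ[v.adicCompletion F, algebraMap F (v.adicCompletion F) A,
            algebraMap F (v.adicCompletion F) B] ≃ₐ[v.adicCompletion F]
          Matrix (Fin 2) (Fin 2) (v.adicCompletion F))) {ℓ : ℕ} (hℓ : ℓ.Prime) (k : ℕ) :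
    ∃ (x y z : F) (n : ℕ) (w : 𝓞 F), ¬ ℓ ∣ n ∧
      (n : F) * (sqv A B x y z - 1) = (ℓ : F) ^ k * w := by
  have hℓ0 : (ℓ : 𝓞 F) ≠ 0 := by exact_mod_cast hℓ.ne_zero
  have hc : (ℓ : F) ^ k ≠ 0 := pow_ne_zero _ (by exact_mod_cast hℓ.ne_zero)
  have hfin : {v : HeightOneSpectrum (𝓞 F) | (ℓ : 𝓞 F) ∈ v.asIdeal}.Finite := by
    convert Ideal.finite_factors (I := Ideal.span {(ℓ : 𝓞 F)}) (by simpa using hℓ0) using 3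
    rw [Ideal.dvd_span_singleton]
  choose X Y Z h using fun v => exists_local_approx v (hunram v) hc
  choose m hm0 hm using fun v => valuation_sqv_le v hc (X v) (Y v) (Z v) (h v)
  obtain ⟨x, hx⟩ := exists_weak_approx hfin.toFinset X m hm0
  obtain ⟨y, hy⟩ := exists_weak_approx hfin.toFinset Y m hm0
  obtain ⟨z, hz⟩ := exists_weak_approx hfin.toFinset Z m hm0
  obtain ⟨n, w, hn, hw⟩ := exists_denom_prime_to hℓ (t := (sqv A B x y z - 1) / (ℓ : F) ^ k)
    fun v hv => by
      have hv' := hfin.mem_toFinset.mpr hv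
      rw [map_div₀, div_le_one₀ (zero_lt_iff.mpr ((Valuation.ne_zero_iff _).mpr hc))]
      exact hm v x y z (hx v hv') (hy v hv') (hz v hv')
  refine ⟨x, y, z, n, w, hn, ?_⟩
  rw [← hw]
  field_simp

end Global

theorem exists_int_of_isIntegral {q : ℚ} (h : IsIntegral ℤ q) : ∃ n : ℤ, q = n := by
  obtain ⟨n, hn⟩ := IsIntegrallyClosed.isIntegral_iff.mp h
  exact ⟨n, by rw [← hn]; rfl⟩

namespace QuadField

variable {F : Type} [Field F] [CharZero F] {p : ℕ} (Q : QuadField F p)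

theorem isIntegral_rat {q : ℚ} (h : IsIntegral ℤ (q : F)) : ∃ n : ℤ, q = n := by
  apply exists_int_of_isIntegral
  have h2 : IsIntegral ℤ (algebraMap ℚ F q) := by simpa using h
  exact (isIntegral_algebraMap_iff (algebraMap ℚ F).injective).mp h2

theorem exists_int_coords {x : F} (h : IsIntegral ℤ x) :
    ∃ a b : ℤ, 2 * Q.re x = a ∧ 2 * Q.im x = b := by
  have hc : IsIntegral ℤ (Q.conj x) := by
    have := h.map (Q.conj.toIntAlgHom)
    exact this
  obtain ⟨a, ha⟩ := isIntegral_rat (F := F) (q := 2 * Q.re x) (by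
    have : ((2 * Q.re x : ℚ) : F) = x + Q.conj x := by
      conv_rhs => rw [conj, emb_apply]; enter [1]; rw [Q.rep x]
      push_cast
      ring
    rw [this]
    exact h.add hc)
  obtain ⟨n, hn⟩ := isIntegral_rat (F := F) (q := Q.nrm x) (by
    rw [← Q.mul_conj]
    exact h.mul hc)
  have h1 : (p * (2 * Q.im x)) ^ 2 = (p * (a ^ 2 - 4 * n) : ℤ) := by
    push_cast
    rw [← ha, ← hn, nrm]
    ring
  obtain ⟨j, hj⟩ := exists_int_of_isIntegral (q := p * (2 * Q.im x))
    (IsIntegral.of_pow (n := 2) two_pos (h1 ▸ isIntegral_algebraMap (R := ℤ)))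
  rw [hj] at h1
  have h1' : j ^ 2 = p * (a ^ 2 - 4 * n) := by exact_mod_cast h1
  obtain ⟨b, rfl⟩ := Int.Prime.dvd_pow' Q.prime (Dvd.intro _ h1'.symm)
  refine ⟨a, b, ha, ?_⟩
  have hp : (p : ℚ) ≠ 0 := by exact_mod_cast Q.prime.ne_zero
  apply mul_left_cancel₀ hp
  rw [hj]
  push_cast
  rfl

section Padic

variable (ℓ : ℕ) [Fact ℓ.Prime]

/-- The `ℓ`-adic sup norm in the coordinates. -/
def nl (x : F) : ℝ := max ‖(Q.re x : ℚ_[ℓ])‖ ‖(Q.im x : ℚ_[ℓ])‖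

theorem nl_add (x y : F) : Q.nl ℓ (x + y) ≤ max (Q.nl ℓ x) (Q.nl ℓ y) := by
  simp only [nl, re_add, im_add, Rat.cast_add]
  refine max_le ((Padic.nonarchimedean _ _).trans ?_) ((Padic.nonarchimedean _ _).trans ?_)
  · exact max_le_max (le_max_left _ _) (le_max_left _ _)
  · exact max_le_max (le_max_right _ _) (le_max_right _ _)

theorem nl_nonneg (x : F) : 0 ≤ Q.nl ℓ x := (norm_nonneg _).trans (le_max_left _ _)

theorem nl_mul (x y : F) : Q.nl ℓ (x * y) ≤ Q.nl ℓ x * Q.nl ℓ y := by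
  have h : ∀ a b : ℚ_[ℓ], ‖a‖ ≤ Q.nl ℓ x → ‖b‖ ≤ Q.nl ℓ y → ‖a * b‖ ≤ Q.nl ℓ x * Q.nl ℓ y :=
    fun a b ha hb => by
      rw [norm_mul]
      exact mul_le_mul ha hb (norm_nonneg _) (Q.nl_nonneg ℓ x)
  have hp : ‖(p : ℚ_[ℓ])‖ ≤ 1 := by exact_mod_cast Padic.norm_int_le_one (p := ℓ) p
  have x1 : ‖(Q.re x : ℚ_[ℓ])‖ ≤ Q.nl ℓ x := le_max_left _ _
  have x2 : ‖(Q.im x : ℚ_[ℓ])‖ ≤ Q.nl ℓ x := le_max_right _ _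
  have y1 : ‖(Q.re y : ℚ_[ℓ])‖ ≤ Q.nl ℓ y := le_max_left _ _
  have y2 : ‖(Q.im y : ℚ_[ℓ])‖ ≤ Q.nl ℓ y := le_max_right _ _
  conv_lhs => rw [nl]
  rw [re_mul, im_mul]
  push_cast
  refine max_le ((Padic.nonarchimedean _ _).trans (max_le ?_ ?_))
    ((Padic.nonarchimedean _ _).trans (max_le ?_ ?_))
  · exact h _ _ x1 y1
  · rw [norm_mul]
    exact (mul_le_of_le_one_left (norm_nonneg _) hp).trans (h _ _ x2 y2)
  · exact h _ _ x1 y2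
  · exact h _ _ x2 y1

theorem nl_rat (q : ℚ) : Q.nl ℓ (q : F) = ‖(q : ℚ_[ℓ])‖ := by
  rw [nl, re_rat, im_rat, Rat.cast_zero, norm_zero]
  exact max_eq_left (norm_nonneg _)

/-- The `ℓ`-integral elements. -/
def intRing : Subring F where
  carrier := {x | Q.nl ℓ x ≤ 1}
  mul_mem' {x y} hx hy := (Q.nl_mul ℓ x y).trans (mul_le_one₀ hx (Q.nl_nonneg ℓ y) hy)
  one_mem' := by simp [nl]
  add_mem' {x y} hx hy := (Q.nl_add ℓ x y).trans (max_le hx hy)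
  zero_mem' := by simp [nl]
  neg_mem' {x} hx := by simpa [nl] using hx

theorem nl_pow_sub_one {u r : F} (hr : Q.nl ℓ r ≤ 1) (h : u - 1 = ℓ * r) (N : ℕ) :
    Q.nl ℓ (u ^ ℓ ^ N - 1) ≤ (ℓ : ℝ)⁻¹ ^ (N + 1) := by
  let R := Q.intRing ℓ
  have hu : u = 1 + ((ℓ : R) * (⟨r, hr⟩ : R) : R) := by
    push_cast
    linear_combination h
  let u' : R := 1 + (ℓ : R) * (⟨r, hr⟩ : R)
  have h1 : (ℓ : R) ∣ u' - 1 := ⟨⟨r, hr⟩, by simp [u']⟩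
  obtain ⟨t, ht⟩ := dvd_sub_pow_of_dvd_sub h1 N
  have h2 : u ^ ℓ ^ N - 1 = ((((ℓ : ℚ) ^ (N + 1) : ℚ)) : F) * (t : F) := by
    have := congrArg (Subtype.val) ht
    rw [hu]
    push_cast at this ⊢
    simpa [u'] using this
  rw [h2]
  refine (Q.nl_mul ℓ _ _).trans ?_
  rw [nl_rat]
  refine (mul_le_of_le_one_right (norm_nonneg _) t.2).trans_eq ?_
  push_cast
  rw [norm_pow, Padic.norm_p]

variable {ℓ}

theorem nl_le_one_of_isIntegral (h2 : ℓ ≠ 2) {x : F} (h : IsIntegral ℤ x) : Q.nl ℓ x ≤ 1 := by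
  obtain ⟨a, b, ha, hb⟩ := Q.exists_int_coords h
  have h2' : ‖(2 : ℚ_[ℓ])‖ = 1 := by
    have := (Padic.norm_natCast_eq_one_iff (p := ℓ) (n := 2)).mpr
      ((Nat.coprime_primes Fact.out Nat.prime_two).mpr h2)
    exact_mod_cast this
  have key : ∀ (q : ℚ) (c : ℤ), 2 * q = c → ‖(q : ℚ_[ℓ])‖ ≤ 1 := fun q c hq => by
    have h3 : ‖((2 * q : ℚ) : ℚ_[ℓ])‖ ≤ 1 := by
      rw [hq, Rat.cast_intCast]
      exact Padic.norm_int_le_one c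
    push_cast at h3
    rwa [norm_mul, h2', one_mul] at h3
  exact max_le (key _ _ ha) (key _ _ hb)

theorem tr_mul_sq (a : F) {b : F} (hb : b ≠ 0) : Q.tr (a * b ^ 2) = Q.tr a := by
  rw [← trHom_frm, ← trHom_frm, frm_mul_sq a hb]

theorem tr_neg (a : F) : Q.tr (-a) = -Q.tr a := by
  rw [← trHom_frm, ← trHom_frm, frm_neg, map_neg]

/-- Residues of transfers are insensitive to multiplication by elements close to one. -/
theorem dl_tr_mul (h2 : ℓ ≠ 2) {u r : F} (hr : Q.nl ℓ r ≤ 1) (h : u - 1 = ℓ * r) (hu : u ≠ 0)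
    (E : F) : dl ℓ (Q.tr (u * E)) = dl ℓ (Q.tr E) := by
  wlog hE : Q.im E ≠ 0 generalizing E
  · push Not at hE
    by_cases hE0 : E = 0
    · simp [hE0]
    have hg : (1 + Q.s) ≠ 0 := fun h0 => by simpa using congrArg Q.im h0
    have hre : Q.re E ≠ 0 := fun h0 => hE0 (Q.ext (by simpa using h0) (by simpa using hE))
    have := this (E * (1 + Q.s) ^ 2) (by
      have : Q.im (E * (1 + Q.s) ^ 2) = 2 * Q.re E := by
        simp [pow_two, hE]
        ring
      rw [this]
      exact mul_ne_zero two_ne_zero hre)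
    rwa [← mul_assoc, Q.tr_mul_sq _ hg, Q.tr_mul_sq _ hg] at this
  have hℓ := (Fact.out : ℓ.Prime)
  have hodd : Odd ℓ := hℓ.odd_of_ne_two h2
  have hE' : 0 < ‖(Q.im E : ℚ_[ℓ])‖ := norm_pos_iff.mpr (by exact_mod_cast hE)
  have hnE : 0 < Q.nl ℓ E := hE'.trans_le (le_max_right _ _)
  have hℓ1 : (ℓ : ℝ)⁻¹ < 1 := inv_lt_one_of_one_lt₀ (by exact_mod_cast hℓ.one_lt)
  have hℓ0 : 0 < (ℓ : ℝ)⁻¹ := inv_pos.mpr (by exact_mod_cast hℓ.pos)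
  obtain ⟨N, hN⟩ := exists_pow_lt_of_lt_one (div_pos hE' hnE) hℓ1
  have hN' : (ℓ : ℝ)⁻¹ ^ (N + 1) * Q.nl ℓ E < ‖(Q.im E : ℚ_[ℓ])‖ := by
    rw [← lt_div_iff₀ hnE]
    refine lt_of_le_of_lt ?_ hN
    rw [pow_succ]
    exact mul_le_of_le_one_right (by positivity) hℓ1.le
  obtain ⟨m, hm⟩ : Odd (ℓ ^ N) := hodd.pow
  have hclose := Q.nl_pow_sub_one ℓ hr h N
  have hδ1 : Q.nl ℓ (u ^ ℓ ^ N - 1) < 1 :=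
    hclose.trans_lt (pow_lt_one₀ hℓ0.le hℓ1 (Nat.succ_ne_zero N))
  have htr : Q.tr (u * E) = Q.tr (u ^ ℓ ^ N * E) := by
    rw [hm, ← Q.tr_mul_sq (u * E) (pow_ne_zero m hu)]
    congr 1
    ring
  rw [htr]
  generalize u ^ ℓ ^ N = w at hclose hδ1
  have h3 : ‖((Q.im (w * E) : ℚ_[ℓ]) - Q.im E)‖ < ‖(Q.im E : ℚ_[ℓ])‖ := by
    have e : ((Q.im (w * E) : ℚ_[ℓ]) - Q.im E) = (Q.im ((w - 1) * E) : ℚ) := by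
      rw [sub_mul, one_mul, im_sub, Rat.cast_sub]
    rw [e]
    refine lt_of_le_of_lt ((le_max_right _ _).trans (Q.nl_mul ℓ _ _)) (lt_of_le_of_lt ?_ hN')
    exact mul_le_mul_of_nonneg_right hclose hnE.le
  have h4 : ‖((Q.nrm w : ℚ_[ℓ]) - 1)‖ < 1 := by
    have e : Q.nrm w - 1 = Q.re (w - 1) * (Q.re (w - 1) + 2) - p * Q.im (w - 1) ^ 2 := by
      simp [nrm]
      ring
    have e' : ((Q.nrm w : ℚ_[ℓ]) - 1) = (Q.re (w - 1) : ℚ_[ℓ]) * (Q.re (w - 1) + (2 : ℤ)) -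
        (p : ℤ) * (Q.im (w - 1) : ℚ_[ℓ]) ^ 2 := by
      have := congrArg (Rat.cast : ℚ → ℚ_[ℓ]) e
      push_cast at this ⊢
      exact this
    have r1 : ‖(Q.re (w - 1) : ℚ_[ℓ])‖ < 1 := (le_max_left _ _).trans_lt hδ1
    have i1 : ‖(Q.im (w - 1) : ℚ_[ℓ])‖ < 1 := (le_max_right _ _).trans_lt hδ1
    rw [e', sub_eq_add_neg]
    refine (Padic.nonarchimedean _ _).trans_lt (max_lt ?_ ?_)
    · rw [norm_mul]
      refine mul_lt_one_of_nonneg_of_lt_one_left (norm_nonneg _) r1 ?_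
      exact (Padic.nonarchimedean _ _).trans (max_le r1.le (Padic.norm_int_le_one _))
    · rw [norm_neg, norm_mul, norm_pow]
      exact mul_lt_one_of_nonneg_of_lt_one_right (Padic.norm_int_le_one _) (by positivity)
        (pow_lt_one₀ (norm_nonneg _) i1 two_ne_zero)
  have h4' : ‖(Q.nrm w : ℚ_[ℓ])‖ ≤ 1 := by
    have := Padic.nonarchimedean ((Q.nrm w : ℚ_[ℓ]) - 1) 1
    rw [sub_add_cancel, norm_one] at this
    exact this.trans (max_le h4.le le_rfl)
  rw [tr, tr, map_add, map_add, ← dl_congr h3]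
  congr 1
  refine (dl_congr ?_).symm
  have hnE0 : (Q.nrm E : ℚ_[ℓ]) ≠ 0 := by
    have : Q.nrm E ≠ 0 := Q.nrm_eq_zero.not.mpr (by rintro rfl; simp at hE)
    exact_mod_cast this
  rw [nrm_mul]
  push_cast
  have e : -((Q.im (w * E) : ℚ_[ℓ]) * (Q.nrm w * Q.nrm E)) - -(Q.im E * Q.nrm E) =
      -(((Q.im (w * E) - Q.im E) * Q.nrm w + Q.im E * (Q.nrm w - 1)) * Q.nrm E) := by ring
  rw [e, norm_neg, norm_neg, norm_mul, norm_mul]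
  refine mul_lt_mul_of_pos_right ?_ (norm_pos_iff.mpr hnE0)
  refine (Padic.nonarchimedean _ _).trans_lt (max_lt ?_ ?_)
  · rw [norm_mul]
    exact (mul_le_of_le_one_right (norm_nonneg _) h4').trans_lt h3
  · rw [norm_mul]
    exact mul_lt_of_lt_one_right hE' h4

end Padic

end QuadField

section Pfister

variable {K : Type} [Field K]

theorem frm_add_of_rep {a b m y z : K} (hm : a * y ^ 2 + b * z ^ 2 = m) (h : m ≠ 0) :
    frm a + frm b = frm m + frm (a * b * m) := by
  subst hm
  by_cases hy : y = 0
  · subst hy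
    have hz : z ≠ 0 := by rintro rfl; simp at h
    have hb : b ≠ 0 := by rintro rfl; simp at h
    have e1 : a * 0 ^ 2 + b * z ^ 2 = b * z ^ 2 := by ring
    have e2 : a * b * (b * z ^ 2) = a * (b * z) ^ 2 := by ring
    rw [e1, e2, frm_mul_sq _ hz, frm_mul_sq _ (mul_ne_zero hb hz), add_comm]
  by_cases hz : z = 0
  · subst hz
    have ha : a ≠ 0 := by rintro rfl; simp at h
    have e1 : a * y ^ 2 + b * 0 ^ 2 = a * y ^ 2 := by ring
    have e2 : a * b * (a * y ^ 2) = b * (a * y) ^ 2 := by ring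
    rw [e1, e2, frm_mul_sq _ hy, frm_mul_sq _ (mul_ne_zero ha hy)]
  rw [← frm_mul_sq a hy, ← frm_mul_sq b hz, frm_add h, ← frm_mul_sq (a * b * _) (mul_ne_zero hy hz)]
  congr 2
  ring

/-- The Witt class of the norm form of the quaternion algebra with `i² = -a`, `j² = -b`. -/
def pf (a b : K) : Witt K := frm 1 + frm a + frm b + frm (a * b)

theorem pf_comm (a b : K) : pf a b = pf b a := by
  rw [pf, pf, mul_comm a b]
  abel

theorem baseChange_pf {L : Type} [Field L] (τ : K →+* L) (a b : K) :
    baseChange τ (pf a b) = pf (τ a) (τ b) := by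
  simp [pf, baseChange_frm]

theorem exists_pf_eq {a b q x y z : K} (ha : a ≠ 0) (hb : b ≠ 0)
    (hq : a * x ^ 2 + b * y ^ 2 + a * b * z ^ 2 = q) (h : q ≠ 0) :
    ∃ c, c ≠ 0 ∧ pf a b = pf q c := by
  by_cases hE : b * y ^ 2 + a * b * z ^ 2 = 0
  · have e : q = a * x ^ 2 := by linear_combination hE - hq
    have hx : x ≠ 0 := by rintro rfl; simp [e] at h
    refine ⟨b, hb, ?_⟩
    have e2 : a * x ^ 2 * b = a * b * x ^ 2 := by ring
    rw [pf, pf, e, frm_mul_sq a hx, e2, frm_mul_sq _ hx]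
  · obtain ⟨E, hE'⟩ : ∃ E, b * y ^ 2 + a * b * z ^ 2 = E := ⟨_, rfl⟩
    rw [hE'] at hE
    refine ⟨a * E, mul_ne_zero ha hE, ?_⟩
    have h1 := frm_add_of_rep hE' hE
    have e1 : b * (a * b) * E = a * E * b ^ 2 := by ring
    rw [e1, frm_mul_sq _ hb] at h1
    have h2 : a * x ^ 2 + E * 1 ^ 2 = q := by linear_combination hq - hE'
    have h3 := frm_add_of_rep h2 h
    rw [pf, pf, add_assoc _ (frm b), h1, mul_comm q (a * E), ← add_assoc, add_assoc (frm 1), h3]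
    abel

/-- Two anticommuting pure quaternions of norms `a`, `b` give the norm form another diagonalisation. -/
theorem pf_eq_of_orthogonal {C D a b : K} (hC : C ≠ 0) (hD : D ≠ 0) (ha : a ≠ 0) (hb : b ≠ 0)
    (v w : Fin 3 → K) (hv : C * v 0 ^ 2 + D * v 1 ^ 2 + C * D * v 2 ^ 2 = a)
    (hw : C * w 0 ^ 2 + D * w 1 ^ 2 + C * D * w 2 ^ 2 = b)
    (hvw : C * v 0 * w 0 + D * v 1 * w 1 + C * D * v 2 * w 2 = 0) : pf C D = pf a b := by
  have hCD := mul_ne_zero hC hD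
  have hab := mul_ne_zero ha hb
  let f : (Fin 3 → K) →ₗ[K] (Fin 3 → K) := Fintype.linearCombination K
    ![v, w, ![D * (v 1 * w 2 - v 2 * w 1), C * (v 2 * w 0 - v 0 * w 2), v 0 * w 1 - v 1 * w 0]]
  have key := sum_cls_eq_of_isometry
    (a := ![Units.mk0 a ha, Units.mk0 b hb, Units.mk0 _ hab])
    (b := ![Units.mk0 C hC, Units.mk0 D hD, Units.mk0 _ hCD]) f (fun x y => by
      simp only [f, Fintype.linearCombination_apply, Fin.sum_univ_three, Matrix.cons_val_zero,
        Matrix.cons_val_one, Matrix.cons_val, Units.val_mk0, Pi.add_apply,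
        Pi.smul_apply, smul_eq_mul]
      linear_combination x 0 * y 0 * hv + x 1 * y 1 * hw + x 2 * y 2 *
        (b * hv + (C * v 0 ^ 2 + D * v 1 ^ 2 + C * D * v 2 ^ 2) * hw) + (x 0 * y 1 + x 1 * y 0) * hvw - x 2 * y 2 *
        (C * v 0 * w 0 + D * v 1 * w 1 + C * D * v 2 * w 2) * hvw) le_rfl
  simp only [Fin.sum_univ_three, Matrix.cons_val_zero, Matrix.cons_val_one,
    Matrix.cons_val, ← frm_of_ne] at key
  rw [pf, pf, add_assoc, add_assoc, ← add_assoc (frm C), ← key]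
  abel

end Pfister

/-- `-A, -B`-norms of pure quaternions approximate `-1` at every rational prime. -/
def LocApprox {F : Type} [Field F] [NumberField F] (A B : F) : Prop :=
  ∀ ℓ k : ℕ, ℓ.Prime → ∃ (x y z : F) (n : ℕ) (w : 𝓞 F), ¬ ℓ ∣ n ∧
    (n : F) * (sqv A B x y z - 1) = (ℓ : F) ^ k * w

section Descent

open Module

variable {F : Type} [Field F] [NumberField F] {p : ℕ} (Q : QuadField F p)

namespace QuadField

theorem exists_close {C D : F} (hC : C ≠ 0) (hD : D ≠ 0) (h : LocApprox (-C) (-D))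
    {ℓ : ℕ} [hℓ : Fact ℓ.Prime] (h2 : ℓ ≠ 2) : ∃ u r E : F, u ≠ 0 ∧ E ≠ 0 ∧ u - 1 = ℓ * r ∧
      Q.nl ℓ r ≤ 1 ∧ pf C D = pf (-u) E := by
  obtain ⟨x, y, z, n, w, hn, hw⟩ := h ℓ 1 hℓ.out
  have hn0 : (n : F) ≠ 0 := by
    have : n ≠ 0 := by rintro rfl; simp at hn
    exact_mod_cast this
  obtain ⟨u, hu⟩ : ∃ u, sqv (-C) (-D) x y z = u := ⟨_, rfl⟩
  rw [hu, pow_one] at hw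
  have hr : Q.nl ℓ ((w : F) * ((1 / n : ℚ) : F)) ≤ 1 := by
    refine (Q.nl_mul ℓ _ _).trans (mul_le_one₀ ?_ (Q.nl_nonneg ℓ _) ?_)
    · exact Q.nl_le_one_of_isIntegral h2 (RingOfIntegers.isIntegral_coe w)
    · rw [nl_rat]
      push_cast
      rw [norm_div, norm_one, Padic.norm_natCast_eq_one_iff.mpr
        ((Nat.Prime.coprime_iff_not_dvd hℓ.out).mpr hn), div_one]
  have hur : u - 1 = ℓ * ((w : F) * ((1 / n : ℚ) : F)) := by
    push_cast
    field_simp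
    linear_combination hw
  have hu0 : u ≠ 0 := by
    rintro rfl
    have h1 : (-1 : F) = ((ℓ : ℚ) : F) * ((w : F) * ((1 / n : ℚ) : F)) := by
      rw [Rat.cast_natCast, ← hur]; ring
    have h3 := Q.nl_mul ℓ ((ℓ : ℚ) : F) ((w : F) * ((1 / n : ℚ) : F))
    rw [← h1, nl_rat, Rat.cast_natCast, Padic.norm_p] at h3
    have h4 : Q.nl ℓ (-1) = 1 := by
      have := Q.nl_rat ℓ (-1)
      push_cast at this
      rw [this]
      simp
    rw [h4] at h3
    have h5 : (ℓ : ℝ)⁻¹ < 1 := inv_lt_one_of_one_lt₀ (by exact_mod_cast hℓ.out.one_lt)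
    have h6 : (0 : ℝ) < (ℓ : ℝ)⁻¹ := inv_pos.mpr (by exact_mod_cast hℓ.out.pos)
    nlinarith
  obtain ⟨E, hE, hpf⟩ := exists_pf_eq (q := -u) (x := x) (y := y) (z := z) hC hD
    (by rw [← hu, sqv]; ring) (neg_ne_zero.mpr hu0)
  exact ⟨u, _, E, hu0, hE, hur, hr, hpf⟩

theorem tr_one : Q.tr 1 = 0 := by simp [tr]

theorem trHom_pf (a b : F) : Q.trHom (pf a b) = Q.tr a + Q.tr b + Q.tr (a * b) := by
  simp [pf, trHom_frm, tr_one]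

theorem par_tr (E : F) : par (Q.tr E) = (padicValRat 2 (Q.nrm E) : ZMod 2) := by
  by_cases hE : E = 0
  · simp [hE, tr, nrm]
  have hn : Q.nrm E ≠ 0 := Q.nrm_eq_zero.not.mpr hE
  by_cases hi : Q.im E = 0
  · have hr : Q.re E ≠ 0 := fun h => hE (Q.ext (by simpa using h) (by simpa using hi))
    have : Q.nrm E = Q.re E ^ 2 := by rw [nrm, hi]; ring
    rw [this, tr, hi, padicValRat.pow]
    push_cast
    rw [show (2 : ZMod 2) = 0 from rfl]
    simp
  · rw [tr, map_add, par_frm, par_frm, padicValRat.neg, padicValRat.mul hi hn]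
    push_cast
    rw [← add_assoc, ← two_mul, show (2 : ZMod 2) = 0 from rfl, zero_mul, zero_add]

theorem sgn_tr {E : F} (h : 0 < Q.nrm E) : sgn (Q.tr E) = 0 := by
  rw [tr, map_add]
  rcases lt_trichotomy (Q.im E) 0 with hi | hi | hi
  · rw [sgn_neg hi, sgn_pos (by nlinarith)]
    rfl
  · simp [hi]
  · rw [sgn_pos hi, sgn_neg (by nlinarith)]
    rfl

theorem trHom_pf_eq_zero {C D : F} (hC : ∀ σ : F →+* ℝ, 0 < σ C) (hD : ∀ σ : F →+* ℝ, 0 < σ D)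
    (h : LocApprox (-C) (-D)) : Q.trHom (pf C D) = 0 := by
  have hnC := Q.nrm_pos hC
  have hnD := Q.nrm_pos hD
  have hC0 : C ≠ 0 := fun h0 => hnC.ne' (Q.nrm_eq_zero.mpr h0)
  have hD0 : D ≠ 0 := fun h0 => hnD.ne' (Q.nrm_eq_zero.mpr h0)
  refine eq_zero_of_dl_of_sgn (fun ℓ hℓ => ?_) ?_
  · by_cases h2 : ℓ = 2
    · subst h2
      have : dl 2 (Q.trHom (pf C D)) = 0 := by
        refine dl_two_eq _ ?_
        rw [trHom_pf, map_add, map_add, par_tr, par_tr, par_tr, nrm_mul,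
          padicValRat.mul hnC.ne' hnD.ne']
        push_cast
        rw [← two_mul, show (2 : ZMod 2) = 0 from rfl, zero_mul]
      convert this
    · obtain ⟨u, r, E, hu, hE, hur, hr, hpf⟩ := Q.exists_close hC0 hD0 h h2
      have key : ∀ x, dl ℓ (Q.tr (-u * x)) = -dl ℓ (Q.tr x) := fun x => by
        rw [neg_mul, tr_neg, map_neg, Q.dl_tr_mul h2 hr hur hu]
      rw [hpf, trHom_pf, map_add, map_add, key, ← mul_one (-u), key, tr_one]
      simp
  · rw [trHom_pf, map_add, map_add, Q.sgn_tr hnC, Q.sgn_tr hnD,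
      Q.sgn_tr (by rw [nrm_mul]; positivity)]
    rfl

/-- The quaternion algebra descends to `ℚ`. -/
theorem exists_rat_pf_eq (Q : QuadField F p) {C D : F} (hC : ∀ σ : F →+* ℝ, 0 < σ C) (hD : ∀ σ : F →+* ℝ, 0 < σ D)
    (h : LocApprox (-C) (-D)) : ∃ a b : ℚ, 0 < a ∧ 0 < b ∧ pf C D = pf (a : F) (b : F) := by
  have hC0 : C ≠ 0 := fun h0 => (hC Q.realEmb).ne' (by simp [h0])
  have hD0 : D ≠ 0 := fun h0 => (hD Q.realEmb).ne' (by simp [h0])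
  have h0 := Q.trHom_pf_eq_zero hC hD h
  obtain ⟨M, hM, hd⟩ := Q.exists_submodule_of_sum_tr
    (a := ![Units.mk0 C hC0, Units.mk0 D hD0, Units.mk0 _ (mul_ne_zero hC0 hD0)])
    (by rw [← h0, trHom_pf]; simp [Fin.sum_univ_three])
  simp only [Fin.sum_univ_three, Matrix.cons_val_zero, Matrix.cons_val_one,
    Matrix.cons_val, Units.val_mk0, Fintype.card_fin] at hM hd
  have hrat : ∀ x : F, Q.im x = 0 → x = (Q.re x : F) := fun x hx =>
    Q.ext (by simp) (by simp [hx])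
  have hpos : ∀ v ∈ M, v ≠ 0 → ∃ a : ℚ, 0 < a ∧
      C * v 0 ^ 2 + D * v 1 ^ 2 + C * D * v 2 ^ 2 = a := by
    intro v hv hv0
    have e := hrat _ (hM v hv v hv)
    refine ⟨_, ?_, (by rw [← e]; ring)⟩
    have e2 := congrArg Q.realEmb e
    simp only [map_add, map_mul, map_ratCast] at e2
    have hc := hC Q.realEmb
    have hd := hD Q.realEmb
    have hne : v 0 ≠ 0 ∨ v 1 ≠ 0 ∨ v 2 ≠ 0 := by
      by_contra! hh
      refine hv0 (funext fun i => ?_)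
      fin_cases i
      exacts [hh.1, hh.2.1, hh.2.2]
    have hcd := mul_pos hc hd
    have t : ∀ c x : ℝ, 0 < c → 0 ≤ c * x * x := fun c x hc => by nlinarith [mul_self_nonneg x]
    have t' : ∀ (c : ℝ) (x : F), 0 < c → x ≠ 0 → 0 < c * Q.realEmb x * Q.realEmb x :=
      fun c x hc hx => by
        have : Q.realEmb x ≠ 0 := (map_ne_zero _).mpr hx
        rw [mul_assoc]
        exact mul_pos hc (mul_self_pos.mpr this)
    have : (0 : ℝ) < ((Q.re (C * v 0 * v 0 + D * v 1 * v 1 + C * D * v 2 * v 2) : ℚ) : ℝ) := by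
      rw [← e2]
      have h0 := t _ (Q.realEmb (v 0)) hc
      have h1 := t _ (Q.realEmb (v 1)) hd
      have h2 := t _ (Q.realEmb (v 2)) hcd
      rcases hne with h | h | h
      · linarith [t' _ _ hc h]
      · linarith [t' _ _ hd h]
      · linarith [t' _ _ hcd h]
    exact_mod_cast this
  have hMne : M ≠ ⊥ := by
    rintro rfl
    simp at hd
  obtain ⟨v, hv, hv0⟩ := M.ne_bot_iff.mp hMne
  obtain ⟨a, ha, hav⟩ := hpos v hv hv0
  have haF : (a : F) ≠ 0 := by exact_mod_cast ha.ne'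
  have := Q.finite
  obtain ⟨w, hw, hwv⟩ : ∃ w ∈ M, ∀ c : F, w ≠ c • v := by
    by_contra! hh
    have hle : M ≤ ((LinearMap.toSpanSingleton F (Fin 3 → F) v).restrictScalars ℚ).range := by
      intro w hw
      obtain ⟨c, hc⟩ := hh w hw
      exact ⟨c, by simp [hc]⟩
    have h1 := (Submodule.finrank_mono hle).trans (LinearMap.finrank_range_le _)
    rw [Q.finrank_eq] at h1
    exact absurd (hd.trans h1) (by decide)
  have e := hrat _ (hM v hv w hw)
  generalize Q.re (C * v 0 * w 0 + D * v 1 * w 1 + C * D * v 2 * w 2) = c at e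
  have hw' : w - (c / a) • v ∈ M := M.sub_mem hw (M.smul_mem _ hv)
  have hcomp : ∀ i, (w - (c / a) • v) i = w i - (c / a : F) * v i := fun i => by
    rw [Pi.sub_apply, Pi.smul_apply, ratCast_smul]
    push_cast
    rfl
  have hw0 : w - (c / a) • v ≠ 0 := fun h => hwv ((c : F) / a) (funext fun i => by
    have := congrFun h i
    rw [hcomp, Pi.zero_apply, sub_eq_zero] at this
    simpa using this)
  obtain ⟨b, hb, hbw⟩ := hpos _ hw' hw0
  refine ⟨a, b, ha, hb, pf_eq_of_orthogonal hC0 hD0 haF (by exact_mod_cast hb.ne') v _ hav hbw ?_⟩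
  rw [hcomp, hcomp, hcomp]
  field_simp
  linear_combination a * e - c * hav

end QuadField

end Descent

section FiniteField

variable {ℓ : ℕ} [hℓ : Fact ℓ.Prime]

theorem two_frm_zmod {r : ZMod ℓ} (hr : r ≠ 0) : frm 1 + frm 1 = frm r + frm r := by
  obtain ⟨a, b, h⟩ := ZMod.sq_add_sq ℓ r
  have := frm_add_of_rep (a := 1) (b := 1) (y := a) (z := b) (m := r) (by linear_combination h) hr
  simpa using this

theorem frm_of_isSquare {r : ZMod ℓ} (hr : r ≠ 0) (h : IsSquare r) : frm r = frm 1 := by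
  obtain ⟨t, rfl⟩ := h
  have ht : t ≠ 0 := by rintro rfl; simp at hr
  rw [← frm_mul_sq 1 ht]
  congr 1
  ring

theorem frm_zmod_cases {r c : ZMod ℓ} (hr : ¬ IsSquare r) (hc : c ≠ 0) :
    frm c = frm 1 ∨ frm c = frm r := by
  have hr0 : r ≠ 0 := by rintro rfl; exact hr (IsSquare.zero)
  by_cases h : IsSquare c
  · exact Or.inl (frm_of_isSquare hc h)
  · have h1 : IsSquare (c * r) := by
      rw [← quadraticChar_one_iff_isSquare (mul_ne_zero hc hr0), map_mul,
        quadraticChar_neg_one_iff_not_isSquare.mpr h, quadraticChar_neg_one_iff_not_isSquare.mpr hr]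
      norm_num
    obtain ⟨t, ht⟩ := h1
    have ht0 : t ≠ 0 := by
      rintro rfl
      exact mul_ne_zero hc hr0 (by simpa using ht)
    right
    rw [← frm_mul_sq c hr0, ← frm_mul_sq r ht0]
    congr 1
    linear_combination r * ht

variable (ℓ) in
/-- The classes of even-dimensional forms over `𝔽_ℓ` with trivial square class of the form `2⟨1⟩`. -/
def evenClasses : AddSubgroup (Witt (ZMod ℓ)) where
  carrier := {x | x = 0 ∨ ∀ r, ¬ IsSquare r → x = frm 1 - frm r}
  zero_mem' := Or.inl rfl
  add_mem' {x y} hx hy := by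
    rcases hx with rfl | hx
    · simpa using hy
    rcases hy with rfl | hy
    · exact Or.inr (by simpa using hx)
    by_cases hr : ∃ r : ZMod ℓ, ¬ IsSquare r
    · obtain ⟨r, hr⟩ := hr
      have hr0 : r ≠ 0 := by rintro rfl; exact hr (IsSquare.zero)
      left
      rw [hx r hr, hy r hr, sub_add_sub_comm, two_frm_zmod hr0, sub_self]
    · push Not at hr
      exact Or.inr fun r h => absurd (hr r) h
  neg_mem' {x} hx := by
    rcases hx with rfl | hx
    · exact Or.inl neg_zero
    · refine Or.inr fun r hr => ?_
      have hr0 : r ≠ 0 := by rintro rfl; exact hr (IsSquare.zero)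
      rw [hx r hr, neg_sub, sub_eq_sub_iff_add_eq_add, two_frm_zmod hr0]

theorem mem_evenClasses {x : Witt (ZMod ℓ)} :
    x ∈ evenClasses ℓ ↔ x = 0 ∨ ∀ r, ¬ IsSquare r → x = frm 1 - frm r := Iff.rfl

theorem frm_sub_mem_evenClasses {c d : ZMod ℓ} (hc : c ≠ 0) (hd : d ≠ 0) :
    frm c - frm d ∈ evenClasses ℓ := by
  have key : ∀ c : ZMod ℓ, c ≠ 0 → frm 1 - frm c ∈ evenClasses ℓ := by
    intro c hc
    by_cases h : IsSquare c
    · rw [frm_of_isSquare hc h, sub_self]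
      exact zero_mem _
    · refine Or.inr fun r hr => ?_
      rcases frm_zmod_cases h (c := r) (by rintro rfl; exact hr (IsSquare.zero)) with h1 | h1
      · rcases frm_zmod_cases hr hc with h2 | h2 <;> simp [h1, h2]
      · rw [h1]
  rw [← sub_sub_sub_cancel_left (frm d) (frm c) (frm 1)]
  exact sub_mem (key d hd) (key c hc)

theorem two_frm_one_mem : (frm 1 + frm 1 : Witt (ZMod ℓ)) ∈ evenClasses ℓ := by
  have h := frm_sub_mem_evenClasses (c := (1 : ZMod ℓ)) (d := -1) one_ne_zero (by simp)
  rwa [frm_neg, sub_neg_eq_add] at h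

/-- Up to even classes the residue only sees the parity of the valuation. -/
theorem dl_frm_sub_mem {a : ℚ} (ha : a ≠ 0) :
    dl ℓ (frm a) - (a : ℚ_[ℓ]).valuation • frm 1 ∈ evenClasses ℓ := by
  have ha' : (a : ℚ_[ℓ]) ≠ 0 := by exact_mod_cast ha
  obtain ⟨z, hz, h⟩ := padicAc_rep (Units.mk0 _ ha')
  rw [Units.val_mk0] at h
  have hz0 : PadicInt.toZMod z ≠ 0 := by rw [hz]; exact Units.ne_zero _
  rw [dl_eq, baseChange_frm, eq_ratCast, padic_res_pow_mul _ z hz0 h]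
  generalize (a : ℚ_[ℓ]).valuation = v
  split_ifs with hv
  · obtain ⟨m, rfl⟩ := hv
    have : frm (PadicInt.toZMod z) - (2 * m + 1) • frm 1 =
        (frm (PadicInt.toZMod z) - frm 1) - m • (frm 1 + frm 1) := by
      rw [add_smul, one_smul, mul_comm, mul_smul, two_smul]
      abel
    rw [this]
    exact sub_mem (frm_sub_mem_evenClasses hz0 one_ne_zero) (zsmul_mem two_frm_one_mem m)
  · obtain ⟨m, rfl⟩ := Int.not_odd_iff_even.mp hv
    rw [zero_sub, ← two_mul, mul_comm, mul_smul, two_smul]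
    exact neg_mem (zsmul_mem two_frm_one_mem m)

theorem dl_pf_mem {a b : ℚ} (ha : a ≠ 0) (hb : b ≠ 0) : dl ℓ (pf a b) ∈ evenClasses ℓ := by
  have h0 := dl_frm_sub_mem (ℓ := ℓ) one_ne_zero
  have h1 := dl_frm_sub_mem (ℓ := ℓ) ha
  have h2 := dl_frm_sub_mem (ℓ := ℓ) hb
  have h3 := dl_frm_sub_mem (ℓ := ℓ) (mul_ne_zero ha hb)
  have ha' : (a : ℚ_[ℓ]) ≠ 0 := by exact_mod_cast ha
  have hb' : (b : ℚ_[ℓ]) ≠ 0 := by exact_mod_cast hb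
  have h4 := zsmul_mem (two_frm_one_mem (ℓ := ℓ))
    ((a : ℚ_[ℓ]).valuation + (b : ℚ_[ℓ]).valuation)
  have h5 := add_mem (add_mem (add_mem (add_mem h0 h1) h2) h3) h4
  rw [Rat.cast_mul, Padic.valuation_mul ha' hb', Rat.cast_one, Padic.valuation_one] at h5
  convert h5 using 1
  rw [pf, map_add, map_add, map_add]
  simp only [add_smul, smul_add, zero_smul]
  abel

theorem dl_frm_one : dl ℓ (frm 1) = 0 := by
  simpa using dl_pow_mul (ℓ := ℓ) 0 1 (by simp)

theorem dl_frm_int {m : ℤ} (h : ¬ (ℓ : ℤ) ∣ m) : dl ℓ (frm (m : ℚ)) = 0 := by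
  simpa using dl_pow_mul (ℓ := ℓ) 0 m (by rwa [Ne, ZMod.intCast_zmod_eq_zero_iff_dvd])

theorem dl_frm_mul_int {m : ℤ} (h : ¬ (ℓ : ℤ) ∣ m) :
    dl ℓ (frm (ℓ * m : ℚ)) = frm (m : ZMod ℓ) := by
  simpa using dl_pow_mul (ℓ := ℓ) 1 m (by rwa [Ne, ZMod.intCast_zmod_eq_zero_iff_dvd])

theorem dl_frm_self : dl ℓ (frm (ℓ : ℚ)) = frm 1 := by
  have h := dl_frm_mul_int (ℓ := ℓ) (m := 1) (by
    rw [Int.natCast_dvd_ofNat]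
    exact hℓ.out.one_lt.ne' ∘ Nat.dvd_one.mp)
  simpa using h

theorem dl_eq_zero_of_mem_smoothSubgroup {k : ℕ} (hk : k ≤ ℓ) {x : Witt ℚ}
    (hx : x ∈ smoothSubgroup k) : dl ℓ x = 0 := by
  induction hx using AddSubgroup.closure_induction with
  | mem x h =>
    obtain ⟨n, hn, rfl⟩ := h
    exact dl_frm_int fun hd => (hn.2 ℓ hℓ.out hd).not_ge hk
  | zero => exact map_zero _
  | add x y _ _ hx hy => rw [map_add, hx, hy, add_zero]
  | neg x _ hx => rw [map_neg, hx, neg_zero]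

end FiniteField

section Kernel

variable (p : ℕ) (c : ℤ)

/-- The form `⟨1, -p, -c, pc⟩`, which vanishes over `ℚ(√p)`. -/
def kerCls : Witt ℚ := frm 1 - frm (p : ℚ) - frm (c : ℚ) + frm (p * c : ℚ)

variable {p c}

theorem sgn_kerCls (hp : p.Prime) (hc : c ≠ 0) : sgn (kerCls p c) = 0 := by
  have hp' : (0 : ℚ) < p := by exact_mod_cast hp.pos
  rw [kerCls, map_add, map_sub, map_sub, sgn_pos hp', sgn_pos one_pos]
  rcases lt_or_gt_of_ne hc with h | h
  · have h' : (c : ℚ) < 0 := by exact_mod_cast h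
    rw [sgn_neg h', sgn_neg (mul_neg_of_pos_of_neg hp' h')]
    norm_num
  · have h' : (0 : ℚ) < c := by exact_mod_cast h
    rw [sgn_pos h', sgn_pos (mul_pos hp' h')]
    norm_num

theorem par_kerCls (hp : p.Prime) (hc : c ≠ 0) : par (kerCls p c) = 0 := by
  have hp' : (p : ℚ) ≠ 0 := by exact_mod_cast hp.ne_zero
  have hc' : (c : ℚ) ≠ 0 := by exact_mod_cast hc
  rw [kerCls, map_add, map_sub, map_sub, par_frm, par_frm, par_frm, par_frm,
    padicValRat.mul hp' hc', padicValRat.one]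
  push_cast
  generalize ((padicValRat 2 (p : ℚ) : ℤ) : ZMod 2) = x
  generalize ((padicValRat 2 (c : ℚ) : ℤ) : ZMod 2) = y
  revert x y
  decide

variable {ℓ : ℕ} [hℓ : Fact ℓ.Prime]

theorem dl_kerCls_of_not_dvd (hp : p.Prime) (hpl : ℓ ≠ p) (hc : ¬ (ℓ : ℤ) ∣ c) :
    dl ℓ (kerCls p c) = 0 := by
  have h1 : ¬ (ℓ : ℤ) ∣ (p : ℤ) := by
    rwa [Int.natCast_dvd_natCast, Nat.prime_dvd_prime_iff_eq hℓ.out hp]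
  have h2 : ¬ (ℓ : ℤ) ∣ p * c := fun h =>
    ((Nat.prime_iff_prime_int.mp hℓ.out).dvd_or_dvd h).elim h1 hc
  have e1 := dl_frm_int h1
  have e2 := dl_frm_int h2
  push_cast at e1 e2
  rw [kerCls, map_add, map_sub, map_sub, dl_frm_one, e1, e2, dl_frm_int hc]
  simp

theorem dl_kerCls_same (hc : ¬ (ℓ : ℤ) ∣ c) :
    dl ℓ (kerCls ℓ c) = frm (c : ZMod ℓ) - frm 1 := by
  rw [kerCls, map_add, map_sub, map_sub, dl_frm_one, dl_frm_self, dl_frm_int hc,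
    dl_frm_mul_int hc]
  abel

theorem dl_kerCls_self (hp : p.Prime) (hpl : ℓ ≠ p) :
    dl ℓ (kerCls p ℓ) = frm (p : ZMod ℓ) - frm 1 := by
  have h1 : ¬ (ℓ : ℤ) ∣ (p : ℤ) := by
    rwa [Int.natCast_dvd_natCast, Nat.prime_dvd_prime_iff_eq hℓ.out hp]
  have e1 := dl_frm_int h1
  have e2 := dl_frm_mul_int h1
  push_cast at e1 e2
  rw [kerCls, Int.cast_natCast, map_add, map_sub, map_sub, dl_frm_one, dl_frm_self, e1,
    mul_comm, e2]
  abel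

end Kernel

namespace QuadField

variable {F : Type} [Field F] [NumberField F] {p : ℕ} (Q : QuadField F p)

theorem baseChange_kerCls (Q : QuadField F p) (c : ℤ) : baseChange (algebraMap ℚ F) (kerCls p c) = 0 := by
  have h1 : (frm (p : F)) = frm 1 := by
    rw [← Q.sq, ← frm_mul_sq 1 Q.s_ne_zero, one_mul]
  have h2 : (frm (p * c : F)) = frm (c : F) := by
    rw [← Q.sq, ← frm_mul_sq (c : F) Q.s_ne_zero, mul_comm]
  simp [kerCls, baseChange_frm, h1, h2]

variable {ℓ : ℕ} [hℓ : Fact ℓ.Prime]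

theorem norm_emb_le {t : ℚ_[ℓ]} (ht : t ^ 2 = p) (x : F) : ‖Q.emb t ht x‖ ≤ Q.nl ℓ x := by
  have ht1 : ‖t‖ ≤ 1 := by
    have : ‖t‖ ^ 2 ≤ 1 := by
      rw [← norm_pow, ht]
      exact by exact_mod_cast Padic.norm_int_le_one (p := ℓ) (p : ℤ)
    exact (sq_le_one_iff₀ (norm_nonneg _)).mp this
  rw [emb_apply]
  refine (Padic.nonarchimedean _ _).trans (max_le_max le_rfl ?_)
  rw [norm_mul]
  exact mul_le_of_le_one_right (norm_nonneg _) ht1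

theorem exists_padic_sqrt (h2 : ℓ ≠ 2) (hp0 : (p : ZMod ℓ) ≠ 0) (hs : IsSquare (p : ZMod ℓ)) :
    ∃ t : ℚ_[ℓ], t ^ 2 = p := by
  obtain ⟨r, hr⟩ := hs
  obtain ⟨z, rfl⟩ := ZMod.ringHom_surjective (PadicInt.toZMod (p := ℓ)) r
  have hz0 : PadicInt.toZMod z ≠ 0 := by
    intro h0
    rw [h0] at hr
    exact hp0 (by simpa using hr)
  have h20 : ((2 : ℕ) : ZMod ℓ) ≠ 0 := by
    rw [Ne, ZMod.natCast_eq_zero_iff, Nat.prime_dvd_prime_iff_eq hℓ.out Nat.prime_two]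
    exact h2
  obtain ⟨c, hc⟩ : ∃ c : ℤ_[ℓ], c = p := ⟨_, rfl⟩
  let f : Polynomial ℤ_[ℓ] := Polynomial.X ^ 2 - Polynomial.C c
  have hder : (Polynomial.derivative f).eval z = (2 : ℕ) * z := by
    simp [f, one_add_one_eq_two]
  have hval : f.eval z = z ^ 2 - c := by simp [f]
  have hd : ‖(Polynomial.derivative f).eval z‖ = 1 := by
    rw [← padicInt_toZMod_ne_zero_iff, hder, map_mul, map_natCast]
    exact mul_ne_zero h20 hz0
  have hf : ‖f.eval z‖ < 1 := by
    refine lt_of_le_of_ne (PadicInt.norm_le_one _) ?_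
    rw [Ne, ← padicInt_toZMod_ne_zero_iff, not_not, hval, map_sub, map_pow, hc, map_natCast, hr]
    ring
  obtain ⟨t, ht, -⟩ := hensels_lemma (R := ℤ_[ℓ]) (F := f) (a := z) (by simpa [hd] using hf)
  refine ⟨t, ?_⟩
  have : t ^ 2 = (p : ℤ_[ℓ]) := by rw [← hc]; simpa [f, sub_eq_zero] using ht
  exact_mod_cast congrArg (fun x : ℤ_[ℓ] => (x : ℚ_[ℓ])) this

theorem dl_pf_eq_zero (Q : QuadField F p) {C D : F} (hC : C ≠ 0) (hD : D ≠ 0)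
    (h : LocApprox (-C) (-D)) {a b : ℚ} (hab : pf C D = pf (a : F) (b : F)) (h2 : ℓ ≠ 2)
    (hp0 : (p : ZMod ℓ) ≠ 0) (hs : IsSquare (p : ZMod ℓ)) : dl ℓ (pf a b) = 0 := by
  obtain ⟨t, ht⟩ := exists_padic_sqrt h2 hp0 hs
  obtain ⟨u, r, E, hu, hE, hur, hr, hpf⟩ := Q.exists_close hC hD h h2
  have e1 : baseChange (algebraMap ℚ ℚ_[ℓ]) (pf a b) = pf (-Q.emb t ht u) (Q.emb t ht E) := by
    rw [baseChange_pf, ← map_neg, ← baseChange_pf (Q.emb t ht), ← hpf, hab, baseChange_pf]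
    simp
  have hℓ1 : (ℓ : ℝ)⁻¹ < 1 := inv_lt_one_of_one_lt₀ (by exact_mod_cast hℓ.out.one_lt)
  have hu1 : ‖Q.emb t ht u - 1‖ < 1 := by
    rw [← map_one (Q.emb t ht), ← map_sub, hur, map_mul, map_natCast, norm_mul, Padic.norm_p]
    exact (mul_le_of_le_one_right (by positivity) ((Q.norm_emb_le ht r).trans hr)).trans_lt hℓ1
  generalize Q.emb t ht u = v at e1 hu1
  have hE' : Q.emb t ht E ≠ 0 := (map_ne_zero _).mpr hE
  generalize Q.emb t ht E = G at e1 hE'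
  have key : ∀ g : ℚ_[ℓ], g ≠ 0 →
      (padicResData ℓ).resHom (frm (-v * g)) = -(padicResData ℓ).resHom (frm g) := by
    intro g hg
    rw [neg_mul, frm_neg, map_neg, neg_inj]
    refine (padic_res_congr ?_).symm
    rw [← sub_one_mul, norm_mul]
    exact mul_lt_of_lt_one_left (norm_pos_iff.mpr hg) hu1
  rw [dl_eq, e1, pf, map_add, map_add, map_add, key G hE', ← mul_one (-v), key 1 one_ne_zero]
  abel

end QuadField

theorem eq_zero_of_odd_dl {x : Witt ℚ} (hs : sgn x = 0) (hp : par x = 0)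
    (h : ∀ (ℓ : ℕ) [Fact ℓ.Prime], ℓ ≠ 2 → dl ℓ x = 0) : x = 0 := by
  refine eq_zero_of_dl_of_sgn (fun ℓ hℓ => ?_) hs
  by_cases h2 : ℓ = 2
  · subst h2
    convert dl_two_eq x hp
  · exact h ℓ h2

theorem sgn_pf {a b : ℚ} (ha : 0 < a) (hb : 0 < b) : sgn (pf a b) = 4 := by
  rw [pf, map_add, map_add, map_add, sgn_pos one_pos, sgn_pos ha, sgn_pos hb,
    sgn_pos (mul_pos ha hb)]
  norm_num

theorem par_pf {a b : ℚ} (ha : a ≠ 0) (hb : b ≠ 0) : par (pf a b) = 0 := by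
  rw [pf, map_add, map_add, map_add, par_frm, par_frm, par_frm, par_frm, padicValRat.mul ha hb,
    padicValRat.one]
  push_cast
  generalize ((padicValRat 2 a : ℤ) : ZMod 2) = x
  generalize ((padicValRat 2 b : ℤ) : ZMod 2) = y
  revert x y
  decide

theorem dl_pf_one_one {ℓ : ℕ} [Fact ℓ.Prime] : dl ℓ (pf 1 1) = 0 := by
  simp [pf, dl_frm_one]

namespace QuadField

variable {F : Type} [Field F] [NumberField F] {p : ℕ}

open Classical in
/-- Away from `2` and `p`, residues can be cleared by classes dying in `ℚ(√p)`. -/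
theorem exists_clear_residues (Q : QuadField F p) {x : Witt ℚ}
    (hev : ∀ (ℓ : ℕ) [Fact ℓ.Prime], dl ℓ x ∈ evenClasses ℓ)
    (hsq : ∀ (ℓ : ℕ) [Fact ℓ.Prime], ℓ ≠ 2 → (p : ZMod ℓ) ≠ 0 → IsSquare (p : ZMod ℓ) → dl ℓ x = 0) :
    ∃ k : Witt ℚ, baseChange (algebraMap ℚ F) k = 0 ∧ sgn k = 0 ∧ par k = 0 ∧
      (∀ (ℓ : ℕ) [Fact ℓ.Prime], ℓ ≠ 2 → ℓ ≠ p → dl ℓ (x + k) = 0) ∧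
      ∀ [Fact p.Prime], dl p (x + k) ∈ evenClasses p := by
  obtain ⟨N, hN⟩ := exists_mem_smoothSubgroup x
  let T := (Finset.range N).filter fun ℓ => ∃ h : ℓ.Prime, ℓ ≠ 2 ∧ ℓ ≠ p ∧ @dl ℓ ⟨h⟩ x ≠ 0
  have hT : ∀ q ∈ T, q.Prime ∧ q ≠ 2 ∧ q ≠ p := fun q hq => by
    obtain ⟨h, h1, h2, -⟩ := (Finset.mem_filter.mp hq).2
    exact ⟨h, h1, h2⟩
  refine ⟨∑ q ∈ T, kerCls p q, ?_, ?_, ?_, fun ℓ hℓ h2 hlp => ?_, fun {hp} => ?_⟩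
  · rw [map_sum]
    exact Finset.sum_eq_zero fun q _ => Q.baseChange_kerCls q
  · rw [map_sum]
    exact Finset.sum_eq_zero fun q hq =>
      sgn_kerCls Q.prime (by exact_mod_cast (hT q hq).1.ne_zero)
  · rw [map_sum]
    exact Finset.sum_eq_zero fun q hq =>
      par_kerCls Q.prime (by exact_mod_cast (hT q hq).1.ne_zero)
  · have hoff : ∀ q ∈ T, q ≠ ℓ → dl ℓ (kerCls p q) = 0 := fun q hq hne =>
      dl_kerCls_of_not_dvd Q.prime hlp (by
        rw [Int.natCast_dvd_natCast, Nat.prime_dvd_prime_iff_eq hℓ.out (hT q hq).1]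
        exact hne.symm)
    rw [map_add, map_sum]
    by_cases hx : dl ℓ x = 0
    · rw [hx, zero_add]
      refine Finset.sum_eq_zero fun q hq => hoff q hq ?_
      rintro rfl
      exact (Finset.mem_filter.mp hq).2.choose_spec.2.2 hx
    · have hℓN : ℓ < N := by
        by_contra! h
        exact hx (dl_eq_zero_of_mem_smoothSubgroup h hN)
      have hmem : ℓ ∈ T := Finset.mem_filter.mpr ⟨Finset.mem_range.mpr hℓN, hℓ.out, h2, hlp, hx⟩
      rw [Finset.sum_eq_single ℓ hoff (fun h => absurd hmem h), dl_kerCls_self Q.prime hlp]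
      have hp0 : (p : ZMod ℓ) ≠ 0 := by
        rwa [Ne, ZMod.natCast_eq_zero_iff, Nat.prime_dvd_prime_iff_eq hℓ.out Q.prime]
      have hns : ¬ IsSquare (p : ZMod ℓ) := fun h => hx (hsq ℓ h2 hp0 h)
      rw [(mem_evenClasses.mp (hev ℓ)).resolve_left hx _ hns]
      abel
  · rw [map_add, map_sum]
    refine add_mem (hev p) (sum_mem fun q hq => ?_)
    have hd : ¬ (p : ℤ) ∣ q := by
      rw [Int.natCast_dvd_natCast, Nat.prime_dvd_prime_iff_eq hp.out (hT q hq).1]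
      exact (hT q hq).2.2.symm
    rw [dl_kerCls_same hd]
    exact frm_sub_mem_evenClasses (by rwa [Ne, ZMod.intCast_zmod_eq_zero_iff_dvd]) one_ne_zero

theorem exists_pf_eq_pf_one (Q : QuadField F p) {C D : F} (hC : ∀ σ : F →+* ℝ, 0 < σ C)
    (hD : ∀ σ : F →+* ℝ, 0 < σ D) (h : LocApprox (-C) (-D)) (hp24 : p % 24 ≠ 1) :
    pf C D = pf 1 1 ∨ pf C D = pf 1 3 := by
  obtain ⟨a, b, ha, hb, hab⟩ := Q.exists_rat_pf_eq hC hD h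
  have hC0 : C ≠ 0 := fun h0 => (hC Q.realEmb).ne' (by simp [h0])
  have hD0 : D ≠ 0 := fun h0 => (hD Q.realEmb).ne' (by simp [h0])
  obtain ⟨k, hk0, hks, hkp, hk, hkev⟩ := Q.exists_clear_residues (x := pf a b - pf 1 1)
    (fun ℓ _ => by
      rw [map_sub]
      exact sub_mem (dl_pf_mem ha.ne' hb.ne') (dl_pf_mem one_ne_zero one_ne_zero))
    (fun ℓ _ h2 hp0 hs => by
      rw [map_sub, dl_pf_one_one, sub_zero]
      exact Q.dl_pf_eq_zero hC0 hD0 h hab h2 hp0 hs)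
  obtain ⟨y, hy⟩ : ∃ y, pf a b - pf 1 1 + k = y := ⟨_, rfl⟩
  have hys : sgn y = 0 := by
    rw [← hy, map_add, map_sub, sgn_pf ha hb, sgn_pf one_pos one_pos, hks]
    rfl
  have hyp : par y = 0 := by
    rw [← hy, map_add, map_sub, par_pf ha.ne' hb.ne', par_pf one_ne_zero one_ne_zero, hkp]
    rfl
  have hbc : baseChange (algebraMap ℚ F) y = pf C D - pf 1 1 := by
    rw [← hy, map_add, map_sub, hk0, baseChange_pf, baseChange_pf, hab]
    simp
  rw [hy] at hk hkev
  have := Fact.mk Q.prime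
  have triv : y = 0 → pf C D = pf 1 1 := by
    rintro rfl
    rw [map_zero] at hbc
    exact (sub_eq_zero.mp hbc.symm)
  by_cases hp2 : p = 2
  · exact Or.inl (triv (eq_zero_of_odd_dl hys hyp fun ℓ _ h2 => hk ℓ h2 (hp2 ▸ h2)))
  rcases mem_evenClasses.mp hkev with h0 | hN
  · refine Or.inl (triv (eq_zero_of_odd_dl hys hyp fun ℓ _ h2 => ?_))
    by_cases hlp : ℓ = p
    · subst hlp
      convert h0
    · exact hk ℓ h2 hlp
  have hcond : ∀ c : ℤ, ¬ IsSquare (c : ZMod p) → ¬ (p : ℤ) ∣ c := fun c hc hd => hc (by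
    rw [(ZMod.intCast_zmod_eq_zero_iff_dvd c p).mpr hd]
    exact IsSquare.zero)
  have hkp0 : ∀ c : ℤ, ¬ IsSquare (c : ZMod p) → dl p (y + kerCls p c) = 0 := fun c hc => by
    rw [map_add, hN _ hc, dl_kerCls_same (hcond c hc)]
    abel
  have unit_case : ∀ c : ℤ, c ≠ 0 → (∀ ℓ : ℕ, ℓ.Prime → ℓ ≠ 2 → ¬ (ℓ : ℤ) ∣ c) →
      ¬ IsSquare (c : ZMod p) → pf C D = pf 1 1 := by
    intro c hc0 hc hns
    have hz : y + kerCls p c = 0 := by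
      refine eq_zero_of_odd_dl (by rw [map_add, hys, sgn_kerCls Q.prime hc0, zero_add])
        (by rw [map_add, hyp, par_kerCls Q.prime hc0, zero_add]) fun ℓ hℓ h2 => ?_
      by_cases hlp : ℓ = p
      · subst hlp
        convert hkp0 c hns
      · rw [map_add, hk ℓ h2 hlp, dl_kerCls_of_not_dvd Q.prime hlp (hc ℓ hℓ.out h2), zero_add]
    have := congrArg (baseChange (algebraMap ℚ F)) hz
    rw [map_add, hbc, Q.baseChange_kerCls, add_zero, map_zero] at this
    exact sub_eq_zero.mp this
  by_cases h4 : p % 4 = 3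
  · refine Or.inl (unit_case (-1) (by norm_num) (fun ℓ hℓ h2 hd => ?_) ?_)
    · rw [Int.dvd_neg, Int.natCast_dvd_ofNat, Nat.dvd_one] at hd
      exact hℓ.one_lt.ne' hd
    · push_cast
      rw [ZMod.exists_sq_eq_neg_one_iff]
      exact not_not.mpr h4
  by_cases h8 : p % 8 = 5
  · refine Or.inl (unit_case 2 (by norm_num) (fun ℓ hℓ h2 hd => ?_) ?_)
    · have : ℓ ∣ 2 := by exact_mod_cast hd
      exact h2 ((Nat.prime_dvd_prime_iff_eq hℓ Nat.prime_two).mp this)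
    · push_cast
      rw [ZMod.exists_sq_eq_two_iff hp2]
      omega
  have hodd := Q.prime.eq_two_or_odd.resolve_left hp2
  have h3 : p % 3 = 2 := by
    have : ¬ p % 3 = 0 := fun h => by
      have := (Nat.prime_dvd_prime_iff_eq Nat.prime_three Q.prime).mp (Nat.dvd_of_mod_eq_zero h)
      omega
    omega
  have hp3 : (p : ZMod 3) = 2 := by
    rw [← ZMod.natCast_mod, h3]
    rfl
  have hpne : (3 : ℕ) ≠ p := by rintro rfl; omega
  have hns : ¬ IsSquare (((3 : ℕ) : ℤ) : ZMod p) := by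
    rw [Int.cast_natCast, ZMod.exists_sq_eq_prime_iff_of_mod_four_eq_one (by omega) (by norm_num), hp3]
    decide
  right
  have hz : y + kerCls p (3 : ℕ) + pf 1 1 - pf 1 3 = 0 := by
    have hc0 : ((3 : ℕ) : ℤ) ≠ 0 := by norm_num
    refine eq_zero_of_odd_dl ?_ ?_ fun ℓ hℓ h2 => ?_
    · rw [map_sub, map_add, map_add, hys, sgn_kerCls Q.prime hc0, sgn_pf one_pos one_pos,
        sgn_pf one_pos (by norm_num)]
      rfl
    · rw [map_sub, map_add, map_add, hyp, par_kerCls Q.prime hc0, par_pf one_ne_zero one_ne_zero,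
        par_pf one_ne_zero (by norm_num)]
      rfl
    · by_cases hl3 : ℓ = 3
      · subst hl3
        have h13 : dl 3 (pf 1 3) = frm 1 + frm 1 := by
          have := dl_frm_self (ℓ := 3)
          push_cast at this
          simp [pf, dl_frm_one, this]
        have h23 : (frm 2 : Witt (ZMod 3)) = -frm 1 := by
          rw [← frm_neg]
          rfl
        have hneg := two_frm_zmod (ℓ := 3) (r := -1) (neg_ne_zero.mpr one_ne_zero)
        rw [frm_neg] at hneg
        rw [map_sub, map_add, map_add, hk 3 h2 hpne, dl_kerCls_self Q.prime hpne, dl_pf_one_one, h13,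
          hp3, h23, hneg]
        abel
      · have hl3' : ¬ (ℓ : ℤ) ∣ ((3 : ℕ) : ℤ) := by
          rwa [Int.natCast_dvd_natCast, Nat.prime_dvd_prime_iff_eq hℓ.out Nat.prime_three]
        have h13 : dl ℓ (pf 1 3) = 0 := by
          have := dl_frm_int hl3'
          push_cast at this
          simp [pf, dl_frm_one, this]
        rw [map_sub, map_add, h13, dl_pf_one_one, add_zero, sub_zero]
        by_cases hlp : ℓ = p
        · subst hlp
          convert hkp0 _ hns
        · rw [map_add, hk ℓ h2 hlp, dl_kerCls_of_not_dvd Q.prime hlp hl3', zero_add]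
  have := congrArg (baseChange (algebraMap ℚ F)) hz
  rw [map_sub, map_add, map_add, hbc, Q.baseChange_kerCls, baseChange_pf, baseChange_pf, map_zero] at this
  simp only [map_one, map_ofNat] at this
  rw [add_zero, sub_add_cancel] at this
  exact sub_eq_zero.mp this

end QuadField

section Quat

variable {K : Type} [Field K] {A B : K}

/-- The bilinear form of the reduced norm. -/
def qb (x y : ℍ[K, A, B]) : K :=
  x.re * y.re - A * (x.imI * y.imI) - B * (x.imJ * y.imJ) + A * B * (x.imK * y.imK)

theorem re_star_mul (x y : ℍ[K, A, B]) : (star x * y).re = qb x y := by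
  simp [qb]
  ring

theorem qb_star_mul (u v w : ℍ[K, A, B]) : qb (star u * v) (star u * w) = qb u u * qb v w := by
  simp [qb]
  ring

theorem mul_self_of_re_eq_zero {x : ℍ[K, A, B]} (h : x.re = 0) :
    x * x = algebraMap K _ (-qb x x) := by
  ext <;> simp [qb, h, QuaternionAlgebra.algebraMap_eq] <;> ring

theorem mul_eq_neg_of_qb {x y : ℍ[K, A, B]} (hx : x.re = 0) (hy : y.re = 0) (h : qb x y = 0) :
    x * y = -(y * x) := by
  simp only [qb, hx, hy] at h
  ext <;> simp [hx, hy]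
  · linear_combination -2 * h
  all_goals ring

theorem exists_anticomm_of_pf [CharZero K] (σ : K →+* ℝ) (hA : σ A < 0) (hB : σ B < 0) {e : K}
    (he : e ≠ 0) (h : pf (-A) (-B) = pf 1 e) :
    ∃ i j : ℍ[K, A, B], i * i = -1 ∧ j * j = algebraMap K _ (-e) ∧ i * j = -(j * i) := by
  have hA0 : -A ≠ 0 := by rintro h0; rw [neg_eq_zero.mp h0] at hA; simp at hA
  have hB0 : -B ≠ 0 := by rintro h0; rw [neg_eq_zero.mp h0] at hB; simp at hB
  have hAB := mul_ne_zero hA0 hB0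
  have hm : Metab (Sum.elim ![1, Units.mk0 _ hA0, Units.mk0 _ hB0, Units.mk0 _ hAB]
      fun j => -(![1, 1, Units.mk0 e he, Units.mk0 e he] : Fin 4 → Kˣ) j) := by
    rw [← sum_cls_eq_zero_iff]
    simp only [Fintype.sum_sum_type, Sum.elim_inl, Sum.elim_inr, cls_neg, Finset.sum_neg_distrib,
      Fin.sum_univ_four, Matrix.cons_val_zero, Matrix.cons_val_one, Matrix.cons_val]
    simp only [← frm_units, Units.val_one, Units.val_mk0]
    rw [pf, pf, one_mul] at h
    rw [h]
    abel
  obtain ⟨M, hM, hd⟩ := hm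
  simp only [Fintype.sum_sum_type, Sum.elim_inl, Sum.elim_inr, 
      Fin.sum_univ_four, Matrix.cons_val_zero, Matrix.cons_val_one, Matrix.cons_val,
      Units.val_one, Units.val_mk0, Units.val_neg] at hM
  let g : M →ₗ[K] (Fin 4 → K) := (LinearMap.funLeft K K Sum.inr) ∘ₗ M.subtype
  have hg : Function.Injective g := by
    rw [← LinearMap.ker_eq_bot, LinearMap.ker_eq_bot']
    rintro ⟨x, hx⟩ h0
    have h1 : ∀ i : Fin 4, x (Sum.inr i) = 0 := fun i => congrFun h0 i
    have h2 := congrArg σ (hM x hx x hx)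
    simp only [h1, map_add, map_mul, map_neg, map_zero, mul_zero, add_zero, one_mul] at h2
    have hAB' := mul_pos_of_neg_of_neg hA hB
    have s0 := mul_self_nonneg (σ (x (Sum.inl 0)))
    have s1 := mul_nonneg (neg_pos.mpr hA).le (mul_self_nonneg (σ (x (Sum.inl 1))))
    have s2 := mul_nonneg (neg_pos.mpr hB).le (mul_self_nonneg (σ (x (Sum.inl 2))))
    have s3 := mul_nonneg hAB'.le (mul_self_nonneg (σ (x (Sum.inl 3))))
    have z0 : σ (x (Sum.inl 0)) * σ (x (Sum.inl 0)) = 0 := by linarith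
    have z1 : -σ A * (σ (x (Sum.inl 1)) * σ (x (Sum.inl 1))) = 0 := by linarith
    have z2 : -σ B * (σ (x (Sum.inl 2)) * σ (x (Sum.inl 2))) = 0 := by linarith
    have z3 : σ A * σ B * (σ (x (Sum.inl 3)) * σ (x (Sum.inl 3))) = 0 := by linarith
    simp only [mul_eq_zero, neg_eq_zero, hA.ne, hB.ne, false_or, or_self, map_eq_zero] at z0 z1 z2 z3
    refine Subtype.ext (funext fun i => ?_)
    rcases i with i | i
    · fin_cases i
      exacts [z0, z1, z2, z3]
    · exact h1 i
  have hdim : Module.finrank K M = Module.finrank K (Fin 4 → K) := by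
    refine le_antisymm (LinearMap.finrank_le_finrank_of_injective hg) ?_
    simp at hd ⊢
    omega
  have hsurj := (LinearMap.injective_iff_surjective_of_finrank_eq_finrank hdim).mp hg
  have hlift : ∀ y : Fin 4 → K, ∃ x ∈ M, ∀ i, x (Sum.inr i) = y i := fun y => by
    obtain ⟨⟨x, hx⟩, h⟩ := hsurj y
    exact ⟨x, hx, fun i => congrFun h i⟩
  obtain ⟨x, hx, hxy⟩ := hlift ![1, 0, 0, 0]
  obtain ⟨y, hy, hyy⟩ := hlift ![0, 1, 0, 0]
  obtain ⟨z, hz, hzy⟩ := hlift ![0, 0, 1, 0]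
  let q : (Fin 4 ⊕ Fin 4 → K) → ℍ[K, A, B] := fun x =>
    ⟨x (Sum.inl 0), x (Sum.inl 1), x (Sum.inl 2), x (Sum.inl 3)⟩
  have hxx := hM x hx x hx
  have hyy' := hM y hy y hy
  have hzz := hM z hz z hz
  have hxy' := hM x hx y hy
  have hxz := hM x hx z hz
  have hyz := hM y hy z hz
  simp only [hxy, hyy, hzy, Matrix.cons_val_zero, Matrix.cons_val_one, Matrix.cons_val] at *
  have q1 : qb (q x) (q x) = 1 := by simp only [q, qb]; linear_combination hxx
  have q2 : qb (q y) (q y) = 1 := by simp only [q, qb]; linear_combination hyy'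
  have q3 : qb (q z) (q z) = e := by simp only [q, qb]; linear_combination hzz
  have q4 : qb (q x) (q y) = 0 := by simp only [q, qb]; linear_combination hxy'
  have q5 : qb (q x) (q z) = 0 := by simp only [q, qb]; linear_combination hxz
  have q6 : qb (q y) (q z) = 0 := by simp only [q, qb]; linear_combination hyz
  have r1 := (re_star_mul (q x) (q y)).trans q4
  have r2 := (re_star_mul (q x) (q z)).trans q5
  refine ⟨star (q x) * q y, star (q x) * q z, ?_, ?_, mul_eq_neg_of_qb r1 r2 ?_⟩
  · rw [mul_self_of_re_eq_zero r1, qb_star_mul, q1, q2]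
    simp
  · rw [mul_self_of_re_eq_zero r2, qb_star_mul, q1, q3, one_mul]
  · rw [qb_star_mul, q6, mul_zero]

theorem re_eq_zero_of_anticomm [CharZero K] {a b : K} (hb : b ≠ 0) {X Y : ℍ[K, A, B]}
    (hX : X * X = algebraMap K _ a) (hY : Y * Y = algebraMap K _ b) (hXY : X * Y = -(Y * X)) :
    X.re = 0 := by
  by_contra h
  have e1 := congrArg QuaternionAlgebra.imI hX
  have e2 := congrArg QuaternionAlgebra.imJ hX
  have e3 := congrArg QuaternionAlgebra.imK hX
  simp [QuaternionAlgebra.algebraMap_eq] at e1 e2 e3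
  have f1 : X.imI = 0 := by
    have : 2 * (X.re * X.imI) = 0 := by linear_combination e1
    simpa [h] using this
  have f2 : X.imJ = 0 := by
    have : 2 * (X.re * X.imJ) = 0 := by linear_combination e2
    simpa [h] using this
  have f3 : X.imK = 0 := by
    have : 2 * (X.re * X.imK) = 0 := by linear_combination e3
    simpa [h] using this
  have hY0 : Y = 0 := by
    have g0 := congrArg QuaternionAlgebra.re hXY
    have g1 := congrArg QuaternionAlgebra.imI hXY
    have g2 := congrArg QuaternionAlgebra.imJ hXY
    have g3 := congrArg QuaternionAlgebra.imK hXY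
    simp [f1, f2, f3, mul_comm _ X.re, self_eq_neg, h] at g0 g1 g2 g3
    ext <;> assumption
  rw [hY0, mul_zero, eq_comm, map_eq_zero_iff _ (algebraMap K ℍ[K, A, B]).injective] at hY
  exact hb hY

theorem pf_eq_of_anticomm [CharZero K] (hA : A ≠ 0) (hB : B ≠ 0) {a b : K} (ha : a ≠ 0) (hb : b ≠ 0)
    {X Y : ℍ[K, A, B]} (hX : X * X = algebraMap K _ (-a)) (hY : Y * Y = algebraMap K _ (-b))
    (hXY : X * Y = -(Y * X)) : pf (-A) (-B) = pf a b := by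
  have rX := re_eq_zero_of_anticomm (neg_ne_zero.mpr hb) hX hY hXY
  have rY := re_eq_zero_of_anticomm (neg_ne_zero.mpr ha) hY hX (by rw [hXY, neg_neg])
  have nX := congrArg QuaternionAlgebra.re hX
  have nY := congrArg QuaternionAlgebra.re hY
  have nXY := congrArg QuaternionAlgebra.re hXY
  simp [QuaternionAlgebra.algebraMap_eq, rX, rY] at nX nY nXY
  refine pf_eq_of_orthogonal (neg_ne_zero.mpr hA) (neg_ne_zero.mpr hB) ha hb
    ![X.imI, X.imJ, X.imK] ![Y.imI, Y.imJ, Y.imK] ?_ ?_ ?_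
  · simp only [Matrix.cons_val_zero, Matrix.cons_val_one, Matrix.cons_val]
    linear_combination -nX
  · simp only [Matrix.cons_val_zero, Matrix.cons_val_one, Matrix.cons_val]
    linear_combination -nY
  · simp only [Matrix.cons_val_zero, Matrix.cons_val_one, Matrix.cons_val]
    have : (2 : K) ≠ 0 := two_ne_zero
    refine mul_left_cancel₀ this ?_
    linear_combination -nXY

end Quat

section Integral

theorem isIntegral_of_mem_subring {H : Type} [Ring H] {O : Subring H} (hO : O.toAddSubgroup.FG)
    {x : H} (hx : x ∈ O) : IsIntegral ℤ x := by
  have : Module.Finite ℤ O := by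
    rw [Module.Finite.iff_addGroup_fg]
    exact (AddGroup.fg_iff_addSubgroup_fg _).mpr hO
  exact (IsIntegral.of_finite ℤ (⟨x, hx⟩ : O)).map O.subtype.toIntAlgHom

variable {K : Type} [Field K]

theorem isIntegral_trace_norm_of_quadratic {H : Type} [Ring H] [Algebra K H] {t n : K} {x : H}
    (h : x * x = algebraMap K H t * x - algebraMap K H n) (hx : IsIntegral ℤ x) [Nontrivial H]
    (hs : ∀ c : K, x ≠ algebraMap K H c) :
    IsIntegral ℤ t ∧ IsIntegral ℤ n := by
  let φ : QuadraticAlgebra K (-n) t →ₐ[K] H := QuadraticAlgebra.lift ⟨x, by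
    rw [h, Algebra.algebraMap_eq_smul_one, Algebra.algebraMap_eq_smul_one, smul_mul_assoc, one_mul,
      neg_smul]
    abel⟩
  let w : QuadraticAlgebra K (-n) t := ⟨0, 1⟩
  have hw : φ w = x := by simp [φ, w]
  have hinj : Function.Injective φ := by
    rw [injective_iff_map_eq_zero]
    intro z hz
    have hz' : algebraMap K H z.re + z.im • x = 0 := by
      rw [← hz]
      simp [φ, Algebra.algebraMap_eq_smul_one]
    by_cases h0 : z.im = 0
    · rw [h0, zero_smul, add_zero, map_eq_zero_iff _ (algebraMap K H).injective] at hz'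
      exact QuadraticAlgebra.ext hz' h0
    · refine absurd ?_ (hs (-(z.im⁻¹ * z.re)))
      rw [map_neg, map_mul, ← Algebra.smul_def, eq_neg_iff_add_eq_zero]
      have := congrArg (fun y => z.im⁻¹ • y) hz'
      simp only [smul_add, smul_smul, inv_mul_cancel₀ h0, one_smul, smul_zero] at this
      rw [add_comm]
      exact this
  have hwi : IsIntegral ℤ w := by
    rw [← hw] at hx
    exact (isIntegral_algHom_iff (φ.restrictScalars ℤ) hinj).mp hx
  have hwi' : IsIntegral ℤ (star w) :=
    hwi.map (starRingEnd (QuadraticAlgebra K (-n) t)).toIntAlgHom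
  have ht : w + star w = algebraMap K _ t := by
    ext <;> simp [w]
  have hn : w * star w = algebraMap K _ n := by
    ext <;> simp [w]
  have hA := (algebraMap K (QuadraticAlgebra K (-n) t)).injective
  exact ⟨(isIntegral_algebraMap_iff hA).mp (ht ▸ hwi.add hwi'),
    (isIntegral_algebraMap_iff hA).mp (hn ▸ hwi.mul hwi')⟩

theorem isIntegral_trace_norm {A B : K} {x : ℍ[K, A, B]} (hx : IsIntegral ℤ x) :
    IsIntegral ℤ (2 * x.re) ∧ IsIntegral ℤ (qb x x) := by
  by_cases hs : ∀ c : K, x ≠ algebraMap K _ c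
  · refine isIntegral_trace_norm_of_quadratic (x := x) ?_ hx hs
    ext <;> simp [QuaternionAlgebra.algebraMap_eq, qb] <;> ring
  · push Not at hs
    obtain ⟨c, rfl⟩ := hs
    have hc : IsIntegral ℤ c :=
      (isIntegral_algebraMap_iff (algebraMap K ℍ[K, A, B]).injective).mp hx
    have h1 : qb (algebraMap K ℍ[K, A, B] c) (algebraMap K ℍ[K, A, B] c) = c * c := by
      simp [qb, QuaternionAlgebra.algebraMap_eq]
    rw [h1]
    refine ⟨?_, hc.mul hc⟩
    rw [QuaternionAlgebra.algebraMap_eq, two_mul]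
    exact hc.add hc

end Integral

section MaxOrder

variable {F : Type} [Field F] [NumberField F]

theorem exists_smul_mem_order {H : Type} [Ring H] [Algebra F H] {O : Subring H} (hO : IsOrder F O)
    (h : H) : ∃ d : 𝓞 F, d ≠ 0 ∧ algebraMap F H d * h ∈ O := by
  have hh : h ∈ Submodule.span F (O : Set H) := hO.2.2 ▸ Submodule.mem_top
  have hr : ∀ r : 𝓞 F, algebraMap F H r ∈ O := fun r => hO.1 ⟨r, rfl⟩
  have hde : ∀ d e : 𝓞 F, ((d * e : 𝓞 F) : F) = d * e := fun _ _ => rfl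
  induction hh using Submodule.span_induction with
  | mem x hx => exact ⟨1, one_ne_zero, by simpa using hx⟩
  | zero => exact ⟨1, one_ne_zero, by simp⟩
  | add x y _ _ hx hy =>
    obtain ⟨d, hd, hx⟩ := hx
    obtain ⟨e, he, hy⟩ := hy
    refine ⟨d * e, mul_ne_zero hd he, ?_⟩
    have : algebraMap F H (d * e : 𝓞 F) * (x + y) =
        algebraMap F H e * (algebraMap F H d * x) + algebraMap F H d * (algebraMap F H e * y) := by
      rw [hde, map_mul, mul_add, mul_assoc (algebraMap F H d) _ y,
        Algebra.commutes (d : F) (algebraMap F H e), mul_assoc _ _ x]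
    rw [this]
    exact O.add_mem (O.mul_mem (hr _) hx) (O.mul_mem (hr _) hy)
  | smul a x _ hx =>
    obtain ⟨d, hd, hx⟩ := hx
    obtain ⟨e, he, hae⟩ := exists_common_denom ({a} : Finset F)
    obtain ⟨r, hr'⟩ := hae a (by simp)
    refine ⟨d * e, mul_ne_zero hd he, ?_⟩
    have : algebraMap F H (d * e : 𝓞 F) * (a • x) =
        algebraMap F H r * (algebraMap F H d * x) := by
      rw [hde, Algebra.smul_def, Algebra.commutes (r : F), ← hr', map_mul, map_mul, mul_assoc, mul_assoc,
        ← mul_assoc (algebraMap F H e), ← map_mul, Algebra.commutes _ x]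
    rw [this]
    exact O.mul_mem (hr _) hx

theorem exists_maximalOrder_ge {A B : F} (hA : A ≠ 0) (hB : B ≠ 0) {O : Subring ℍ[F, A, B]}
    (hO : IsOrder F O) : ∃ O' : Subring ℍ[F, A, B], O ≤ O' ∧ IsMaximalOrder F O' := by
  obtain ⟨d₁, hd₁, h₁⟩ := exists_smul_mem_order hO (⟨0, 1, 0, 0⟩ : ℍ[F, A, B])
  obtain ⟨d₂, hd₂, h₂⟩ := exists_smul_mem_order hO (⟨0, 0, 1, 0⟩ : ℍ[F, A, B])
  obtain ⟨d₃, hd₃, h₃⟩ := exists_smul_mem_order hO (⟨0, 0, 0, 1⟩ : ℍ[F, A, B])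
  have hd : ∀ {d : 𝓞 F}, d ≠ 0 → (d : F) ≠ 0 := fun h => by simpa using h
  let g : (Fin 4 → 𝓞 F) →ₗ[ℤ] ℍ[F, A, B] :=
    { toFun := fun r => ⟨(r 0 : F) / 2, (r 1 : F) / (2 * d₁ * A), (r 2 : F) / (2 * d₂ * B),
        (r 3 : F) / (2 * d₃ * A * B)⟩
      map_add' := fun r s => by ext <;> simp [add_div]
      map_smul' := fun n r => by ext <;> simp [mul_div_assoc] }
  have hle : ∀ O' : Subring ℍ[F, A, B], IsOrder F O' → O ≤ O' → ∀ x ∈ O', x ∈ g.range := by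
    intro O' hO' hOO' x hx
    have key : ∀ y ∈ O, ∃ r : 𝓞 F, 2 * (x * y).re = r := fun y hy =>
      ⟨⟨_, (isIntegral_trace_norm
        (isIntegral_of_mem_subring hO'.2.1 (O'.mul_mem hx (hOO' hy)))).1⟩, rfl⟩
    obtain ⟨r₀, e₀⟩ := key 1 O.one_mem
    obtain ⟨r₁, e₁⟩ := key _ h₁
    obtain ⟨r₂, e₂⟩ := key _ h₂
    obtain ⟨r₃, e₃⟩ := key _ h₃
    simp [QuaternionAlgebra.algebraMap_eq] at e₀ e₁ e₂ e₃
    refine ⟨![r₀, r₁, r₂, -r₃], ?_⟩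
    have := hd hd₁
    have := hd hd₂
    have := hd hd₃
    ext
    · simp [g, ← e₀]
    · simp [g, ← e₁]; field_simp
    · simp [g, ← e₂]; field_simp
    · simp [g, ← e₃]; field_simp
  let P : Set (Submodule ℤ g.range) := {S | ∃ O' : Subring ℍ[F, A, B], IsOrder F O' ∧ O ≤ O' ∧
    S = O'.toAddSubgroup.toIntSubmodule.comap g.range.subtype}
  obtain ⟨_, ⟨O', hO', hOO', rfl⟩, hmax⟩ := wellFounded_gt.has_min P ⟨_, O, hO, le_rfl, rfl⟩
  refine ⟨O', hOO', hO', fun O'' hO'' h => ?_⟩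
  by_contra hne
  refine hmax _ ⟨O'', hO'', hOO'.trans h, rfl⟩ (lt_of_le_of_ne (fun x hx => h hx) fun he => ?_)
  refine hne (le_antisymm (fun x hx => ?_) h)
  have : (⟨x, hle _ hO'' (hOO'.trans h) x hx⟩ : g.range) ∈
      O''.toAddSubgroup.toIntSubmodule.comap g.range.subtype := hx
  rw [← he] at this
  exact this

end MaxOrder

section

variable {F : Type} [Field F] [CharZero F] {A B : F}

theorem span_eq_top_of_anticomm {a b : F} (ha : a ≠ 0) (hb : b ≠ 0) {X Y : ℍ[F, A, B]}
    (hX : X * X = algebraMap F _ a) (hY : Y * Y = algebraMap F _ b) (hXY : X * Y = -(Y * X)) :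
    Submodule.span F (Set.range ![1, X, Y, Y * X]) = ⊤ := by
  have rX := re_eq_zero_of_anticomm hb hX hY hXY
  have rY := re_eq_zero_of_anticomm ha hY hX (by rw [hXY, neg_neg])
  have rYX : (Y * X).re = 0 := by
    have h1 := congrArg QuaternionAlgebra.re hXY
    have h2 : (X * Y).re = (Y * X).re := by simp; ring
    rw [h2, QuaternionAlgebra.re_neg, self_eq_neg] at h1
    exact h1
  have h1 : (1 : ℍ[F, A, B]).re = 1 := rfl
  refine LinearIndependent.span_eq_top_of_card_eq_finrank ?_ (by
    rw [QuaternionAlgebra.finrank_eq_four]; rfl)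
  rw [Fintype.linearIndependent_iff]
  intro g hg
  simp only [Fin.sum_univ_four, Matrix.cons_val_zero, Matrix.cons_val_one, Matrix.cons_val] at hg
  have eX : X * X = a • 1 := by rw [hX, Algebra.algebraMap_eq_smul_one]
  have eY : Y * Y = b • 1 := by rw [hY, Algebra.algebraMap_eq_smul_one]
  have eXYX : X * (Y * X) = -(a • Y) := by
    rw [← mul_assoc, hXY, neg_mul, mul_assoc, eX, mul_smul_comm, mul_one]
  have eYYX : Y * (Y * X) = b • X := by rw [← mul_assoc, eY, smul_mul_assoc, one_mul]
  have rXY : (X * Y).re = 0 := by rw [hXY, QuaternionAlgebra.re_neg, rYX, neg_zero]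
  have g0 : g 0 = 0 := by
    simpa [rX, rY, rYX, -QuaternionAlgebra.re_mul] using congrArg QuaternionAlgebra.re hg
  have g1 : g 1 = 0 := by
    simpa [mul_add, eX, eXYX, rX, rY, rXY, -QuaternionAlgebra.re_mul, ha] using
      congrArg QuaternionAlgebra.re (congrArg (X * ·) hg)
  have g2 : g 2 = 0 := by
    simpa [mul_add, eY, eYYX, rX, rY, rYX, -QuaternionAlgebra.re_mul, hb] using
      congrArg QuaternionAlgebra.re (congrArg (Y * ·) hg)
  have g3 : g 3 = 0 := by
    rw [g0, g1, g2] at hg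
    simp only [zero_smul, zero_add, smul_eq_zero] at hg
    refine hg.resolve_right fun h => ?_
    rw [h, mul_zero, eq_comm, neg_eq_zero] at eXYX
    have : Y = 0 := (smul_eq_zero.mp eXYX).resolve_left ha
    rw [this, mul_zero, eq_comm, map_eq_zero_iff _ (algebraMap F ℍ[F, A, B]).injective] at hY
    exact hb hY
  intro k
  fin_cases k <;> assumption

end

section

variable {F : Type} [Field F] [NumberField F] {H : Type} [Ring H] [Algebra F H]

theorem exists_isOrder {s : ℤ} {i w : H} (hi : i * i = -1) (hw : w * w = s * w - 1)
    (hiw : i * w = s * i - w * i) (hspan : Submodule.span F (Set.range ![1, i, w, w * i]) = ⊤) :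
    ∃ O : Subring H, IsOrder F O ∧ i ∈ O ∧ w ∈ O := by
  let : Algebra (𝓞 F) H := ((algebraMap F H).comp (algebraMap (𝓞 F) F)).toAlgebra'
    fun c x => Algebra.commutes (c : F) x
  have : IsScalarTower (𝓞 F) F H := IsScalarTower.of_algebraMap_eq fun _ => rfl
  let v : Fin 4 → H := ![1, i, w, w * i]
  let L : Submodule (𝓞 F) H := Submodule.span (𝓞 F) (Set.range v)
  have m0 : 1 ∈ L := Submodule.subset_span ⟨0, rfl⟩
  have m1 : i ∈ L := Submodule.subset_span ⟨1, rfl⟩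
  have m2 : w ∈ L := Submodule.subset_span ⟨2, rfl⟩
  have m3 : w * i ∈ L := Submodule.subset_span ⟨3, rfl⟩
  have hs : ∀ x ∈ L, (s : H) * x ∈ L := fun x hx => by
    rw [← zsmul_eq_mul]
    exact zsmul_mem hx s
  have hwi : w * i * w = i := by
    rw [mul_assoc, hiw, mul_sub, ← mul_assoc w w, hw, ← mul_assoc w, ← Int.cast_comm s w, sub_mul,
      one_mul]
    abel
  have hv : ∀ a b, v a * v b ∈ L := by
    have c1 : w * (w * i) = s * (w * i) - i := by
      rw [← mul_assoc, hw, sub_mul, one_mul, mul_assoc]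
    have c2 : i * (w * i) = -s + w := by
      rw [← mul_assoc, hiw, sub_mul, mul_assoc, mul_assoc, hi, mul_neg_one, mul_neg_one,
        sub_neg_eq_add]
    have c3 : w * i * i = -w := by rw [mul_assoc, hi, mul_neg_one]
    have c4 : w * i * (w * i) = -1 := by rw [← mul_assoc, hwi, hi]
    have n0 : (s : H) ∈ L := by simpa using hs 1 m0
    intro a b
    fin_cases a <;> fin_cases b <;> dsimp [v] <;>
      try simp only [one_mul, mul_one, hi, hw, hiw, hwi, c1, c2, c3, c4]
    exacts [m0, m1, m2, m3, m1, neg_mem m0, sub_mem (hs _ m1) m3, add_mem (neg_mem n0) m2,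
      m2, m3, sub_mem (hs _ m2) m0, sub_mem (hs _ m3) m1, m3, neg_mem m2, m1, neg_mem m0]
  have hmul : ∀ x y, x ∈ L → y ∈ L → x * y ∈ L := by
    intro x y hx hy
    have : L * L ≤ L := by
      rw [Submodule.span_mul_span, Submodule.span_le]
      rintro _ ⟨_, ⟨a, rfl⟩, _, ⟨b, rfl⟩, rfl⟩
      exact hv a b
    exact this (Submodule.mul_mem_mul hx hy)
  refine ⟨(L.toSubalgebra m0 hmul).toSubring, ⟨?_, ?_, ?_⟩, m1, m2⟩
  · rintro _ ⟨r, rfl⟩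
    exact (L.toSubalgebra m0 hmul).algebraMap_mem r
  · have h1 : L.FG := Submodule.fg_span (Set.finite_range v)
    have h2 : (L.restrictScalars ℤ).FG := h1.restrictScalars
    exact (Submodule.fg_iff_addSubgroup_fg _).mp h2
  · rw [eq_top_iff, ← hspan]
    exact Submodule.span_mono Submodule.subset_span

end

section

variable {G : Type*} [Group G]

theorem exists_finite_subgroup {x y : G} (h : x * y = y⁻¹ * x) (hx : IsOfFinOrder x)
    (hy : IsOfFinOrder y) : ∃ S : Subgroup G, (S : Set G).Finite ∧ x ∈ S ∧ y ∈ S := by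
  refine ⟨Subgroup.zpowers x ⊔ Subgroup.zpowers y, ?_, ?_, ?_⟩
  · rw [Subgroup.coe_mul_of_left_le_normalizer_right]
    · exact hx.finite_zpowers.mul hy.finite_zpowers
    · rw [Subgroup.zpowers_le, Subgroup.mem_normalizer_iff_map_conj_eq, MonoidHom.map_zpowers]
      change Subgroup.zpowers (x * y * x⁻¹) = _
      rw [h, mul_inv_cancel_right, Subgroup.zpowers_inv]
  · exact Subgroup.mem_sup_left (Subgroup.mem_zpowers x)
  · exact Subgroup.mem_sup_right (Subgroup.mem_zpowers y)

end

section

variable {F : Type} [Field F] [NumberField F] {A B : F}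

theorem exists_maximalOrder_of_dicyclic (hA : A ≠ 0) (hB : B ≠ 0) {i w : ℍ[F, A, B]} {s : ℤ}
    (hi : i * i = -1) (hw : w * w = s * w - 1) (hiw : i * w = s * i - w * i)
    (hspan : Submodule.span F (Set.range ![1, i, w, w * i]) = ⊤) (hw12 : w ^ 12 = 1)
    (hne : i * w ≠ w * i) :
    ∃ O : Subring ℍ[F, A, B], IsMaximalOrder F O ∧ ∃ S : Subgroup (↥O)ˣ,
      (S : Set (↥O)ˣ).Finite ∧ ∃ x ∈ S, ∃ y ∈ S, x * y ≠ y * x := by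
  obtain ⟨O₁, hO₁, mi, mw⟩ := exists_isOrder hi hw hiw hspan
  obtain ⟨O, hle, hO⟩ := exists_maximalOrder_ge hA hB hO₁
  have ms : (s : ℍ[F, A, B]) - w ∈ O := O.sub_mem (intCast_mem O s) (hle mw)
  have hcs := Int.cast_comm s w
  let x : (↥O)ˣ := ⟨⟨i, hle mi⟩, -⟨i, hle mi⟩, Subtype.ext (by simp [hi]),
    Subtype.ext (by simp [hi])⟩
  let y : (↥O)ˣ := ⟨⟨w, hle mw⟩, ⟨s - w, ms⟩, Subtype.ext (by simp [mul_sub, hw, hcs]),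
    Subtype.ext (by simp [sub_mul, hw])⟩
  have hxy : x * y = y⁻¹ * x := by
    refine Units.ext (Subtype.ext ?_)
    change i * w = (s - w) * i
    rw [hiw, sub_mul]
  have hx : x ^ 4 = 1 := by
    refine Units.ext (Subtype.ext ?_)
    change i ^ 4 = 1
    rw [pow_succ, pow_succ, pow_two, hi]
    simp [hi]
  have hy : y ^ 12 = 1 := Units.ext (Subtype.ext hw12)
  obtain ⟨S, hS, hxS, hyS⟩ := exists_finite_subgroup hxy
    (isOfFinOrder_iff_pow_eq_one.mpr ⟨4, by norm_num, hx⟩)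
    (isOfFinOrder_iff_pow_eq_one.mpr ⟨12, by norm_num, hy⟩)
  exact ⟨O, hO, S, hS, x, hxS, y, hyS, fun h =>
    hne (congrArg (fun u : (↥O)ˣ => ((u : ↥O) : ℍ[F, A, B])) h)⟩

theorem exists_maximalOrder_of_mod {p : ℕ} (Q : QuadField F p)
    (hdef : ∀ σ : F →+* ℝ, σ A < 0 ∧ σ B < 0) (h : LocApprox A B) (hp24 : p % 24 ≠ 1) :
    ∃ O : Subring ℍ[F, A, B], IsMaximalOrder F O ∧ ∃ S : Subgroup (↥O)ˣ,
      (S : Set (↥O)ˣ).Finite ∧ ∃ x ∈ S, ∃ y ∈ S, x * y ≠ y * x := by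
  have σ : F →+* ℝ := Q.realEmb
  have hA : A ≠ 0 := fun h => by simpa [h] using (hdef σ).1
  have hB : B ≠ 0 := fun h => by simpa [h] using (hdef σ).2
  have key : ∀ {i j : ℍ[F, A, B]} {e : F}, e ≠ 0 → i * i = -1 → j * j = algebraMap F _ (-e) →
      i * j = -(j * i) → Submodule.span F (Set.range ![1, i, j, j * i]) = ⊤ ∧ i * j ≠ j * i := by
    intro i j e he hi hj hij
    refine ⟨span_eq_top_of_anticomm (a := -1) (by simp) (neg_ne_zero.mpr he) (by simpa using hi) hj
      hij, fun h => ?_⟩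
    have h2 : (2 : F) • (j * i) = 0 := by
      rw [two_smul]
      nth_rewrite 1 [← h]
      rw [hij, neg_add_cancel]
    have : j = 0 := by
      have := congrArg (· * i) ((smul_eq_zero.mp h2).resolve_left two_ne_zero)
      simpa [mul_assoc, hi] using this
    rw [this, mul_zero, eq_comm, map_eq_zero_iff _ (algebraMap F ℍ[F, A, B]).injective,
      neg_eq_zero] at hj
    exact he hj
  rcases Q.exists_pf_eq_pf_one (C := -A) (D := -B) (fun σ => by simpa using (hdef σ).1)
    (fun σ => by simpa using (hdef σ).2) (by simpa using h) hp24 with h | h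
  · obtain ⟨i, j, hi, hj, hij⟩ := exists_anticomm_of_pf σ (hdef σ).1 (hdef σ).2 one_ne_zero h
    obtain ⟨hs, hne⟩ := key one_ne_zero hi hj hij
    have hj' : j * j = -1 := by simpa using hj
    refine exists_maximalOrder_of_dicyclic hA hB (s := 0) hi (by simpa using hj)
      (by simpa using hij) hs ?_ hne
    rw [show 12 = 2 * 6 from rfl, pow_mul, pow_two, hj']
    exact Even.neg_one_pow (by decide)
  · obtain ⟨i, j, hi, hj, hij⟩ := exists_anticomm_of_pf σ (hdef σ).1 (hdef σ).2 three_ne_zero h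
    obtain ⟨hs, hne⟩ := key three_ne_zero hi hj hij
    have hj' : j * j = (-3 : F) • 1 := by rw [hj, Algebra.algebraMap_eq_smul_one]
    let w : ℍ[F, A, B] := (2⁻¹ : F) • (1 + j)
    have h2w : j = (2 : F) • w - 1 := by simp [w, smul_smul]
    have hw : w * w = w - 1 := by
      simp only [w, smul_mul_smul, add_mul, mul_add, one_mul, mul_one, hj']
      module
    have hiw : i * w = i - w * i := by
      simp only [w, mul_smul_comm, smul_mul_assoc, mul_add, add_mul, one_mul, mul_one, hij]
      module
    refine exists_maximalOrder_of_dicyclic hA hB (s := 1) (w := w) hi (by simpa using hw)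
      (by simpa using hiw) ?_ ?_ ?_
    · rw [eq_top_iff, ← hs, Submodule.span_le, Set.range_subset_iff]
      let L := Submodule.span F (Set.range ![1, i, w, w * i])
      have m0 : 1 ∈ L := Submodule.subset_span ⟨0, rfl⟩
      have m1 : i ∈ L := Submodule.subset_span ⟨1, rfl⟩
      have m2 : w ∈ L := Submodule.subset_span ⟨2, rfl⟩
      have m3 : w * i ∈ L := Submodule.subset_span ⟨3, rfl⟩
      have m4 : j ∈ L := h2w ▸ L.sub_mem (L.smul_mem _ m2) m0
      have m5 : j * i ∈ L := by
        rw [h2w, sub_mul, smul_mul_assoc, one_mul]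
        exact L.sub_mem (L.smul_mem _ m3) m1
      intro k
      fin_cases k
      exacts [m0, m1, m4, m5]
    · have h3 : w ^ 3 = -1 := by
        rw [pow_succ, pow_two, hw, sub_mul, one_mul, hw]
        abel
      rw [show 12 = 3 * 4 from rfl, pow_mul, h3]
      exact Even.neg_one_pow (by decide)
    · intro h
      refine hne ?_
      rw [h2w, mul_sub, sub_mul, mul_smul_comm, smul_mul_assoc, h, mul_one, one_mul]

end

section

variable {K : Type} [Field K] {A B : K}

theorem qb_mul_self (x y : ℍ[K, A, B]) : qb (x * y) (x * y) = qb x x * qb y y := by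
  simp [qb]
  ring

theorem qb_pow_self (x : ℍ[K, A, B]) (n : ℕ) : qb (x ^ n) (x ^ n) = qb x x ^ n := by
  induction n with
  | zero => simp [qb]
  | succ n ih => rw [pow_succ, qb_mul_self, ih, pow_succ]

theorem qb_commutator_self (x y : ℍ[K, A, B]) : qb (x * y - y * x) (x * y - y * x) =
    4 * qb x x * qb y y + 2 * x.re * (2 * y.re) * (2 * (x * y).re) - (2 * x.re) ^ 2 * qb y y -
      (2 * y.re) ^ 2 * qb x x - (2 * (x * y).re) ^ 2 := by
  simp [qb]
  ring

theorem re_sq_le (σ : K →+* ℝ) (hA : σ A < 0) (hB : σ B < 0) (x : ℍ[K, A, B]) :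
    σ x.re ^ 2 ≤ σ (qb x x) := by
  have hAB := mul_pos_of_neg_of_neg hA hB
  have s1 := mul_nonneg (neg_pos.mpr hA).le (mul_self_nonneg (σ x.imI))
  have s2 := mul_nonneg (neg_pos.mpr hB).le (mul_self_nonneg (σ x.imJ))
  have s3 := mul_nonneg hAB.le (mul_self_nonneg (σ x.imK))
  simp only [qb, map_add, map_sub, map_mul]
  linarith

theorem qb_self_pos (σ : K →+* ℝ) (hA : σ A < 0) (hB : σ B < 0) {x : ℍ[K, A, B]} (hx : x ≠ 0) :
    0 < σ (qb x x) := by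
  by_contra hn
  have hAB := mul_pos_of_neg_of_neg hA hB
  have s0 := mul_self_nonneg (σ x.re)
  have s1 := mul_nonneg (neg_pos.mpr hA).le (mul_self_nonneg (σ x.imI))
  have s2 := mul_nonneg (neg_pos.mpr hB).le (mul_self_nonneg (σ x.imJ))
  have s3 := mul_nonneg hAB.le (mul_self_nonneg (σ x.imK))
  simp only [qb, map_add, map_sub, map_mul] at hn
  have z0 : σ x.re * σ x.re = 0 := by linarith
  have z1 : -σ A * (σ x.imI * σ x.imI) = 0 := by linarith
  have z2 : -σ B * (σ x.imJ * σ x.imJ) = 0 := by linarith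
  have z3 : σ A * σ B * (σ x.imK * σ x.imK) = 0 := by linarith
  simp only [mul_eq_zero, neg_eq_zero, hA.ne, hB.ne, false_or, or_self, map_eq_zero] at z0 z1 z2 z3
  exact hx (QuaternionAlgebra.ext z0 z1 z2 z3)

theorem qb_self_eq_one (σ : K →+* ℝ) (hA : σ A < 0) (hB : σ B < 0) {x : ℍ[K, A, B]} {n : ℕ}
    (hn : n ≠ 0) (hx : x ^ n = 1) : qb x x = 1 := by
  have h1 : x ≠ 0 := by
    rintro rfl
    rw [zero_pow hn] at hx
    exact zero_ne_one hx
  have h2 : σ (qb x x) ^ n = 1 := by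
    rw [← map_pow, ← qb_pow_self, hx]
    simp [qb]
  apply σ.injective
  rw [map_one]
  exact (pow_eq_one_iff_of_nonneg (qb_self_pos σ hA hB h1).le hn).mp h2

end

section

variable {F : Type} [Field F] [NumberField F] {A B : F} {p : ℕ}

theorem QuadField.exists_int_of_abs_le (Q : QuadField F p) (hp : 16 < p) {t : F}
    (ht : IsIntegral ℤ t) (h : ∀ σ : F →+* ℝ, |σ t| ≤ 2) : ∃ m : ℤ, t = m ∧ |m| ≤ 2 := by
  obtain ⟨a, b, ha, hb⟩ := Q.exists_int_coords ht
  have h1 := h Q.realEmb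
  have h2 := h Q.realEmb'
  have hs : √(p : ℝ) * √(p : ℝ) = p := Real.mul_self_sqrt (Nat.cast_nonneg p)
  have hb0 : b = 0 := by
    have e : Q.realEmb t - Q.realEmb' t = b * √p := by
      simp only [QuadField.realEmb, QuadField.realEmb', Q.emb_apply]
      have : (b : ℝ) = 2 * Q.im t := by exact_mod_cast hb.symm
      rw [this]
      ring
    have h3 : |(b : ℝ) * √p| ≤ 4 := by
      rw [← e]
      exact (abs_sub _ _).trans (by linarith)
    have h4 : ((b : ℝ) * √p) ^ 2 ≤ 4 ^ 2 := sq_le_sq' (abs_le.mp h3).1 (abs_le.mp h3).2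
    have h5 : (b ^ 2 * p : ℤ) ≤ 16 := by
      have : (b : ℝ) ^ 2 * p ≤ 16 := by nlinarith
      exact_mod_cast this
    by_contra hb0
    have h6 : 1 ≤ b ^ 2 := Int.one_le_abs (pow_ne_zero 2 hb0) |>.trans_eq (abs_of_nonneg (sq_nonneg b))
    have h7 : (16 : ℤ) < p := by exact_mod_cast hp
    nlinarith
  have him : Q.im t = 0 := by
    have : 2 * Q.im t = 0 := by rw [hb, hb0]; simp
    linarith
  have hre : t = (Q.re t : F) := by
    conv_lhs => rw [Q.rep t, him]
    simp
  rw [hre] at ht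
  obtain ⟨m, hm⟩ := QuadField.isIntegral_rat ht
  rw [hm] at hre
  have hre' : t = m := by simpa using hre
  refine ⟨m, hre', ?_⟩
  rw [hre', map_intCast] at h1
  exact_mod_cast h1

theorem exists_pf_eq_of_noncommuting (Q : QuadField F p) (hp : 16 < p)
    (hdef : ∀ σ : F →+* ℝ, σ A < 0 ∧ σ B < 0) {O : Subring ℍ[F, A, B]} (hO : O.toAddSubgroup.FG)
    {S : Subgroup (↥O)ˣ} (hS : (S : Set (↥O)ˣ).Finite) {x y : (↥O)ˣ} (hx : x ∈ S) (hy : y ∈ S)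
    (hxy : x * y ≠ y * x) :
    ∃ a b : ℤ, ((a = 4 ∨ a = 3) ∧ (b = 4 ∨ b = 3 ∨ b = 2) ∧ ¬ (a = 3 ∧ b = 4)) ∧
      pf (-A) (-B) = pf (a : F) (b : F) := by
  let q : (↥O)ˣ → ℍ[F, A, B] := fun u => ((u : ↥O) : ℍ[F, A, B])
  have σ : F →+* ℝ := Q.realEmb
  have hA : A ≠ 0 := fun h => by simpa [h] using (hdef σ).1
  have hB : B ≠ 0 := fun h => by simpa [h] using (hdef σ).2
  have hq1 : ∀ u ∈ S, qb (q u) (q u) = 1 := by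
    intro u hu
    have : Finite S := hS
    obtain ⟨n, hn, h⟩ := isOfFinOrder_iff_pow_eq_one.mp (isOfFinOrder_of_finite (⟨u, hu⟩ : S))
    refine qb_self_eq_one σ (hdef σ).1 (hdef σ).2 hn.ne' ?_
    have h' : u ^ n = 1 := congrArg Subtype.val h
    exact congrArg q h'
  have hqt : ∀ u ∈ S, ∃ m : ℤ, 2 * (q u).re = m ∧ |m| ≤ 2 := by
    intro u hu
    refine Q.exists_int_of_abs_le hp
      (isIntegral_trace_norm (isIntegral_of_mem_subring hO (u : ↥O).2)).1 fun τ => ?_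
    have := re_sq_le τ (hdef τ).1 (hdef τ).2 (q u)
    rw [hq1 u hu, map_one, sq_le_one_iff_abs_le_one] at this
    rw [map_mul, abs_mul, map_ofNat, abs_two]
    change 2 * |τ (q u).re| ≤ 2
    linarith
  have hsq : ∀ u ∈ S, ∀ m : ℤ, 2 * (q u).re = m →
      qb (2 * q u - (m : ℍ[F, A, B])) (2 * q u - (m : ℍ[F, A, B])) = ((4 - m ^ 2 : ℤ) : F) := by
    intro u hu m hm
    have e : qb (2 * q u - (m : ℍ[F, A, B])) (2 * q u - (m : ℍ[F, A, B])) =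
        4 * qb (q u) (q u) - 2 * m * (2 * (q u).re) + m ^ 2 := by
      rw [← map_intCast (algebraMap F ℍ[F, A, B]), two_mul]
      simp [qb]
      ring
    rw [e, hq1 u hu, hm]
    push_cast
    ring
  have hqc : ∀ u ∈ S, ∀ m : ℤ, 2 * (q u).re = m → |m| ≤ 2 → (∃ v, u * v ≠ v * u) → |m| ≤ 1 := by
    rintro u hu m hm h2 ⟨v, hv⟩
    by_contra h1
    have h4 : m ^ 2 = 4 := by
      have : |m| = 2 := by omega
      rw [← sq_abs, this]
      norm_num
    have h0 : 2 * q u - m = 0 := by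
      by_contra h0
      have := qb_self_pos σ (hdef σ).1 (hdef σ).2 h0
      rw [hsq u hu m hm, h4] at this
      simp at this
    have e : q u = algebraMap F _ (2⁻¹ * m) := by
      rw [map_mul, map_intCast, ← sub_eq_zero.mp h0, ← mul_assoc,
        ← map_ofNat (algebraMap F ℍ[F, A, B]) 2, ← map_mul]
      simp
    refine hv (Units.ext (Subtype.ext ?_))
    change q u * q v = q v * q u
    rw [e, Algebra.commutes]
  obtain ⟨m₁, e₁, b₁⟩ := hqt x hx
  obtain ⟨m₂, e₂, b₂⟩ := hqt y hy
  obtain ⟨m₃, e₃, b₃⟩ := hqt (x * y) (S.mul_mem hx hy)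
  have c₁ := hqc x hx m₁ e₁ b₁ ⟨y, hxy⟩
  have c₂ := hqc y hy m₂ e₂ b₂ ⟨x, hxy.symm⟩
  have c₃ := hqc (x * y) (S.mul_mem hx hy) m₃ e₃ b₃ ⟨x, fun h => hxy (by
    rw [mul_assoc, mul_right_inj] at h
    exact h.symm)⟩
  have hY : q x * q y - q y * q x ≠ 0 := fun h =>
    hxy (Units.ext (Subtype.ext (sub_eq_zero.mp h)))
  have hYY : qb (q x * q y - q y * q x) (q x * q y - q y * q x) =
      ((4 + m₁ * m₂ * m₃ - m₁ ^ 2 - m₂ ^ 2 - m₃ ^ 2 : ℤ) : F) := by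
    rw [qb_commutator_self, hq1 x hx, hq1 y hy, e₁, e₂, show q x * q y = q (x * y) from rfl, e₃]
    push_cast
    ring
  have hYpos : 0 < 4 + m₁ * m₂ * m₃ - m₁ ^ 2 - m₂ ^ 2 - m₃ ^ 2 := by
    have := qb_self_pos σ (hdef σ).1 (hdef σ).2 hY
    rw [hYY, map_intCast] at this
    exact_mod_cast this
  have hab : ((4 - m₁ ^ 2 = 4 ∨ 4 - m₁ ^ 2 = 3) ∧ (4 + m₁ * m₂ * m₃ - m₁ ^ 2 - m₂ ^ 2 - m₃ ^ 2 = 4 ∨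
      4 + m₁ * m₂ * m₃ - m₁ ^ 2 - m₂ ^ 2 - m₃ ^ 2 = 3 ∨
      4 + m₁ * m₂ * m₃ - m₁ ^ 2 - m₂ ^ 2 - m₃ ^ 2 = 2) ∧
      ¬ (4 - m₁ ^ 2 = 3 ∧ 4 + m₁ * m₂ * m₃ - m₁ ^ 2 - m₂ ^ 2 - m₃ ^ 2 = 4)) := by
    rw [abs_le] at c₁ c₂ c₃
    obtain ⟨l₁, r₁⟩ := c₁
    obtain ⟨l₂, r₂⟩ := c₂
    obtain ⟨l₃, r₃⟩ := c₃
    interval_cases m₁ <;> interval_cases m₂ <;> interval_cases m₃ <;> revert hYpos <;> decide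
  refine ⟨_, _, hab, ?_⟩
  have ha0 : 4 - m₁ ^ 2 ≠ 0 := by omega
  have rX : (2 * q x - (m₁ : ℍ[F, A, B])).re = 0 := by
    rw [← map_intCast (algebraMap F ℍ[F, A, B]), two_mul, ← e₁]
    simp [QuaternionAlgebra.algebraMap_eq]
    ring
  have rY : (q x * q y - q y * q x).re = 0 := by
    simp
    ring
  refine pf_eq_of_anticomm hA hB (by exact_mod_cast ha0) (by exact_mod_cast hYpos.ne')
    (X := 2 * q x - m₁) (Y := q x * q y - q y * q x) ?_ ?_ (mul_eq_neg_of_qb rX rY ?_)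
  · rw [mul_self_of_re_eq_zero rX, hsq x hx m₁ e₁]
  · rw [mul_self_of_re_eq_zero rY, hYY]
  · rw [← map_intCast (algebraMap F ℍ[F, A, B]), two_mul]
    simp [qb]
    ring

end

section

variable {K : Type} [Field K]

theorem exists_isotropic_of_metab {ι : Type} [Fintype ι] [Nonempty ι] {a : ι → Kˣ} (h : Metab a) :
    ∃ x : ι → K, x ≠ 0 ∧ ∑ i, (a i : K) * x i * x i = 0 := by
  obtain ⟨M, hM, hd⟩ := h
  have h0 : M ≠ ⊥ := by
    rintro rfl
    rw [finrank_bot] at hd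
    exact Fintype.card_ne_zero (Nat.le_zero.mp hd)
  obtain ⟨x, hx, hx0⟩ := M.ne_bot_iff.mp h0
  exact ⟨x, hx0, hM x hx x hx⟩

theorem exists_isotropic_of_pf_eq_zero {a b : K} (ha : a ≠ 0) (hb : b ≠ 0) (h : pf a b = 0) :
    ∃ x : Fin 4 → K, x ≠ 0 ∧
      x 0 * x 0 + a * (x 1 * x 1) + b * (x 2 * x 2) + a * b * (x 3 * x 3) = 0 := by
  have hm : Metab ![1, Units.mk0 _ ha, Units.mk0 _ hb, Units.mk0 _ (mul_ne_zero ha hb)] := by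
    rw [← sum_cls_eq_zero_iff]
    simp only [Fin.sum_univ_four, Matrix.cons_val_zero, Matrix.cons_val_one, Matrix.cons_val]
    simp only [← frm_units, Units.val_one, Units.val_mk0]
    exact h
  obtain ⟨x, hx, h⟩ := exists_isotropic_of_metab hm
  refine ⟨x, hx, ?_⟩
  simp only [Fin.sum_univ_four, Matrix.cons_val_zero, Matrix.cons_val_one, Matrix.cons_val,
    Units.val_one, Units.val_mk0] at h
  linear_combination h

theorem pf_neg_sq (u c : K) (hu : u ≠ 0) : pf (-u ^ 2) c = 0 := by
  have e1 : -u ^ 2 = -1 * u ^ 2 := by ring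
  have e2 : -u ^ 2 * c = -c * u ^ 2 := by ring
  rw [pf, e2, e1, frm_mul_sq _ hu, frm_mul_sq _ hu, frm_neg, frm_neg]
  abel

end

theorem frm_one_add_frm_one_zmod_three_ne_zero : (frm 1 + frm 1 : Witt (ZMod 3)) ≠ 0 := by
  intro h
  have hm : Metab (fun _ : Fin 2 => (1 : (ZMod 3)ˣ)) := by
    rw [← sum_cls_eq_zero_iff, Fin.sum_univ_two, ← frm_units, Units.val_one]
    exact h
  obtain ⟨x, hx, h⟩ := exists_isotropic_of_metab hm
  simp only [Fin.sum_univ_two, Units.val_one, one_mul] at h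
  have key : ∀ a b : ZMod 3, a * a + b * b = 0 → a = 0 ∧ b = 0 := by decide
  obtain ⟨h0, h1⟩ := key _ _ h
  refine hx (funext fun i => ?_)
  fin_cases i <;> assumption

section TwoAdic

theorem isSquare_of_norm_sub_one_lt {z : ℤ_[2]} (h : ‖z - 1‖ < 1 / 4) : IsSquare z := by
  have h2 : ‖(2 : ℤ_[2])‖ = 1 / 2 := by simpa using PadicInt.norm_p (p := 2)
  obtain ⟨w, hw, -⟩ := hensels_lemma (p := 2) (R := ℤ_[2])
    (F := Polynomial.X ^ 2 - Polynomial.C z) (a := 1) (by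
      simp only [Polynomial.derivative_X_pow, Polynomial.derivative_C,
        map_sub, map_pow, map_mul, Polynomial.aeval_X, Polynomial.aeval_C]
      rw [norm_sub_rev]
      simp [h2]
      norm_num at h ⊢
      exact h)
  refine ⟨w, ?_⟩
  simp at hw
  linear_combination -hw

theorem zmod_sixteen_mul_self (x : ZMod 16) : x * x = 0 ∨ x * x = 1 ∨ x * x = 4 ∨ x * x = 9 := by
  revert x
  decide

theorem eq_zero_of_zmod_sixteen {a b c : ℤ} (hmod : ∀ x : Fin 4 → ZMod 16,
      x 0 * x 0 + a * (x 1 * x 1) + b * (x 2 * x 2) + c * (x 3 * x 3) = 0 → ∀ i, x i ≠ 1)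
    {x : Fin 4 → ℚ_[2]}
    (hx : x 0 * x 0 + a * (x 1 * x 1) + b * (x 2 * x 2) + c * (x 3 * x 3) = 0) : x = 0 := by
  by_contra h0
  obtain ⟨k, hk⟩ := Finite.exists_max fun i => ‖x i‖
  have hk0 : x k ≠ 0 := fun h => h0 (funext fun i => by
    have := hk i
    rw [h, norm_zero] at this
    simpa using this)
  let y : Fin 4 → ℤ_[2] := fun i => ⟨x i / x k, by
    rw [norm_div]
    exact div_le_one_of_le₀ (hk i) (norm_nonneg _)⟩
  have hyk : y k = 1 := Subtype.ext (div_self hk0)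
  have hy : y 0 * y 0 + a * (y 1 * y 1) + b * (y 2 * y 2) + c * (y 3 * y 3) = 0 := by
    apply Subtype.ext
    push_cast
    simp only [y]
    field_simp
    linear_combination hx
  refine hmod (fun i => PadicInt.toZModPow 4 (y i)) ?_ k (by simp only [hyk, map_one])
  have := congrArg (PadicInt.toZModPow (p := 2) 4) hy
  simpa only [map_add, map_mul, map_zero, map_intCast] using this

theorem norm_le_one_of_ringOfIntegers {F : Type} [Field F] {ℓ : ℕ} [Fact ℓ.Prime] (τ : F →+* ℚ_[ℓ]) (w : 𝓞 F) :
    ‖τ w‖ ≤ 1 := by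
  have h : IsIntegral ℤ (τ w) := w.2.map τ.toIntAlgHom
  have h' : IsIntegral ℤ_[ℓ] (τ w) := h.tower_top
  obtain ⟨z, hz⟩ := IsIntegrallyClosed.isIntegral_iff.mp h'
  rw [← hz]
  exact z.2

theorem exists_sq_of_mod_eight {p : ℕ} (hp : p % 8 = 1) : ∃ t : ℚ_[2], t ^ 2 = p := by
  obtain ⟨w, hw⟩ := isSquare_of_norm_sub_one_lt (z := (p : ℤ_[2])) (by
    have h : (p : ℤ_[2]) - 1 = 2 ^ 3 * ((p / 8 : ℕ) : ℤ_[2]) := by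
      have : (p : ℤ_[2]) = ((8 * (p / 8) + 1 : ℕ) : ℤ_[2]) := by congr 1; omega
      rw [this]
      push_cast
      ring
    have h2 : ‖(2 : ℤ_[2])‖ = 1 / 2 := by simpa using PadicInt.norm_p (p := 2)
    rw [h, norm_mul, norm_pow, h2]
    have := PadicInt.norm_le_one ((p / 8 : ℕ) : ℤ_[2])
    norm_num
    linarith)
  refine ⟨w, ?_⟩
  rw [pow_two]
  exact_mod_cast congrArg (Subtype.val) hw.symm

variable {F : Type} [Field F] [NumberField F]

theorem pf_padic_two_eq_zero {C D : F} (hC : C ≠ 0) (hD : D ≠ 0) (h : LocApprox (-C) (-D))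
    (τ : F →+* ℚ_[2]) : pf (τ C) (τ D) = 0 := by
  obtain ⟨x, y, z, n, w, hn, e⟩ := h 2 3 Nat.prime_two
  set u := sqv (-C) (-D) x y z with hu
  have hn1 : ‖(n : ℚ_[2])‖ = 1 := by
    rw [Padic.norm_natCast_eq_one_iff, Nat.coprime_comm]
    exact Nat.coprime_comm.mp ((Nat.Prime.coprime_iff_not_dvd Nat.prime_two).mpr hn)
  have h2 : ‖(2 : ℚ_[2])‖ = 1 / 2 := by simpa using Padic.norm_p (p := 2)
  have hle : ‖τ u - 1‖ ≤ 1 / 8 := by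
    have e' := congrArg (fun a => ‖τ a‖) e
    simp only [map_mul, map_sub, map_pow, map_natCast, map_one, norm_mul, norm_pow, hn1, one_mul,
      Nat.cast_ofNat, map_ofNat, h2] at e'
    rw [e']
    have := norm_le_one_of_ringOfIntegers τ w
    linarith
  have hu1 : ‖τ u‖ ≤ 1 := by
    have := Padic.nonarchimedean (τ u - 1) 1
    rw [sub_add_cancel, norm_one] at this
    exact this.trans (max_le (hle.trans (by norm_num)) le_rfl)
  obtain ⟨v, hv⟩ := isSquare_of_norm_sub_one_lt (z := ⟨τ u, hu1⟩) (lt_of_le_of_lt hle (by norm_num))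
  have hv' : τ u = (v : ℚ_[2]) ^ 2 := by
    rw [pow_two]
    exact congrArg Subtype.val hv
  have hu0 : u ≠ 0 := by
    intro h0
    rw [h0, map_zero, zero_sub, norm_neg, norm_one] at hle
    norm_num at hle
  obtain ⟨E, hE, hpf⟩ := exists_pf_eq (q := -u) hC hD (x := x) (y := y) (z := z)
    (by rw [hu, sqv]; ring) (neg_ne_zero.mpr hu0)
  rw [← baseChange_pf, hpf, baseChange_pf, map_neg, hv']
  refine pf_neg_sq _ _ fun h0 => hu0 ?_
  rw [h0, zero_pow two_ne_zero] at hv'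
  exact (map_eq_zero τ).mp hv'

end TwoAdic

theorem pf_four {K : Type} [Field K] [CharZero K] (b : K) : pf 4 b = pf 1 b := by
  have h2 : (2 : K) ≠ 0 := two_ne_zero
  have e1 : (4 : K) = 1 * 2 ^ 2 := by norm_num
  have e2 : (4 : K) * b = 1 * b * 2 ^ 2 := by ring
  rw [pf, pf, e2, e1, frm_mul_sq _ h2, frm_mul_sq _ h2]

theorem dl_three_pf_one_three : dl 3 (pf 1 3) = frm 1 + frm 1 := by
  have h : dl 3 (frm (3 : ℚ)) = frm 1 := by simpa using dl_frm_self (ℓ := 3)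
  simp [pf, dl_frm_one, h]

theorem dl_three_pf_three_three : dl 3 (pf 3 3) = frm 1 + frm 1 := by
  have h : dl 3 (frm (3 : ℚ)) = frm 1 := by simpa using dl_frm_self (ℓ := 3)
  have e : frm ((3 : ℚ) * 3) = frm 1 := by
    rw [← frm_mul_sq 1 (three_ne_zero (α := ℚ))]
    norm_num
  simp [pf, dl_frm_one, h, e]

theorem zmod_sixteen_anisotropic {a b c : ZMod 16}
    (h : ∀ s t u : ZMod 16, (s = 0 ∨ s = 1 ∨ s = 4 ∨ s = 9) → (t = 0 ∨ t = 1 ∨ t = 4 ∨ t = 9) →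
      (u = 0 ∨ u = 1 ∨ u = 4 ∨ u = 9) → 1 + a * s + b * t + c * u ≠ 0 ∧
      s + a + b * t + c * u ≠ 0 ∧ s + a * t + b + c * u ≠ 0 ∧ s + a * t + b * u + c ≠ 0)
    (x : Fin 4 → ZMod 16)
    (hx : x 0 * x 0 + a * (x 1 * x 1) + b * (x 2 * x 2) + c * (x 3 * x 3) = 0) (i : Fin 4) :
    x i ≠ 1 := by
  intro hi
  have sq := fun j => zmod_sixteen_mul_self (x j)
  fin_cases i <;> simp only [Fin.zero_eta, Fin.mk_one, Fin.reduceFinMk] at hi <;>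
    simp only [hi, mul_one] at hx
  · exact (h _ _ _ (sq 1) (sq 2) (sq 3)).1 hx
  · exact (h _ _ _ (sq 0) (sq 2) (sq 3)).2.1 hx
  · exact (h _ _ _ (sq 0) (sq 1) (sq 3)).2.2.1 hx
  · exact (h _ _ _ (sq 0) (sq 1) (sq 2)).2.2.2 hx

theorem pf_padic_two_ne_zero {a b : ℤ} (ha : a ≠ 0) (hb : b ≠ 0)
    (h : ∀ s t u : ZMod 16, (s = 0 ∨ s = 1 ∨ s = 4 ∨ s = 9) → (t = 0 ∨ t = 1 ∨ t = 4 ∨ t = 9) →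
      (u = 0 ∨ u = 1 ∨ u = 4 ∨ u = 9) → 1 + a * s + b * t + (a * b : ℤ) * u ≠ 0 ∧
      s + a + b * t + (a * b : ℤ) * u ≠ 0 ∧ s + a * t + b + (a * b : ℤ) * u ≠ 0 ∧
      s + a * t + b * u + (a * b : ℤ) ≠ 0) :
    pf (a : ℚ_[2]) b ≠ 0 := by
  intro h0
  obtain ⟨x, hx0, hx⟩ := exists_isotropic_of_pf_eq_zero (by exact_mod_cast ha)
    (by exact_mod_cast hb) h0
  exact hx0 (eq_zero_of_zmod_sixteen (c := a * b) (zmod_sixteen_anisotropic h) (by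
    push_cast
    exact hx))

theorem pf_one_one_padic_two_ne_zero : pf (1 : ℚ_[2]) 1 ≠ 0 := by
  have := pf_padic_two_ne_zero (a := 1) (b := 1) one_ne_zero one_ne_zero (by decide)
  simpa using this

theorem pf_one_two_padic_two_ne_zero : pf (1 : ℚ_[2]) 2 ≠ 0 := by
  have := pf_padic_two_ne_zero (a := 1) (b := 2) one_ne_zero two_ne_zero (by decide)
  simpa using this

theorem pf_three_two_padic_two_ne_zero : pf (3 : ℚ_[2]) 2 ≠ 0 := by
  have := pf_padic_two_ne_zero (a := 3) (b := 2) three_ne_zero two_ne_zero (by decide)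
  simpa using this

section

variable {F : Type} [Field F] [NumberField F] {A B : F} {p : ℕ}

theorem mod_ne_one_of_noncommuting (Q : QuadField F p) (hp : p.Prime)
    (hdef : ∀ σ : F →+* ℝ, σ A < 0 ∧ σ B < 0) (h : LocApprox A B)
    {O : Subring ℍ[F, A, B]} (hO : O.toAddSubgroup.FG)
    {S : Subgroup (↥O)ˣ} (hS : (S : Set (↥O)ˣ).Finite) {x y : (↥O)ˣ} (hx : x ∈ S) (hy : y ∈ S)
    (hxy : x * y ≠ y * x) : p % 24 ≠ 1 := by
  intro hm
  have h16 : 16 < p := by have := hp.one_lt; omega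
  obtain ⟨a, b, hab, hpf⟩ := exists_pf_eq_of_noncommuting Q h16 hdef hO hS hx hy hxy
  have hA : -A ≠ 0 := fun h => by simpa [neg_eq_zero.mp h] using (hdef Q.realEmb).1
  have hB : -B ≠ 0 := fun h => by simpa [neg_eq_zero.mp h] using (hdef Q.realEmb).2
  rw [← neg_neg A, ← neg_neg B] at h
  obtain ⟨t, ht⟩ := exists_sq_of_mod_eight (p := p) (by omega)
  have two : pf (a : ℚ_[2]) b = 0 := by
    have := pf_padic_two_eq_zero hA hB h (Q.emb t ht)
    rw [← baseChange_pf, hpf, baseChange_pf] at this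
    simpa using this
  have hp3 : (p : ZMod 3) = 1 := by
    rw [← Nat.cast_one, ZMod.natCast_eq_natCast_iff']
    omega
  have three : dl 3 (pf (a : ℚ) b) = 0 :=
    Q.dl_pf_eq_zero hA hB h (by exact_mod_cast hpf) (by norm_num) (by rw [hp3]; exact one_ne_zero)
      (by rw [hp3]; exact IsSquare.one)
  obtain ⟨rfl | rfl, rfl | rfl | rfl, h'⟩ := hab
  · push_cast at two
    rw [pf_four, pf_comm, pf_four] at two
    exact pf_one_one_padic_two_ne_zero two
  · push_cast at three
    rw [pf_four, dl_three_pf_one_three] at three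
    exact frm_one_add_frm_one_zmod_three_ne_zero three
  · push_cast at two
    rw [pf_four] at two
    exact pf_one_two_padic_two_ne_zero two
  · exact h' ⟨rfl, rfl⟩
  · push_cast at three
    rw [dl_three_pf_three_three] at three
    exact frm_one_add_frm_one_zmod_three_ne_zero three
  · push_cast at two
    exact pf_three_two_padic_two_ne_zero two

end

/-- **Existence of a maximal order with non-abelian finite unit subgroup.** -/
theorem exists_maximalOrder_nonabelian_units_iff
    (p : ℕ) (hp : p.Prime)
    (sqrtp : F) (hsqrtp : sqrtp ^ 2 = (p : F))
    (hgen : Algebra.adjoin ℚ {sqrtp} = ⊤)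
    -- `H = ℍ[F, A, B]` is a totally definite quaternion `F`-algebra (every totally
    -- definite quaternion algebra admits such a presentation) ...
    (A B : F) (hdef : ∀ σ : F →+* ℝ, σ A < 0 ∧ σ B < 0)
    -- ... unramified at every finite place of `F`
    (hunram : ∀ v : IsDedekindDomain.HeightOneSpectrum (𝓞 F),
      Nonempty
        (ℍ[v.adicCompletion F, algebraMap F (v.adicCompletion F) A,
            algebraMap F (v.adicCompletion F) B] ≃ₐ[v.adicCompletion F]
          Matrix (Fin 2) (Fin 2) (v.adicCompletion F))) :
    (∃ O : Subring ℍ[F, A, B], IsMaximalOrder F O ∧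
        ∃ S : Subgroup (↥O)ˣ, (S : Set (↥O)ˣ).Finite ∧
          ∃ x ∈ S, ∃ y ∈ S, x * y ≠ y * x) ↔
      p % 24 ≠ 1 := by
  let Q := QuadField.mk' hp hsqrtp hgen
  have happ : LocApprox A B := fun ℓ k hℓ => exists_approx hunram hℓ k
  constructor
  · rintro ⟨O, hO, S, hS, x, hx, y, hy, hxy⟩
    exact mod_ne_one_of_noncommuting Q hp hdef happ hO.1.2.1 hS hx hy hxy
  · exact exists_maximalOrder_of_mod Q hdef happ

end QuatPaper
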